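/- Let n ≥ 1 and k ≥ 0 be natural numbers with 1 ≤ 4k+1 ≤ 2n−1. Then for every continuous map f ∈ C(S^{2n+1}, Γ_{n+1}⁺), the homotopy group π_{4k+2}(C(S^{2n+1}, Γ_{n+1}⁺), f) contains an element of infinite order; equivalently, it contains an infinite cyclic subgroup. -/

import Mathlib

open Topology

/-- The unit sphere `S^m ⊆ ℝ^{m+1}` centered at the origin. -/
noncomputable def Sph (m : ℕ) : Set (EuclideanSpace ℝ (Fin (m + 1))) :=
  Metric.sphere (0 : EuclideanSpace ℝ (Fin (m + 1))) 1

/-- The north pole `N = (0, …, 0, 1) ∈ S^m`. -/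
noncomputable def northPole (m : ℕ) : Sph m :=
  ⟨EuclideanSpace.single (Fin.last m) (1 : ℝ), by
    simp [Sph, EuclideanSpace.norm_single]⟩

/-- The space `Γ_n` of orthogonal complex structures on `ℝ^{2n}`: real `(2n) × (2n)` matrices
`J` (with `Fin (2n)` identified with `Fin n ⊕ Fin n`) such that `Jᵀ * J = 1` and `J * J = -1`,
with the subspace topology. -/
def Gamma (n : ℕ) : Set (Matrix (Fin n ⊕ Fin n) (Fin n ⊕ Fin n) ℝ) :=
  {J | J.transpose * J = 1 ∧ J * J = -1}

/-- The standard complex structure `J₀` on `ℝ^{2n}`, given by the block matrix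
`[[0, -1], [1, 0]]`. -/
def J0 (n : ℕ) : Matrix (Fin n ⊕ Fin n) (Fin n ⊕ Fin n) ℝ :=
  Matrix.fromBlocks 0 (-1) 1 0

theorem J0_mem (n : ℕ) : J0 n ∈ Gamma n := by
  constructor
  · simp [J0, Matrix.fromBlocks_transpose, Matrix.fromBlocks_multiply, ← Matrix.fromBlocks_one]
  · have h : (-1 : Matrix (Fin n ⊕ Fin n) (Fin n ⊕ Fin n) ℝ)
        = Matrix.fromBlocks (-1) (-0) (-0) (-1) := by
      rw [← Matrix.fromBlocks_neg, Matrix.fromBlocks_one]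
    simp [J0, Matrix.fromBlocks_multiply, h]

/-- `Γ_n⁺`: the path component of the standard complex structure `J₀` in `Γ_n`
(the homogeneous space `SO(2n)/U(n)`). -/
noncomputable def GammaPlus (n : ℕ) : Set (Gamma n) :=
  pathComponent (⟨J0 n, J0_mem n⟩ : Gamma n)

/-- `Γ_n⁺` pointed at `J₀`. -/
noncomputable def J0plus (n : ℕ) : GammaPlus n :=
  ⟨⟨J0 n, J0_mem n⟩, mem_pathComponent_self _⟩

section

open Matrix unitInterval
set_option linter.unusedSectionVars false
set_option linter.unusedSimpArgs false

/-- Block sum of two square matrices. -/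
notation:65 A:65 "⊞ₘ" B:66 => Matrix.fromBlocks A 0 0 B

theorem exists_descend {T A B Z : Type*} [TopologicalSpace T] [TopologicalSpace A]
    [TopologicalSpace B] [TopologicalSpace Z] [CompactSpace T] [T2Space T] [CompactSpace A]
    [T2Space B] (q : A → B) (hq : Continuous q) (hs : Function.Surjective q) (F : T → A → Z)
    (hF : Continuous fun p : T × A => F p.1 p.2)
    (hqF : ∀ t a a', q a = q a' → F t a = F t a') :
    ∃ g : T → B → Z, (Continuous fun p : T × B => g p.1 p.2) ∧ ∀ t a, g t (q a) = F t a := by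
  let Q : C(T × A, T × B) := ⟨Prod.map id q, by fun_prop⟩
  have hQ : IsQuotientMap Q := IsQuotientMap.of_surjective_continuous
    (Function.surjective_id.prodMap hs) Q.continuous
  have hfac : Function.FactorsThrough (fun p : T × A => F p.1 p.2) Q := by
    rintro ⟨t, a⟩ ⟨t', a'⟩ h
    obtain ⟨h1, h2⟩ := Prod.mk.inj h
    dsimp at h1
    subst h1
    exact hqF t a a' h2
  refine ⟨fun t b => hQ.lift ⟨_, hF⟩ hfac (t, b), (hQ.lift ⟨_, hF⟩ hfac).continuous, fun t a => ?_⟩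
  have := congrArg (fun φ => φ (t, a)) (hQ.lift_comp ⟨_, hF⟩ hfac)
  exact this

/-! ### Suspension coordinates on spheres and the circle coordinate -/

theorem mem_Sph_iff {m : ℕ} {y : EuclideanSpace ℝ (Fin (m + 1))} :
    y ∈ Sph m ↔ ∑ i, y i ^ 2 = 1 := by
  rw [Sph, mem_sphere_zero_iff_norm, EuclideanSpace.norm_eq, Real.sqrt_eq_one]
  simp

theorem Sph_sum_sq {m : ℕ} (y : Sph m) : ∑ i, y.1 i ^ 2 = 1 := mem_Sph_iff.1 y.2

/-- The map `S^d × [0,1] → S^{d+1}` exhibiting `S^{d+1}` as the suspension of `S^d`. -/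
noncomputable def suspMap (d : ℕ) (p : Sph d × I) : Sph (d + 1) :=
  ⟨WithLp.toLp 2 (Fin.snoc (α := fun _ => ℝ) (fun i => Real.sin (Real.pi * p.2) * p.1.1 i)
    (Real.cos (Real.pi * p.2))), by
    rw [mem_Sph_iff, Fin.sum_univ_castSucc]
    simp only [Fin.snoc_castSucc, Fin.snoc_last, mul_pow, ← Finset.mul_sum, Sph_sum_sq]
    rw [mul_one, Real.sin_sq_add_cos_sq]⟩

@[simp] theorem suspMap_castSucc {d : ℕ} (p : Sph d × I) (i : Fin (d + 1)) :
    (suspMap d p).1 i.castSucc = Real.sin (Real.pi * p.2) * p.1.1 i := by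
  simp [suspMap]

@[simp] theorem suspMap_last {d : ℕ} (p : Sph d × I) :
    (suspMap d p).1 (Fin.last (d + 1)) = Real.cos (Real.pi * p.2) := by
  simp [suspMap]

theorem continuous_suspMap (d : ℕ) : Continuous (suspMap d) := by
  refine Continuous.subtype_mk ?_ _
  refine (PiLp.continuous_toLp 2 _).comp ?_
  refine continuous_pi fun i => ?_
  refine Fin.lastCases ?_ (fun i => ?_) i
  · simp only [Fin.snoc_last]; fun_prop
  · simp only [Fin.snoc_castSucc]; fun_prop

instance Sph.compactSpace (m : ℕ) : CompactSpace (Sph m) :=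
  isCompact_iff_compactSpace.1 (isCompact_sphere _ _)

theorem sin_pi_mul_pos {t : I} (h0 : t ≠ 0) (h1 : t ≠ 1) : 0 < Real.sin (Real.pi * t) := by
  have h0' : (0 : ℝ) < t := unitInterval.pos_iff_ne_zero.2 h0
  have h1' : (t : ℝ) < 1 := unitInterval.lt_one_iff_ne_one.2 h1
  exact Real.sin_pos_of_pos_of_lt_pi (by positivity) (by nlinarith [Real.pi_pos])

theorem suspMap_surjective (d : ℕ) : Function.Surjective (suspMap d) := by
  intro y
  have hy := Sph_sum_sq y
  rw [Fin.sum_univ_castSucc] at hy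
  set c := y.1 (Fin.last (d + 1)) with hc
  have hS : 0 ≤ ∑ i : Fin (d + 1), y.1 i.castSucc ^ 2 := Finset.sum_nonneg fun i _ => sq_nonneg _
  have hc1 : c ^ 2 ≤ 1 := by linarith
  have hcl : -1 ≤ c := by nlinarith
  have hcr : c ≤ 1 := by nlinarith
  set t : ℝ := Real.arccos c / Real.pi with ht
  have hpi := Real.pi_pos
  have htI : t ∈ I := ⟨by have := Real.arccos_nonneg c; positivity, by
    rw [ht, div_le_one hpi]; exact Real.arccos_le_pi c⟩
  have hpt : Real.pi * t = Real.arccos c := by rw [ht]; field_simp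
  have hcos : Real.cos (Real.pi * t) = c := by rw [hpt, Real.cos_arccos hcl hcr]
  have hsin : Real.sin (Real.pi * t) ^ 2 = ∑ i : Fin (d + 1), y.1 i.castSucc ^ 2 := by
    have := Real.sin_sq_add_cos_sq (Real.pi * t); rw [hcos] at this; linarith
  by_cases h : Real.sin (Real.pi * t) = 0
  · refine ⟨(northPole d, ⟨t, htI⟩), Subtype.ext (PiLp.ext fun i => ?_)⟩
    refine Fin.lastCases ?_ (fun i => ?_) i
    · simpa using hcos
    · rw [h] at hsin
      have := (Finset.sum_eq_zero_iff_of_nonneg (fun i _ => sq_nonneg (y.1 (Fin.castSucc i)))).1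
        (by simpa using hsin.symm) i (Finset.mem_univ i)
      simp [h, pow_eq_zero_iff two_ne_zero |>.1 this]
  · refine ⟨(⟨WithLp.toLp 2 fun i => y.1 i.castSucc / Real.sin (Real.pi * t), ?_⟩, ⟨t, htI⟩),
      Subtype.ext (PiLp.ext fun i => ?_)⟩
    · rw [mem_Sph_iff]
      simp only [div_pow, ← Finset.sum_div]
      rw [← hsin]; field_simp
    · refine Fin.lastCases ?_ (fun i => ?_) i
      · simpa using hcos
      · simp; field_simp

theorem suspMap_eq_iff {d : ℕ} {x x' : Sph d} {t t' : I} (h : suspMap d (x, t) = suspMap d (x', t')) :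
    t = t' ∧ (t = 0 ∨ t = 1 ∨ x = x') := by
  have h1 : Real.cos (Real.pi * t) = Real.cos (Real.pi * t') := by
    rw [← suspMap_last (x, t), h, suspMap_last (x', t')]
  have hpi := Real.pi_pos
  have htt : t = t' := by
    have := Real.injOn_cos ⟨by have := t.2.1; positivity, by nlinarith [t.2.2]⟩
      ⟨by have := t'.2.1; positivity, by nlinarith [t'.2.2]⟩ h1
    exact Subtype.ext (mul_left_cancel₀ hpi.ne' this)
  refine ⟨htt, ?_⟩
  subst htt
  by_cases h0 : t = 0
  · exact Or.inl h0
  by_cases h1 : t = 1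
  · exact Or.inr (Or.inl h1)
  refine Or.inr (Or.inr (Subtype.ext (PiLp.ext fun i => ?_)))
  have : (suspMap d (x, t)).1 i.castSucc = (suspMap d (x', t)).1 i.castSucc := by rw [h]
  rw [suspMap_castSucc, suspMap_castSucc] at this
  exact mul_left_cancel₀ (sin_pi_mul_pos h0 h1).ne' this

theorem suspMap_zero {d : ℕ} (x x' : Sph d) : suspMap d (x, 0) = suspMap d (x', 0) := by
  refine Subtype.ext (PiLp.ext fun i => ?_)
  refine Fin.lastCases ?_ (fun i => ?_) i <;> simp

theorem suspMap_one {d : ℕ} (x x' : Sph d) : suspMap d (x, 1) = suspMap d (x', 1) := by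
  refine Subtype.ext (PiLp.ext fun i => ?_)
  refine Fin.lastCases ?_ (fun i => ?_) i <;> simp

theorem exists_descend_susp {T Z : Type*} [TopologicalSpace T] [CompactSpace T] [T2Space T]
    [TopologicalSpace Z] {d : ℕ} (F : T → Sph d → I → Z)
    (hF : Continuous fun p : T × (Sph d × I) => F p.1 p.2.1 p.2.2)
    (h0 : ∀ t x x', F t x 0 = F t x' 0) (h1 : ∀ t x x', F t x 1 = F t x' 1) :
    ∃ g : T → Sph (d + 1) → Z, (Continuous fun p : T × Sph (d + 1) => g p.1 p.2) ∧
      ∀ t x s, g t (suspMap d (x, s)) = F t x s := by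
  obtain ⟨g, hg, h⟩ := exists_descend (suspMap d) (continuous_suspMap d) (suspMap_surjective d)
    (fun t p => F t p.1 p.2) hF (by
      rintro t ⟨x, s⟩ ⟨x', s'⟩ h
      obtain ⟨rfl, rfl | rfl | rfl⟩ := suspMap_eq_iff h
      · exact h0 _ _ _
      · exact h1 _ _ _
      · rfl)
  exact ⟨g, hg, fun t x s => h t (x, s)⟩

/-- The parametrization of the circle by the unit interval. -/
noncomputable def circ (t : I) : Circle := Circle.exp (2 * Real.pi * t)

theorem continuous_circ : Continuous circ := by unfold circ; fun_prop

@[simp] theorem circ_zero : circ 0 = 1 := by simp [circ]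

@[simp] theorem circ_one : circ 1 = 1 := by simp [circ]

theorem circ_surjective : Function.Surjective circ := by
  intro z
  obtain ⟨s, hs⟩ := Circle.exp_surjective z
  refine ⟨⟨Int.fract (s / (2 * Real.pi)), Int.fract_nonneg _, (Int.fract_lt_one _).le⟩, ?_⟩
  rw [circ, ← hs, Circle.exp_eq_exp]
  refine ⟨-⌊s / (2 * Real.pi)⌋, ?_⟩
  simp only [← Int.self_sub_floor]
  push_cast
  have := Real.pi_pos
  field_simp
  ring

theorem circ_eq_iff {t t' : I} (h : circ t = circ t') : t = t' ∨ ((t = 0 ∨ t = 1) ∧ (t' = 0 ∨ t' = 1)) := by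
  rw [circ, circ, Circle.exp_eq_exp] at h
  obtain ⟨m, hm⟩ := h
  have hpi := Real.pi_pos
  have hm' : (t : ℝ) = t' + m := by
    have : 2 * Real.pi * (t : ℝ) = 2 * Real.pi * (t' + m) := by rw [hm]; ring
    exact mul_left_cancel₀ (by positivity) this
  have h1 : (m : ℝ) ≤ 1 := by linarith [t.2.2, t'.2.1]
  have h2 : (-1 : ℝ) ≤ m := by linarith [t.2.1, t'.2.2]
  have h1' : m ≤ 1 := by exact_mod_cast h1
  have h2' : -1 ≤ m := by exact_mod_cast h2
  interval_cases m
  · refine Or.inr ⟨Or.inl (Subtype.ext ?_), Or.inr (Subtype.ext ?_)⟩ <;> push_cast at hm' ⊢ <;>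
      linarith [t.2.1, t'.2.2]
  · exact Or.inl (Subtype.ext (by simpa using hm'))
  · refine Or.inr ⟨Or.inr (Subtype.ext ?_), Or.inl (Subtype.ext ?_)⟩ <;> push_cast at hm' ⊢ <;>
      linarith [t.2.2, t'.2.1]

theorem exists_descend_circ {T Z : Type*} [TopologicalSpace T] [CompactSpace T] [T2Space T]
    [TopologicalSpace Z] (F : T → I → Z) (hF : Continuous fun p : T × I => F p.1 p.2)
    (h01 : ∀ t, F t 0 = F t 1) :
    ∃ g : T → Circle → Z, (Continuous fun p : T × Circle => g p.1 p.2) ∧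
      ∀ t s, g t (circ s) = F t s := by
  refine exists_descend circ continuous_circ circ_surjective F hF fun t s s' h => ?_
  obtain rfl | ⟨rfl | rfl, rfl | rfl⟩ := circ_eq_iff h
  · rfl
  · rfl
  · exact h01 t
  · exact (h01 t).symm
  · rfl

/-! ### Continuous families of invertible matrices up to homotopy -/

section Invertible

variable {X Y ι κ : Type} [TopologicalSpace X] [TopologicalSpace Y] [Fintype ι] [DecidableEq ι]
  [Fintype κ] [DecidableEq κ]

theorem continuous_matrix_inv {u : X → Matrix ι ι ℂ} (hu : Continuous u)
    (h : ∀ x, IsUnit (u x)) : Continuous fun x => (u x)⁻¹ := by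
  simp only [Matrix.inv_def, Ring.inverse_eq_inv']
  refine Continuous.smul (Continuous.inv₀ hu.matrix_det fun x => ?_) hu.matrix_adjugate
  exact ((Matrix.isUnit_iff_isUnit_det _).1 (h x)).ne_zero

theorem isUnit_of_mul_eq_one' {A B : Matrix ι ι ℂ} (h : A * B = 1) : IsUnit A :=
  IsUnit.of_mul_eq_one _ h

theorem IsUnit.matrix_mul_inv {A : Matrix ι ι ℂ} (h : IsUnit A) : A * A⁻¹ = 1 :=
  Matrix.mul_nonsing_inv _ ((Matrix.isUnit_iff_isUnit_det _).1 h)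

theorem IsUnit.matrix_inv_mul {A : Matrix ι ι ℂ} (h : IsUnit A) : A⁻¹ * A = 1 :=
  Matrix.nonsing_inv_mul _ ((Matrix.isUnit_iff_isUnit_det _).1 h)

theorem IsUnit.matrix_inv {A : Matrix ι ι ℂ} (h : IsUnit A) : IsUnit A⁻¹ :=
  isUnit_of_mul_eq_one' h.matrix_inv_mul

theorem IsUnit.blockSum {A : Matrix ι ι ℂ} {B : Matrix κ κ ℂ} (hA : IsUnit A) (hB : IsUnit B) :
    IsUnit (A ⊞ₘ B) := by
  refine isUnit_of_mul_eq_one' (B := A⁻¹ ⊞ₘ B⁻¹) ?_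
  simp [Matrix.fromBlocks_multiply, hA.matrix_mul_inv, hB.matrix_mul_inv]

theorem IsUnit.matrix_reindex {A : Matrix ι ι ℂ} (hA : IsUnit A) (e : κ ≃ ι) :
    IsUnit (A.submatrix e e) := by
  refine isUnit_of_mul_eq_one' (B := A⁻¹.submatrix e e) ?_
  rw [Matrix.submatrix_mul_equiv, hA.matrix_mul_inv, Matrix.submatrix_one_equiv]

theorem isUnit_of_forall_mul_eq_zero {A : Matrix ι ι ℂ}
    (h : ∀ w : Matrix ι ι ℂ, A * w = 0 → w = 0) : IsUnit A := by
  rw [← Matrix.mulVec_injective_iff_isUnit]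
  refine (injective_iff_map_eq_zero (Matrix.mulVecLin A)).2 fun v hv => ?_
  by_contra hne
  obtain ⟨i, hi⟩ := Function.ne_iff.1 hne
  have := h (Matrix.of fun a _ => v a) (by
    ext a b
    exact congrFun hv a)
  exact hi (congrFun (congrFun this i) i)

/-- Two families of invertible matrices are homotopic through such families. -/
def GLHomotopic (u v : X → Matrix ι ι ℂ) : Prop :=
  ∃ h : I → X → Matrix ι ι ℂ, (Continuous fun p : I × X => h p.1 p.2) ∧ (∀ t x, IsUnit (h t x)) ∧
    (∀ x, h 0 x = u x) ∧ ∀ x, h 1 x = v x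

namespace GLHomotopic

variable {u v w u' v' : X → Matrix ι ι ℂ}

theorem isUnit_left (h : GLHomotopic u v) (x : X) : IsUnit (u x) := by
  obtain ⟨h, -, h1, h2, -⟩ := h
  exact h2 x ▸ h1 0 x

theorem isUnit_right (h : GLHomotopic u v) (x : X) : IsUnit (v x) := by
  obtain ⟨h, -, h1, -, h2⟩ := h
  exact h2 x ▸ h1 1 x

theorem continuous_left (h : GLHomotopic u v) : Continuous u := by
  obtain ⟨h, h1, -, h2, -⟩ := h
  rw [← funext h2]
  exact h1.comp (Continuous.prodMk_right (0 : I))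

theorem continuous_right (h : GLHomotopic u v) : Continuous v := by
  obtain ⟨h, h1, -, -, h2⟩ := h
  rw [← funext h2]
  exact h1.comp (Continuous.prodMk_right (1 : I))

theorem refl (hu : Continuous u) (h : ∀ x, IsUnit (u x)) : GLHomotopic u u :=
  ⟨fun _ x => u x, by fun_prop, fun _ x => h x, fun _ => rfl, fun _ => rfl⟩

theorem symm (h : GLHomotopic u v) : GLHomotopic v u := by
  obtain ⟨h, h1, h2, h3, h4⟩ := h
  refine ⟨fun t x => h (σ t) x, ?_, fun t x => h2 _ _, fun x => by simp [h4], fun x => by simp [h3]⟩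
  exact h1.comp (f := fun p : I × X => (σ p.1, p.2)) (by fun_prop)

theorem trans (h : GLHomotopic u v) (h' : GLHomotopic v w) : GLHomotopic u w := by
  have key : ∀ {a b : X → Matrix ι ι ℂ} (H : GLHomotopic a b),
      ContinuousMap.Homotopic (Y := {A : Matrix ι ι ℂ // IsUnit A})
        ⟨fun x => ⟨a x, H.isUnit_left x⟩, H.continuous_left.subtype_mk _⟩
        ⟨fun x => ⟨b x, H.isUnit_right x⟩, H.continuous_right.subtype_mk _⟩ := by
    intro a b H
    obtain ⟨h, h1, h2, h3, h4⟩ := id H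
    exact ⟨⟨⟨fun p => ⟨h p.1 p.2, h2 _ _⟩, h1.subtype_mk _⟩, fun x => Subtype.ext (h3 x),
      fun x => Subtype.ext (h4 x)⟩⟩
  obtain ⟨F⟩ := (key h).trans (key h')
  exact ⟨fun t x => (F (t, x)).1, continuous_subtype_val.comp F.continuous,
    fun t x => (F (t, x)).2, fun x => congrArg Subtype.val (F.apply_zero x),
    fun x => congrArg Subtype.val (F.apply_one x)⟩

theorem mul (h : GLHomotopic u v) (h' : GLHomotopic u' v') :
    GLHomotopic (fun x => u x * u' x) fun x => v x * v' x := by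
  obtain ⟨h, h1, h2, h3, h4⟩ := h
  obtain ⟨k, k1, k2, k3, k4⟩ := h'
  exact ⟨fun t x => h t x * k t x, h1.matrix_mul k1, fun t x => (h2 t x).mul (k2 t x),
    fun x => by simp only [h3, k3], fun x => by simp only [h4, k4]⟩

theorem blockSum {a b : X → Matrix κ κ ℂ} (h : GLHomotopic u v) (h' : GLHomotopic a b) :
    GLHomotopic (fun x => u x ⊞ₘ a x) fun x => v x ⊞ₘ b x := by
  obtain ⟨h, h1, h2, h3, h4⟩ := h
  obtain ⟨k, k1, k2, k3, k4⟩ := h'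
  exact ⟨fun t x => h t x ⊞ₘ k t x, by fun_prop, fun t x => (h2 t x).blockSum (k2 t x),
    fun x => by simp only [h3, k3], fun x => by simp only [h4, k4]⟩

theorem reindex (h : GLHomotopic u v) (e : κ ≃ ι) :
    GLHomotopic (fun x => (u x).submatrix e e) fun x => (v x).submatrix e e := by
  obtain ⟨h, h1, h2, h3, h4⟩ := h
  exact ⟨fun t x => (h t x).submatrix e e, h1.matrix_submatrix e e,
    fun t x => (h2 t x).matrix_reindex e, fun x => by simp only [h3], fun x => by simp only [h4]⟩

end GLHomotopic

/-- The rotation matrix by a quarter turn times `s`. -/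
noncomputable def rotBlock (ι : Type) [Fintype ι] [DecidableEq ι] (s : ℝ) :
    Matrix (ι ⊕ ι) (ι ⊕ ι) ℂ :=
  Matrix.fromBlocks ((Real.cos (Real.pi / 2 * s) : ℂ) • (1 : Matrix ι ι ℂ))
    (-((Real.sin (Real.pi / 2 * s) : ℂ) • (1 : Matrix ι ι ℂ)))
    ((Real.sin (Real.pi / 2 * s) : ℂ) • (1 : Matrix ι ι ℂ))
    ((Real.cos (Real.pi / 2 * s) : ℂ) • (1 : Matrix ι ι ℂ))

theorem continuous_rotBlock : Continuous (rotBlock ι) := by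
  unfold rotBlock
  fun_prop

theorem rotBlock_mul_neg (s : ℝ) : rotBlock ι s * rotBlock ι (-s) = 1 := by
  have h := Complex.cos_sq_add_sin_sq ((Real.pi / 2 * s : ℝ) : ℂ)
  simp only [rotBlock, Matrix.fromBlocks_multiply, mul_neg, Real.cos_neg, Real.sin_neg,
    ← Matrix.fromBlocks_one, Matrix.smul_mul, Matrix.mul_smul, Matrix.one_mul, smul_smul,
    Complex.ofReal_neg, neg_smul, Matrix.neg_mul, neg_neg, ← add_smul, ← sub_eq_add_neg,
    Complex.ofReal_cos, Complex.ofReal_sin, ← neg_smul]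
  congr 1
  · convert one_smul ℂ (1 : Matrix ι ι ℂ) using 2; rw [← h]; ring
  · convert zero_smul ℂ _ using 2; ring
  · convert zero_smul ℂ _ using 2; ring
  · convert one_smul ℂ (1 : Matrix ι ι ℂ) using 2; rw [← h]; ring

theorem isUnit_rotBlock (s : ℝ) : IsUnit (rotBlock ι s) :=
  isUnit_of_mul_eq_one' (rotBlock_mul_neg s)

theorem rotBlock_neg_mul (s : ℝ) : rotBlock ι (-s) * rotBlock ι s = 1 := by
  simpa using rotBlock_mul_neg (ι := ι) (-s)

@[simp] theorem rotBlock_zero : rotBlock ι 0 = 1 := by simp [rotBlock, ← Matrix.fromBlocks_one]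

theorem rotBlock_one : rotBlock ι 1 = Matrix.fromBlocks 0 (-1) 1 0 := by simp [rotBlock]

theorem rotBlock_neg_one : rotBlock ι (-1) = Matrix.fromBlocks 0 1 (-1) 0 := by simp [rotBlock]

theorem GLHomotopic.whitehead {u v : X → Matrix ι ι ℂ} (hu : Continuous u)
    (hu' : ∀ x, IsUnit (u x)) (hv : Continuous v) (hv' : ∀ x, IsUnit (v x)) :
    GLHomotopic (fun x => (u x * v x) ⊞ₘ (1 : Matrix ι ι ℂ)) fun x => u x ⊞ₘ v x := by
  have hc := continuous_rotBlock (ι := ι)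
  refine ⟨fun t x => (u x ⊞ₘ (1 : Matrix ι ι ℂ)) * (rotBlock ι t * (v x ⊞ₘ (1 : Matrix ι ι ℂ)) *
    rotBlock ι (-t)), by fun_prop, fun t x => ?_, fun x => ?_, fun x => ?_⟩
  · exact ((hu' x).blockSum isUnit_one).mul (((isUnit_rotBlock _).mul
      ((hv' x).blockSum isUnit_one)).mul (isUnit_rotBlock _))
  · simp [Matrix.fromBlocks_multiply]
  · simp [rotBlock_one, rotBlock_neg_one, Matrix.fromBlocks_multiply]

theorem GLHomotopic.conj_blockSum_one {A B u : X → Matrix ι ι ℂ} (hA : Continuous A)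
    (hB : Continuous B) (hAB : ∀ x, A x * B x = 1) (hu : Continuous u)
    (hu' : ∀ x, IsUnit (u x)) :
    GLHomotopic (fun x => (A x * u x * B x) ⊞ₘ (1 : Matrix ι ι ℂ))
      fun x => u x ⊞ₘ (1 : Matrix ι ι ℂ) := by
  have hBA : ∀ x, B x * A x = 1 := fun x => mul_eq_one_comm.1 (hAB x)
  have hAu : ∀ x, IsUnit (A x) := fun x => isUnit_of_mul_eq_one' (hAB x)
  have hBu : ∀ x, IsUnit (B x) := fun x => isUnit_of_mul_eq_one' (hBA x)
  have h1 := (GLHomotopic.whitehead hA hAu hB hBu).symm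
  have h2 := (GLHomotopic.whitehead hB hBu hA hAu).symm
  have hu1 : GLHomotopic (fun x => u x ⊞ₘ (1 : Matrix ι ι ℂ)) fun x => u x ⊞ₘ (1 : Matrix ι ι ℂ) :=
    GLHomotopic.refl (by fun_prop) fun x => (hu' x).blockSum isUnit_one
  have := (h1.mul hu1).mul h2
  simpa [Matrix.fromBlocks_multiply, hAB, hBA] using this

end Invertible

/-! ### Murray-von Neumann equivalence of families of idempotents -/

section Idempotents

variable {X Y ι κ μ ι' κ' : Type} [TopologicalSpace X] [TopologicalSpace Y] [Fintype ι]
  [DecidableEq ι] [Fintype κ] [DecidableEq κ] [Fintype μ] [DecidableEq μ] [Fintype ι']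
  [DecidableEq ι'] [Fintype κ'] [DecidableEq κ']

/-- Murray-von Neumann equivalence of two families of idempotent matrices. -/
def MvN (p : X → Matrix ι ι ℂ) (q : X → Matrix κ κ ℂ) : Prop :=
  ∃ (V : X → Matrix ι κ ℂ) (W : X → Matrix κ ι ℂ), Continuous V ∧ Continuous W ∧
    (∀ x, V x * W x = p x) ∧ ∀ x, W x * V x = q x

namespace MvN

variable {p : X → Matrix ι ι ℂ} {q : X → Matrix κ κ ℂ} {r : X → Matrix μ μ ℂ}
  {p' : X → Matrix ι' ι' ℂ} {q' : X → Matrix κ' κ' ℂ}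

theorem refl (hp : Continuous p) (h : ∀ x, p x * p x = p x) : MvN p p := ⟨p, p, hp, hp, h, h⟩

theorem symm (h : MvN p q) : MvN q p := by
  obtain ⟨V, W, hV, hW, h1, h2⟩ := h
  exact ⟨W, V, hW, hV, h2, h1⟩

theorem trans (h : MvN p q) (h' : MvN q r) (hp : ∀ x, p x * p x = p x)
    (hr : ∀ x, r x * r x = r x) : MvN p r := by
  obtain ⟨V, W, hV, hW, h1, h2⟩ := h
  obtain ⟨V', W', hV', hW', h1', h2'⟩ := h'
  refine ⟨fun x => V x * V' x, fun x => W' x * W x, by fun_prop, by fun_prop, fun x => ?_,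
    fun x => ?_⟩
  · calc V x * V' x * (W' x * W x) = V x * (V' x * W' x) * W x := by simp only [Matrix.mul_assoc]
      _ = (V x * W x) * (V x * W x) := by rw [h1', ← h2]; simp only [Matrix.mul_assoc]
      _ = p x := by rw [h1, hp]
  · calc W' x * W x * (V x * V' x) = W' x * (W x * V x) * V' x := by simp only [Matrix.mul_assoc]
      _ = (W' x * V' x) * (W' x * V' x) := by rw [h2, ← h1']; simp only [Matrix.mul_assoc]
      _ = r x := by rw [h2', hr]

theorem blockSum (h : MvN p q) (h' : MvN p' q') :
    MvN (fun x => p x ⊞ₘ p' x) fun x => q x ⊞ₘ q' x := by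
  obtain ⟨V, W, hV, hW, h1, h2⟩ := h
  obtain ⟨V', W', hV', hW', h1', h2'⟩ := h'
  exact ⟨fun x => V x ⊞ₘ V' x, fun x => W x ⊞ₘ W' x, by fun_prop, by fun_prop,
    fun x => by simp [Matrix.fromBlocks_multiply, h1, h1'],
    fun x => by simp [Matrix.fromBlocks_multiply, h2, h2']⟩

theorem conj {V W : X → Matrix ι ι ℂ} (hV : Continuous V) (hW : Continuous W)
    (hVW : ∀ x, V x * W x = 1) (hp : Continuous p) (h : ∀ x, p x * p x = p x) :
    MvN (fun x => V x * p x * W x) p := by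
  have hWV : ∀ x, W x * V x = 1 := fun x => mul_eq_one_comm.1 (hVW x)
  refine ⟨fun x => V x * p x, fun x => p x * W x, by fun_prop, by fun_prop, fun x => ?_,
    fun x => ?_⟩
  · rw [Matrix.mul_assoc, ← Matrix.mul_assoc (p x), h, ← Matrix.mul_assoc]
  · rw [Matrix.mul_assoc, ← Matrix.mul_assoc (W x), hWV, Matrix.one_mul, h]

theorem reindex (e : κ ≃ ι) (hp : Continuous p) (h : ∀ x, p x * p x = p x) :
    MvN p (fun x => (p x).submatrix e e) := by
  refine ⟨fun x => (p x).submatrix id e, fun x => (p x).submatrix e id,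
    hp.matrix_submatrix _ _, hp.matrix_submatrix _ _, fun x => ?_, fun x => ?_⟩
  · rw [Matrix.submatrix_mul_equiv, h]; rfl
  · rw [← Matrix.submatrix_mul _ _ e id e Function.bijective_id, h]

theorem comm (hp : Continuous p) (h : ∀ x, p x * p x = p x) (hq : Continuous q)
    (h' : ∀ x, q x * q x = q x) : MvN (fun x => p x ⊞ₘ q x) fun x => q x ⊞ₘ p x := by
  refine ⟨fun x => Matrix.fromBlocks 0 (p x) (q x) 0, fun x => Matrix.fromBlocks 0 (q x) (p x) 0,
    by fun_prop, by fun_prop, fun x => ?_, fun x => ?_⟩ <;>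
  simp [Matrix.fromBlocks_multiply, h, h']

theorem assoc (hp : Continuous p) (h : ∀ x, p x * p x = p x) (hq : Continuous q)
    (h' : ∀ x, q x * q x = q x) (hr : Continuous r) (h'' : ∀ x, r x * r x = r x) :
    MvN (fun x => (p x ⊞ₘ q x) ⊞ₘ r x) fun x => p x ⊞ₘ (q x ⊞ₘ r x) := by
  refine ⟨fun x => ((p x ⊞ₘ q x) ⊞ₘ r x).submatrix id (Equiv.sumAssoc ι κ μ).symm,
    fun x => ((p x ⊞ₘ q x) ⊞ₘ r x).submatrix (Equiv.sumAssoc ι κ μ).symm id,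
    Continuous.matrix_submatrix (by fun_prop) _ _, Continuous.matrix_submatrix (by fun_prop) _ _,
    fun x => ?_, fun x => ?_⟩
  · rw [Matrix.submatrix_mul_equiv]
    simp [Matrix.fromBlocks_multiply, h, h', h'']
  · rw [← Matrix.submatrix_mul _ _ _ id _ Function.bijective_id]
    simp only [Matrix.fromBlocks_multiply, h, h', h'', mul_zero, zero_mul, add_zero, zero_add,
      Matrix.mul_zero, Matrix.zero_mul]
    ext i j
    rcases i with i | i | i <;> rcases j with j | j | j <;> rfl

theorem continuous_left (h : MvN p q) : Continuous p := by
  obtain ⟨V, W, hV, hW, h1, h2⟩ := h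
  rw [← funext h1]; fun_prop

end MvN

theorem exists_rank_factorization (e : Matrix ι ι ℂ) (he : e * e = e) :
    ∃ (r : ℕ) (V : Matrix ι (Fin r) ℂ) (W : Matrix (Fin r) ι ℂ), V * W = e ∧ W * V = 1 := by
  let f := Matrix.toLin' e
  let b := Module.finBasis ℂ (LinearMap.range f)
  have hf : f ∘ₗ f = f := by rw [← Matrix.toLin'_mul, he]
  let c := Pi.basisFun ℂ ι
  refine ⟨_, LinearMap.toMatrix b c (LinearMap.range f).subtype,
    LinearMap.toMatrix c b f.rangeRestrict, ?_, ?_⟩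
  · rw [← LinearMap.toMatrix_comp, LinearMap.subtype_comp_codRestrict]
    exact LinearMap.toMatrix'_toLin' e
  · rw [← LinearMap.toMatrix_comp, ← LinearMap.toMatrix_id (v₁ := b)]
    congr 1
    ext1 ⟨x, y, hy⟩
    refine Subtype.ext ?_
    subst hy
    exact LinearMap.congr_fun hf y

/-- A family of idempotents that is stably equivalent to a constant one. -/
def StablyTrivial (p : X → Matrix ι ι ℂ) : Prop :=
  ∃ N M : ℕ, MvN (fun x => p x ⊞ₘ (1 : Matrix (Fin N) (Fin N) ℂ))
    fun _ => (1 : Matrix (Fin M) (Fin M) ℂ)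

theorem stablyTrivial_of_const {p : X → Matrix ι ι ℂ} (hp : ∀ x, p x * p x = p x)
    (e : Matrix κ κ ℂ) (he : e * e = e) (q : Matrix μ μ ℂ) (hq : q * q = q)
    (h : MvN (fun x => p x ⊞ₘ e) fun _ => q) : StablyTrivial p := by
  have hpc : Continuous p := by
    have := h.continuous_left.matrix_submatrix (Sum.inl : ι → ι ⊕ κ) Sum.inl
    exact this
  obtain ⟨N, V, W, h1, h2⟩ := exists_rank_factorization e he
  obtain ⟨M, V', W', h1', h2'⟩ := exists_rank_factorization q hq
  have a1 : MvN (fun x => p x ⊞ₘ (1 : Matrix (Fin N) (Fin N) ℂ)) fun x => p x ⊞ₘ e :=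
    (MvN.refl hpc hp).blockSum ⟨fun _ => W, fun _ => V, continuous_const, continuous_const,
      fun _ => h2, fun _ => h1⟩
  have a2 : MvN (fun _ : X => q) fun _ => (1 : Matrix (Fin M) (Fin M) ℂ) :=
    ⟨fun _ => V', fun _ => W', continuous_const, continuous_const, fun _ => h1', fun _ => h2'⟩
  exact ⟨N, M, (a1.trans h (by simp [Matrix.fromBlocks_multiply, hp]) fun _ => hq).trans a2
    (by simp [Matrix.fromBlocks_multiply, hp]) (by simp)⟩

theorem StablyTrivial.of_mvN {p : X → Matrix ι ι ℂ} {q : X → Matrix κ κ ℂ}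
    (hp : ∀ x, p x * p x = p x) (h : MvN p q) (hq : StablyTrivial q) : StablyTrivial p := by
  obtain ⟨N, M, hq⟩ := hq
  exact ⟨N, M, (h.blockSum (MvN.refl continuous_const (by simp))).trans hq
    (by simp [Matrix.fromBlocks_multiply, hp]) (by simp)⟩

theorem StablyTrivial.of_blockSum {p : X → Matrix ι ι ℂ} (hp : Continuous p)
    (hp' : ∀ x, p x * p x = p x) (e : Matrix κ κ ℂ) (he : e * e = e)
    (h : StablyTrivial fun x => p x ⊞ₘ e) : StablyTrivial p := by
  obtain ⟨N, M, h⟩ := h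
  refine stablyTrivial_of_const hp' (e ⊞ₘ (1 : Matrix (Fin N) (Fin N) ℂ))
    (by simp [Matrix.fromBlocks_multiply, he]) (1 : Matrix (Fin M) (Fin M) ℂ) (by simp) ?_
  refine (MvN.assoc hp hp' continuous_const (fun _ => he) continuous_const (by simp)).symm.trans h
    ?_ (by simp)
  simp [Matrix.fromBlocks_multiply, he, hp']

end Idempotents

/-! ### Homotopies of idempotents -/

section HomotopyIdempotents

variable {X ι κ : Type} [TopologicalSpace X] [Fintype ι] [DecidableEq ι] [Fintype κ]
  [DecidableEq κ]

theorem isOpen_setOf_isUnit_matrix : IsOpen {A : Matrix ι ι ℂ | IsUnit A} := by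
  have : {A : Matrix ι ι ℂ | IsUnit A} = {A | A.det ≠ 0} := by
    ext A; simp [Matrix.isUnit_iff_isUnit_det]
  rw [this]
  exact isOpen_ne_fun (Continuous.matrix_det continuous_id) continuous_const

theorem exists_conj_of_homotopy [CompactSpace X] (E : X → I → Matrix ι ι ℂ)
    (hE : Continuous fun p : X × I => E p.1 p.2) (hE' : ∀ x t, E x t * E x t = E x t) :
    ∃ A : X → Matrix ι ι ℂ, Continuous A ∧ (∀ x, IsUnit (A x)) ∧
      ∀ x, E x 1 * A x = A x * E x 0 := by
  let P : I → I → Prop := fun t t' => ∃ A : X → Matrix ι ι ℂ, Continuous A ∧ (∀ x, IsUnit (A x)) ∧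
      ∀ x, E x t' * A x = A x * E x t
  have hs : Std.Symm P := ⟨fun t t' ⟨A, hA, hA', h⟩ => ⟨fun x => (A x)⁻¹,
    continuous_matrix_inv hA hA', fun x => (hA' x).matrix_inv, fun x => by
      calc E x t * (A x)⁻¹ = (A x)⁻¹ * (A x * E x t) * (A x)⁻¹ := by
            rw [← Matrix.mul_assoc, (hA' x).matrix_inv_mul, Matrix.one_mul]
        _ = (A x)⁻¹ * E x t' := by
            rw [← h, Matrix.mul_assoc, Matrix.mul_assoc, (hA' x).matrix_mul_inv, Matrix.mul_one]⟩⟩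
  have ht : IsTrans I P := ⟨fun a b c ⟨A, hA, hA', h⟩ ⟨B, hB, hB', h'⟩ =>
    ⟨fun x => B x * A x, by fun_prop, fun x => (hB' x).mul (hA' x), fun x => by
      rw [← Matrix.mul_assoc, h', Matrix.mul_assoc, h, Matrix.mul_assoc]⟩⟩
  refine PreconnectedSpace.induction₂ P (fun t => ?_) ht 0 1
  let U : I → X → Matrix ι ι ℂ := fun t' x => E x t' * E x t + (1 - E x t') * (1 - E x t)
  have hcomp : ∀ s : I, Continuous fun x => E x s := fun s =>
    hE.comp (Continuous.prodMk_left s)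
  have hU : Continuous fun p : I × X => U p.1 p.2 := by
    have h1 : Continuous fun p : I × X => E p.2 p.1 := hE.comp continuous_swap
    have h2 : Continuous fun p : I × X => E p.2 t := (hcomp t).comp continuous_snd
    fun_prop
  have hev : ∀ᶠ t' in 𝓝 t, ∀ x ∈ (Set.univ : Set X), IsUnit (U t' x) := by
    refine isCompact_univ.eventually_forall_of_forall_eventually fun x _ => ?_
    have : IsUnit (U t x) := by
      have : U t x = 1 := by
        simp only [U, sub_mul, mul_sub, hE', Matrix.one_mul, Matrix.mul_one]; abel
      rw [this]; exact isUnit_one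
    exact hU.continuousAt.eventually (isOpen_setOf_isUnit_matrix.mem_nhds this)
  filter_upwards [hev] with t' h
  refine ⟨U t', hU.comp (Continuous.prodMk_right t'), fun x => h x trivial, fun x => ?_⟩
  simp only [U, mul_add, add_mul, sub_mul, mul_sub, Matrix.one_mul, Matrix.mul_one,
    ← Matrix.mul_assoc, hE']
  simp only [Matrix.mul_assoc, hE']
  abel

theorem exists_trivialization_of_homotopy [CompactSpace X] (E : X → I → Matrix ι ι ℂ)
    (hE : Continuous fun p : X × I => E p.1 p.2) (hE' : ∀ x t, E x t * E x t = E x t)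
    (P : Matrix ι ι ℂ) (h0 : ∀ x, E x 0 = P) :
    ∃ A : X → I → Matrix ι ι ℂ, (Continuous fun p : X × I => A p.1 p.2) ∧
      (∀ x t, IsUnit (A x t)) ∧ (∀ x t, E x t * A x t = A x t * P) ∧ ∀ x, A x 0 = 1 := by
  obtain ⟨A, hA, hA', h⟩ := exists_conj_of_homotopy (X := X × I)
    (fun p s => E p.1 (s * p.2)) (hE.comp (f := fun p : (X × I) × I => (p.1.1, p.2 * p.1.2))
      (by fun_prop)) fun _ _ => hE' _ _
  simp only [zero_mul, one_mul, h0] at h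
  have hc : Continuous fun p : X × I => A (p.1, 0) := by fun_prop
  refine ⟨fun x t => A (x, t) * (A (x, 0))⁻¹, ?_, fun x t => (hA' _).mul (hA' _).matrix_inv,
    fun x t => ?_, fun x => (hA' _).matrix_mul_inv⟩
  · exact Continuous.matrix_mul (by fun_prop) (continuous_matrix_inv hc fun p => hA' _)
  · have hP : P * A (x, 0) = A (x, 0) * P := by rw [← h (x, 0), h0]
    have hP' : P * (A (x, 0))⁻¹ = (A (x, 0))⁻¹ * P := by
      calc P * (A (x, 0))⁻¹ = (A (x, 0))⁻¹ * (A (x, 0) * P) * (A (x, 0))⁻¹ := by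
            rw [← Matrix.mul_assoc, (hA' _).matrix_inv_mul, Matrix.one_mul]
        _ = (A (x, 0))⁻¹ * P := by
            rw [← hP, Matrix.mul_assoc, Matrix.mul_assoc, (hA' _).matrix_mul_inv, Matrix.mul_one]
    dsimp only
    rw [← Matrix.mul_assoc, h (x, t), Matrix.mul_assoc, hP', Matrix.mul_assoc]

theorem mvN_of_mul_eq_mul {p q A : X → Matrix ι ι ℂ} (hA : Continuous A)
    (hA' : ∀ x, IsUnit (A x)) (h : ∀ x, q x * A x = A x * p x) (hp : Continuous p)
    (hp' : ∀ x, p x * p x = p x) : MvN q p := by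
  have := MvN.conj hA (continuous_matrix_inv hA hA') (fun x => (hA' x).matrix_mul_inv) hp hp'
  have e : (fun x => A x * p x * (A x)⁻¹) = q := funext fun x => by
    rw [← h, Matrix.mul_assoc, (hA' x).matrix_mul_inv, Matrix.mul_one]
  rwa [e] at this

theorem mvN_of_homotopy [CompactSpace X] (E : X → I → Matrix ι ι ℂ)
    (hE : Continuous fun p : X × I => E p.1 p.2) (hE' : ∀ x t, E x t * E x t = E x t) :
    MvN (fun x => E x 1) fun x => E x 0 := by
  obtain ⟨A, hA, hA', h⟩ := exists_conj_of_homotopy E hE hE'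
  exact mvN_of_mul_eq_mul hA hA' h (hE.comp (Continuous.prodMk_left (0 : I))) fun x => hE' _ _

end HomotopyIdempotents

section PathConnected

variable {ι : Type} [Fintype ι] [DecidableEq ι]

theorem exists_path_to_one {A : Matrix ι ι ℂ} (hA : IsUnit A) :
    ∃ h : I → Matrix ι ι ℂ, Continuous h ∧ (∀ t, IsUnit (h t)) ∧ h 0 = 1 ∧ h 1 = A := by
  let f : ℂ → Matrix ι ι ℂ := fun z => (1 - z) • (1 : Matrix ι ι ℂ) + z • A
  let M : Matrix ι ι (Polynomial ℂ) :=
    (1 - Polynomial.X : Polynomial ℂ) • (1 : Matrix ι ι (Polynomial ℂ)) +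
      (Polynomial.X : Polynomial ℂ) • A.map Polynomial.C
  have hM : ∀ z, (M.det).eval z = (f z).det := by
    intro z
    have := (Polynomial.evalRingHom z).map_det M
    rw [Polynomial.coe_evalRingHom] at this
    rw [this]
    congr 1
    ext i j
    by_cases hij : i = j <;> simp [M, f, hij, Matrix.one_apply] <;> ring
  have hne : M.det ≠ 0 := by
    intro h
    have := hM 0
    simp [h, f] at this
  have hfin : {z : ℂ | M.det.IsRoot z}.Finite := Polynomial.finite_setOfPred_isRoot hne
  have hpc := hfin.countable.isPathConnected_compl_of_one_lt_rank (by simp)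
  have hu : ∀ z, z ∈ {z : ℂ | M.det.IsRoot z}ᶜ ↔ IsUnit (f z) := by
    intro z
    rw [Matrix.isUnit_iff_isUnit_det, isUnit_iff_ne_zero, ← hM]
    rfl
  obtain ⟨γ, hγ⟩ := hpc.joinedIn 0 ((hu 0).2 (by simp [f])) 1 ((hu 1).2 (by simpa [f] using hA))
  refine ⟨fun t => f (γ t), ?_, fun t => (hu _).1 (hγ t), by simp [f], by simp [f]⟩
  fun_prop

theorem exists_path_matrix {A B : Matrix ι ι ℂ} (hA : IsUnit A) (hB : IsUnit B) :
    ∃ h : I → Matrix ι ι ℂ, Continuous h ∧ (∀ t, IsUnit (h t)) ∧ h 0 = A ∧ h 1 = B := by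
  obtain ⟨h, h1, h2, h3, h4⟩ := exists_path_to_one (hA.matrix_inv.mul hB)
  refine ⟨fun t => A * h t, by fun_prop, fun t => hA.mul (h2 t), by simp [h3], ?_⟩
  simp only [h4]
  rw [← Matrix.mul_assoc, hA.matrix_mul_inv, Matrix.one_mul]

end PathConnected

/-! ### The spectral idempotent of a linear pencil -/

section Pencil

variable {R S : Type} [NormedRing R] [NormedAlgebra ℂ R] [CompleteSpace R]
  [NormedAddCommGroup S] [NormedSpace ℂ S] [CompleteSpace S]

/-- The normalized contour integral over the unit circle. -/
noncomputable def circAvg (f : ℂ → S) : S :=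
  (2 * Real.pi * Complex.I : ℂ)⁻¹ • ∮ z in C(0, 1), f z

theorem circAvg_congr {f g : ℂ → S} (h : ∀ z, ‖z‖ = 1 → f z = g z) : circAvg f = circAvg g := by
  unfold circAvg
  rw [circleIntegral.integral_congr zero_le_one fun z hz => h z (by simpa using hz)]

theorem circAvg_clm {T : Type} [NormedAddCommGroup T] [NormedSpace ℂ T] [CompleteSpace T]
    (L : S →L[ℂ] T) {f : ℂ → S} (hf : ContinuousOn f (Metric.sphere 0 1)) :
    circAvg (fun z => L (f z)) = L (circAvg f) := by
  unfold circAvg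
  rw [map_smul]
  congr 1
  have := (hf.circleIntegrable zero_le_one).out
  simp only [circleIntegral, ← map_smul]
  exact L.intervalIntegral_comp_comm this

theorem circAvg_const_mul (c : R) {f : ℂ → R} (hf : ContinuousOn f (Metric.sphere 0 1)) :
    circAvg (fun z => c * f z) = c * circAvg f :=
  circAvg_clm (ContinuousLinearMap.mul ℂ R c) hf

theorem circAvg_mul_const (c : R) {f : ℂ → R} (hf : ContinuousOn f (Metric.sphere 0 1)) :
    circAvg (fun z => f z * c) = circAvg f * c :=
  circAvg_clm ((ContinuousLinearMap.mul ℂ R).flip c) hf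

theorem circAvg_add {f g : ℂ → S} (hf : ContinuousOn f (Metric.sphere 0 1))
    (hg : ContinuousOn g (Metric.sphere 0 1)) :
    circAvg (fun z => f z + g z) = circAvg f + circAvg g := by
  unfold circAvg
  rw [← smul_add, ← circleIntegral.integral_add (hf.circleIntegrable zero_le_one)
    (hg.circleIntegrable zero_le_one)]

theorem circAvg_smul_const (f : ℂ → ℂ) (s : S) : circAvg (fun z => f z • s) = circAvg f • s := by
  unfold circAvg
  rw [circleIntegral.integral_smul_const, smul_eq_mul, mul_smul]

theorem two_pi_I_ne : (2 * Real.pi * Complex.I : ℂ) ≠ 0 := by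
  simp [Real.pi_ne_zero]

theorem circAvg_zpow (n : ℤ) : circAvg (fun z : ℂ => z ^ n) = if n = -1 then 1 else 0 := by
  unfold circAvg
  split_ifs with h
  · have := circleIntegral.integral_sub_center_inv (0 : ℂ) one_ne_zero
    simp only [sub_zero] at this
    simp only [h, _root_.zpow_neg_one]
    rw [this, smul_eq_mul, inv_mul_cancel₀ two_pi_I_ne]
  · have := circleIntegral.integral_sub_zpow_of_ne h 0 0 1
    simp only [sub_zero] at this
    rw [this, smul_zero]

theorem circAvg_sub_inv_of_lt {ζ : ℂ} (h : ‖ζ‖ < 1) : circAvg (fun z : ℂ => (z - ζ)⁻¹) = 1 := by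
  unfold circAvg
  rw [circleIntegral.integral_sub_inv_of_mem_ball (by simpa using h), smul_eq_mul,
    inv_mul_cancel₀ two_pi_I_ne]

theorem circAvg_sub_inv_of_gt {ζ : ℂ} (h : 1 < ‖ζ‖) : circAvg (fun z : ℂ => (z - ζ)⁻¹) = 0 := by
  unfold circAvg
  have hne : ∀ z : ℂ, ‖z‖ ≤ 1 → z - ζ ≠ 0 := fun z hz h0 => by
    rw [sub_eq_zero] at h0; subst h0; linarith
  rw [Complex.circleIntegral_eq_zero_of_differentiable_on_off_countable zero_le_one
    Set.countable_empty, smul_zero]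
  · exact ContinuousOn.inv₀ (by fun_prop) fun z hz => hne z (by simpa using hz)
  · intro z hz
    have : ‖z‖ < 1 := by simpa using hz.1
    exact DifferentiableAt.inv (by fun_prop) (hne z this.le)

theorem continuous_circAvg {X : Type} [TopologicalSpace X] {f : X → ℂ → S}
    (hf : Continuous fun p : X × Circle => f p.1 p.2) : Continuous fun x => circAvg (f x) := by
  unfold circAvg
  refine Continuous.const_smul ?_ _
  simp only [circleIntegral]
  refine intervalIntegral.continuous_parametric_intervalIntegral_of_continuous' ?_ _ _
  simp only [Function.uncurry_def, deriv_circleMap]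
  have h1 : Continuous fun p : X × ℝ => f p.1 (circleMap 0 1 p.2) := by
    have := hf.comp (f := fun p : X × ℝ => (p.1, Circle.exp p.2)) (by fun_prop)
    convert this using 2 with p
    simp [circleMap]
  exact Continuous.smul (((continuous_circleMap 0 1).comp continuous_snd).mul continuous_const) h1

theorem tendsto_circAvg_zpow {f : ℂ → S} :
    Filter.Tendsto (fun k : ℕ => circAvg fun z => z ^ (-(k : ℤ) - 1) • f z) Filter.atTop (𝓝 0) := by
  let g : ℝ → S := (Set.Ioc 0 (2 * Real.pi)).indicator fun θ => f (circleMap 0 1 θ)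
  have h := Real.tendsto_integral_exp_smul_cocompact g
  have hk : Filter.Tendsto (fun k : ℕ => (k : ℝ) / (2 * Real.pi)) Filter.atTop
      (Filter.cocompact ℝ) := by
    refine Filter.Tendsto.mono_right ?_ atTop_le_cocompact
    exact Filter.Tendsto.atTop_div_const (by positivity) tendsto_natCast_atTop_atTop
  have h2 := ((h.comp hk).const_smul (Complex.I : ℂ)).const_smul (2 * Real.pi * Complex.I : ℂ)⁻¹
  rw [smul_zero, smul_zero] at h2
  refine h2.congr fun k => ?_
  simp only [Function.comp, circAvg]
  congr 1
  rw [← MeasureTheory.integral_smul, circleIntegral, intervalIntegral.integral_of_le (by positivity),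
    ← MeasureTheory.integral_indicator measurableSet_Ioc]
  congr 1
  ext θ
  by_cases hθ : θ ∈ Set.Ioc 0 (2 * Real.pi)
  · simp only [g, Set.indicator_of_mem hθ, deriv_circleMap, smul_smul, Circle.smul_def]
    congr 1
    simp only [circleMap, zero_add, Complex.ofReal_one, one_mul, Real.fourierChar_apply]
    rw [← Complex.exp_int_mul, mul_right_comm (Complex.exp (θ * Complex.I)), ← Complex.exp_add,
      mul_comm Complex.I]
    congr 2
    have : (Real.pi : ℂ) ≠ 0 := by simp [Real.pi_ne_zero]
    push_cast
    field_simp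
    ring
  · simp [g, Set.indicator_of_notMem hθ]

theorem norm_circAvg_le {f : ℂ → S} {C : ℝ} (h : ∀ z, ‖z‖ = 1 → ‖f z‖ ≤ C) : ‖circAvg f‖ ≤ C := by
  have := circleIntegral.norm_two_pi_i_inv_smul_integral_le_of_norm_le_const (c := 0) zero_le_one
    (f := f) (C := C) fun z hz => h z (by simpa using hz)
  simpa [circAvg] using this

/-- The pencil `z ↦ z • a + b` is invertible along the unit circle. -/
def PencilUnit (a b : R) : Prop := ∀ z : ℂ, ‖z‖ = 1 → IsUnit (z • a + b)

/-- The spectral idempotent of the pencil `z • a + b` for the inside of the unit circle. -/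
noncomputable def pencilProj (a b : R) : R := circAvg fun z => Ring.inverse (z • a + b) * a

/-- The Laurent coefficients of the resolvent of a pencil. -/
noncomputable def pencilCoeff (a b : R) (n : ℤ) : R :=
  circAvg fun z => z ^ (-n - 1) • Ring.inverse (z • a + b)

theorem PencilUnit.continuousOn {a b : R} (h : PencilUnit a b) :
    ContinuousOn (fun z : ℂ => Ring.inverse (z • a + b)) (Metric.sphere 0 1) := by
  intro z hz
  obtain ⟨u, hu⟩ := h z (by simpa using hz)
  have h1 : ContinuousAt Ring.inverse (z • a + b) := hu ▸ NormedRing.inverse_continuousAt u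
  exact (h1.comp (f := fun z : ℂ => z • a + b) (by fun_prop)).continuousWithinAt

theorem PencilUnit.continuousOn_smul {a b : R} (h : PencilUnit a b) (n : ℤ) :
    ContinuousOn (fun z : ℂ => z ^ n • Ring.inverse (z • a + b)) (Metric.sphere 0 1) := by
  refine ContinuousOn.smul (fun z hz => ?_) h.continuousOn
  have : z ≠ 0 := by rintro rfl; simp at hz
  exact (continuousAt_zpow₀ z n (Or.inl this)).continuousWithinAt

theorem PencilUnit.coeff_right {a b : R} (h : PencilUnit a b) (n : ℤ) :
    b * pencilCoeff a b n + a * pencilCoeff a b (n - 1) = if n = 0 then 1 else 0 := by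
  unfold pencilCoeff
  rw [← circAvg_const_mul _ (h.continuousOn_smul _), ← circAvg_const_mul _ (h.continuousOn_smul _),
    ← circAvg_add (f := fun z => b * z ^ (-n - 1) • Ring.inverse (z • a + b))
      (g := fun z => a * z ^ (-(n - 1) - 1) • Ring.inverse (z • a + b))
      (continuousOn_const.mul (h.continuousOn_smul _))
      (continuousOn_const.mul (h.continuousOn_smul _))]
  have : ∀ z : ℂ, ‖z‖ = 1 → b * z ^ (-n - 1) • Ring.inverse (z • a + b) +
      a * z ^ (-(n - 1) - 1) • Ring.inverse (z • a + b) = z ^ (-n - 1) • (1 : R) := by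
    intro z hz
    have hz0 : z ≠ 0 := by rintro rfl; simp at hz
    have e : z ^ (-(n - 1) - 1) = z ^ (-n - 1) * z := by
      rw [← zpow_add_one₀ hz0]; congr 1; ring
    rw [e, mul_smul, mul_smul_comm, mul_smul_comm, mul_smul_comm, ← smul_add, ← smul_mul_assoc,
      ← add_mul, add_comm b, Ring.mul_inverse_cancel _ (h z hz)]
  rw [circAvg_congr this, circAvg_smul_const, circAvg_zpow]
  by_cases hn : n = 0
  · simp [hn]
  · rw [if_neg (by omega), if_neg hn, zero_smul]

theorem PencilUnit.coeff_left {a b : R} (h : PencilUnit a b) (n : ℤ) :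
    pencilCoeff a b n * b + pencilCoeff a b (n - 1) * a = if n = 0 then 1 else 0 := by
  unfold pencilCoeff
  rw [← circAvg_mul_const _ (h.continuousOn_smul _), ← circAvg_mul_const _ (h.continuousOn_smul _),
    ← circAvg_add (f := fun z => z ^ (-n - 1) • Ring.inverse (z • a + b) * b)
      (g := fun z => z ^ (-(n - 1) - 1) • Ring.inverse (z • a + b) * a)
      ((h.continuousOn_smul _).mul continuousOn_const)
      ((h.continuousOn_smul _).mul continuousOn_const)]
  have : ∀ z : ℂ, ‖z‖ = 1 → z ^ (-n - 1) • Ring.inverse (z • a + b) * b +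
      z ^ (-(n - 1) - 1) • Ring.inverse (z • a + b) * a = z ^ (-n - 1) • (1 : R) := by
    intro z hz
    have hz0 : z ≠ 0 := by rintro rfl; simp at hz
    have e : z ^ (-(n - 1) - 1) = z ^ (-n - 1) * z := by
      rw [← zpow_add_one₀ hz0]; congr 1; ring
    rw [e, mul_smul, smul_mul_assoc, smul_mul_assoc, smul_mul_assoc, ← smul_add, ← mul_smul_comm,
      ← mul_add, add_comm b, Ring.inverse_mul_cancel _ (h z hz)]
  rw [circAvg_congr this, circAvg_smul_const, circAvg_zpow]
  by_cases hn : n = 0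
  · simp [hn]
  · rw [if_neg (by omega), if_neg hn, zero_smul]

theorem PencilUnit.proj_eq {a b : R} (h : PencilUnit a b) :
    pencilProj a b = pencilCoeff a b (-1) * a := by
  unfold pencilProj pencilCoeff
  rw [circAvg_mul_const _ h.continuousOn]
  simp

theorem PencilUnit.b_mul_proj {a b : R} (h : PencilUnit a b) :
    b * pencilProj a b = a * pencilCoeff a b (-1) * b := by
  have h1 := h.coeff_right (-1)
  have h2 := h.coeff_left (-1)
  rw [if_neg (by decide)] at h1 h2
  rw [h.proj_eq, ← mul_assoc, eq_neg_of_add_eq_zero_left h1, mul_assoc,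
    eq_neg_of_add_eq_zero_left h2, neg_mul, mul_neg, mul_assoc]

theorem PencilUnit.coeff_sandwich {a b : R} (h : PencilUnit a b) :
    pencilCoeff a b (-1) * a * pencilCoeff a b (-1) = pencilCoeff a b (-1) := by
  set c := pencilCoeff a b with hc
  have key : ∀ n m : ℤ, c n * a * c (m - 1) - c (n - 1) * a * c m =
      (if m = 0 then c n else 0) - if n = 0 then c m else 0 := by
    intro n m
    have h1 := eq_sub_of_add_eq' (h.coeff_right m)
    have h2 := eq_sub_of_add_eq' (h.coeff_left n)
    rw [← hc] at h1 h2
    rw [mul_assoc, h1, h2, mul_sub, sub_mul, mul_assoc (c n) b]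
    split_ifs <;> simp [mul_assoc] <;> abel
  have hD : ∀ k : ℕ, c (-1) * a * c (-1) = c (-1) + c (-2 - k) * a * c k := by
    intro k
    induction k with
    | zero =>
      have := key (-1) 0
      simp only [if_true] at this
      rw [if_neg (by decide), sub_zero] at this
      simpa [add_comm] using sub_eq_iff_eq_add.1 this
    | succ k ih =>
      have := key (-2 - k) (k + 1)
      rw [if_neg (by omega), if_neg (by omega), sub_zero, sub_eq_zero] at this
      rw [ih]
      congr 1
      convert this using 3 <;> push_cast <;> ring_nf
  obtain ⟨C, hC⟩ : ∃ C, ∀ n, ‖c n‖ ≤ C := by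
    obtain ⟨C, hC⟩ := (isCompact_sphere (0 : ℂ) 1).exists_bound_of_continuousOn h.continuousOn
    refine ⟨C, fun n => norm_circAvg_le fun z hz => ?_⟩
    rw [norm_smul, norm_zpow, hz, _root_.one_zpow, one_mul]
    exact hC z (by simpa using hz)
  have ht : Filter.Tendsto (fun k : ℕ => c k) Filter.atTop (𝓝 0) := tendsto_circAvg_zpow
  have h0 : Filter.Tendsto (fun k : ℕ => c (-2 - k) * a * c k) Filter.atTop (𝓝 0) := by
    refine squeeze_zero_norm (a := fun k : ℕ => C * ‖a‖ * ‖c k‖) (fun k => ?_) ?_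
    · refine (norm_mul_le _ _).trans (mul_le_mul_of_nonneg_right ?_ (norm_nonneg _))
      exact (norm_mul_le _ _).trans (mul_le_mul_of_nonneg_right (hC _) (norm_nonneg _))
    · simpa using ht.norm.const_mul (C * ‖a‖)
  have hlim := h0.const_add (c (-1))
  rw [add_zero] at hlim
  exact tendsto_nhds_unique (tendsto_const_nhds.congr fun k => hD k) hlim

theorem PencilUnit.proj_mul_proj {a b : R} (h : PencilUnit a b) :
    pencilProj a b * pencilProj a b = pencilProj a b := by
  rw [h.proj_eq, ← mul_assoc, h.coeff_sandwich]

theorem PencilUnit.proj_mul_of_kernel {a b w : R} (h : PencilUnit a b) {ζ : ℂ} (hζ : ‖ζ‖ ≠ 1)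
    (hw : (ζ • a + b) * w = 0) :
    pencilProj a b * w = circAvg (fun z : ℂ => (z - ζ)⁻¹) • w := by
  rw [h.proj_eq, pencilCoeff, ← circAvg_mul_const _ (h.continuousOn_smul _),
    ← circAvg_mul_const (f := fun z => z ^ (-(-1) - 1 : ℤ) • Ring.inverse (z • a + b) * a) w
      ((h.continuousOn_smul _).mul continuousOn_const), ← circAvg_smul_const]
  refine circAvg_congr fun z hz => ?_
  have hne : z - ζ ≠ 0 := fun h0 => hζ (by rw [← sub_eq_zero.1 h0, hz])
  have e : (z • a + b) * w = (z - ζ) • (a * w) := by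
    have : z • a + b = (z - ζ) • a + (ζ • a + b) := by rw [sub_smul]; abel
    rw [this, add_mul, hw, add_zero, smul_mul_assoc]
  have e2 : a * w = (z - ζ)⁻¹ • ((z • a + b) * w) := by rw [e, inv_smul_smul₀ hne]
  rw [mul_assoc, e2]
  simp only [neg_neg, sub_self, zpow_zero, one_smul]
  rw [mul_smul_comm, ← mul_assoc, Ring.inverse_mul_cancel _ (h z hz), one_mul]

theorem PencilUnit.eq_zero_of_homotopy {a b w : R} (h : PencilUnit a b) {z : ℂ} (hz : ‖z‖ = 1)
    {t : ℝ} (ht0 : 0 ≤ t) (ht1 : t ≤ 1)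
    (hw : ((z • a + (t : ℂ) • b) * pencilProj a b +
      (((t : ℂ) * z) • a + b) * (1 - pencilProj a b)) * w = 0) : w = 0 := by
  set Q := pencilProj a b with hQ
  have hQQ : Q * Q = Q := h.proj_mul_proj
  set Q' := a * pencilCoeff a b (-1) with hQ'
  have haQ : a * Q = Q' * a := by rw [hQ, h.proj_eq, hQ', mul_assoc]
  have hbQ : b * Q = Q' * b := h.b_mul_proj
  have hcomm : ∀ x y : ℂ, (x • a + y • b) * Q = Q' * (x • a + y • b) := by
    intro x y
    simp only [add_mul, mul_add, smul_mul_assoc, mul_smul_comm, haQ, hbQ]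
  have h1 : (z • a + (t : ℂ) • b) * (Q * w) = 0 := by
    have e1 : Q' * ((z • a + (t : ℂ) • b) * Q) = (z • a + (t : ℂ) • b) * Q := by
      rw [← mul_assoc, ← hcomm, mul_assoc, hQQ]
    have e2 : Q' * ((((t : ℂ) * z) • a + b) * (1 - Q)) = 0 := by
      have := hcomm ((t : ℂ) * z) 1
      rw [one_smul] at this
      rw [← mul_assoc, ← this, mul_assoc, mul_sub, mul_one, hQQ, sub_self, mul_zero]
    have := congrArg (Q' * ·) hw
    simp only [mul_zero] at this
    rw [← mul_assoc, mul_add, e1, e2, add_zero, mul_assoc] at this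
    exact this
  have h2 : (((t : ℂ) * z) • a + b) * ((1 - Q) * w) = 0 := by
    rw [add_mul, mul_assoc, h1, zero_add, mul_assoc] at hw
    exact hw
  have hw1 : Q * w = 0 := by
    have hQw : Q * (Q * w) = Q * w := by rw [← mul_assoc, hQQ]
    rcases ht0.eq_or_lt with rfl | htpos
    · simp only [Complex.ofReal_zero, zero_smul, add_zero] at h1
      have hz0 : z ≠ 0 := by rintro rfl; simp at hz
      rw [smul_mul_assoc, smul_eq_zero_iff_right hz0] at h1
      have h3 := h.proj_eq
      rw [← hQ] at h3
      rw [← hQw]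
      nth_rewrite 1 [h3]
      rw [mul_assoc, h1, mul_zero]
    · have htc : (t : ℂ) ≠ 0 := by exact_mod_cast htpos.ne'
      have h3 : ((z / t) • a + b) * (Q * w) = 0 := by
        have : (z / t) • a + b = (t : ℂ)⁻¹ • (z • a + (t : ℂ) • b) := by
          rw [smul_add, smul_smul, inv_smul_smul₀ htc, div_eq_inv_mul]
        rw [this, smul_mul_assoc, h1, smul_zero]
      have hn : ‖z / t‖ = t⁻¹ := by
        rw [norm_div, hz, Complex.norm_real, Real.norm_of_nonneg ht0, one_div]
      rcases ht1.eq_or_lt with rfl | htlt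
      · have := h (z / ((1 : ℝ) : ℂ)) (by simpa using hz)
        exact (this.mul_right_eq_zero).1 h3
      · have h4 : 1 < ‖z / t‖ := by rw [hn]; exact (one_lt_inv₀ htpos).2 htlt
        rw [← hQw, hQ, h.proj_mul_of_kernel h4.ne' (by rw [← hQ]; exact h3),
          circAvg_sub_inv_of_gt h4, zero_smul]
  have hw2 : (1 - Q) * w = 0 := by
    have hQw : Q * ((1 - Q) * w) = 0 := by
      rw [← mul_assoc, mul_sub, hQQ, mul_one, sub_self, zero_mul]
    have hn : ‖(t : ℂ) * z‖ = t := by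
      rw [norm_mul, hz, Complex.norm_real, Real.norm_of_nonneg ht0, mul_one]
    rcases ht1.eq_or_lt with rfl | htlt
    · exact ((h _ hn).mul_right_eq_zero).1 h2
    · rw [hQ, h.proj_mul_of_kernel (by rw [hn]; exact htlt.ne) (by rw [← hQ]; exact h2),
        circAvg_sub_inv_of_lt (by rw [hn]; exact htlt), one_smul] at hQw
      exact hQw
  calc w = Q * w + (1 - Q) * w := by rw [sub_mul, one_mul]; abel
    _ = 0 := by rw [hw1, hw2, add_zero]

theorem continuous_pencilProj {X : Type} [TopologicalSpace X] {a b : X → R} (ha : Continuous a)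
    (hb : Continuous b) (h : ∀ x, PencilUnit (a x) (b x)) :
    Continuous fun x => pencilProj (a x) (b x) := by
  unfold pencilProj
  refine continuous_circAvg (f := fun x z => Ring.inverse (z • a x + b x) * a x) ?_
  refine Continuous.mul ?_ (by fun_prop)
  refine continuous_iff_continuousAt.2 fun p => ?_
  obtain ⟨u, hu⟩ := h p.1 p.2 (Circle.norm_coe _)
  have h1 : ContinuousAt Ring.inverse ((p.2 : ℂ) • a p.1 + b p.1) :=
    hu ▸ NormedRing.inverse_continuousAt u
  exact h1.comp (f := fun p : X × Circle => (p.2 : ℂ) • a p.1 + b p.1)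
    (Continuous.continuousAt (by fun_prop))

end Pencil

/-! ### Laurent approximation of loops of matrices -/

section Laurent

variable {X ι : Type} [TopologicalSpace X] [Fintype ι] [DecidableEq ι]

/-- The Laurent polynomial with coefficients `b`, divided by the `k`-th power of the variable. -/
noncomputable def laurentSum {S : Type} [AddCommMonoid S] [Module ℂ S] (k : ℕ) (b : ℕ → S)
    (z : ℂ) : S :=
  (z ^ k)⁻¹ • ∑ t ∈ Finset.range (2 * k + 1), z ^ t • b t

theorem eventually_exists_laurentSum {g : C(X × Circle, ℂ)}
    (hg : g ∈ Submodule.span ℂ {g : C(X × Circle, ℂ) | ∃ (f : C(X, ℂ)) (n : ℤ),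
      ∀ p, g p = f p.1 * (p.2 : ℂ) ^ n}) :
    ∀ᶠ k : ℕ in Filter.atTop, ∃ b : ℕ → C(X, ℂ), ∀ p, g p = laurentSum k (fun t => b t p.1) p.2 := by
  induction hg using Submodule.span_induction with
  | mem g hg =>
    obtain ⟨f, n, hg⟩ := hg
    filter_upwards [Filter.eventually_ge_atTop n.natAbs] with k hk
    refine ⟨fun t => if (t : ℤ) = n + k then f else 0, fun p => ?_⟩
    obtain ⟨m, hm⟩ : ∃ m : ℕ, (m : ℤ) = n + k := ⟨(n + k).toNat, by omega⟩
    have hz : (p.2 : ℂ) ≠ 0 := Circle.coe_ne_zero _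
    rw [hg, laurentSum, Finset.sum_eq_single m]
    · simp only [if_pos hm]
      rw [smul_eq_mul, smul_eq_mul, ← mul_assoc, mul_comm, ← zpow_natCast, ← zpow_natCast,
        ← _root_.zpow_neg, ← zpow_add₀ hz, hm]
      congr 2
      omega
    · intro t _ ht
      simp only
      rw [if_neg (by omega)]
      simp
    · intro h
      exact absurd (Finset.mem_range.2 (by omega)) h
  | zero => exact Filter.Eventually.of_forall fun k => ⟨0, fun p => by simp [laurentSum]⟩
  | add g h _ _ h1 h2 =>
    filter_upwards [h1, h2] with k ⟨b, hb⟩ ⟨c, hc⟩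
    refine ⟨b + c, fun p => ?_⟩
    simp [hb, hc, laurentSum, mul_add, Finset.sum_add_distrib]
  | smul c g _ h1 =>
    filter_upwards [h1] with k ⟨b, hb⟩
    refine ⟨c • b, fun p => ?_⟩
    simp only [ContinuousMap.smul_apply, hb, laurentSum, Pi.smul_apply, smul_eq_mul, Finset.mul_sum]
    refine Finset.sum_congr rfl fun t _ => by ring

theorem exists_laurentSum_near [CompactSpace X] [T2Space X] (f : C(X × Circle, ℂ)) {ε : ℝ}
    (hε : 0 < ε) : ∀ᶠ k : ℕ in Filter.atTop, ∃ b : ℕ → C(X, ℂ),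
      ∀ p, ‖laurentSum k (fun t => b t p.1) (p.2 : ℂ) - f p‖ < ε := by
  let s : Set C(X × Circle, ℂ) := {g | ∃ (f : C(X, ℂ)) (n : ℤ), ∀ p, g p = f p.1 * (p.2 : ℂ) ^ n}
  have hs : Submonoid.closure s ≤ (⟨⟨s, ?_⟩, ?_⟩ : Submonoid C(X × Circle, ℂ)) :=
    Submonoid.closure_le.2 fun x hx => hx
  rotate_left
  · rintro g h ⟨f, n, hf⟩ ⟨f', n', hf'⟩
    refine ⟨f * f', n + n', fun p => ?_⟩
    rw [ContinuousMap.mul_apply, hf, hf', zpow_add₀ (Circle.coe_ne_zero _), ContinuousMap.mul_apply]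
    ring
  · exact ⟨1, 0, fun p => by simp⟩
  let A : StarSubalgebra ℂ C(X × Circle, ℂ) :=
    { Algebra.adjoin ℂ s with
      star_mem' := by
        intro g hg
        induction hg using Algebra.adjoin_induction with
        | mem g hg =>
          obtain ⟨f, n, hg⟩ := hg
          refine Algebra.subset_adjoin ⟨star f, -n, fun p => ?_⟩
          rw [ContinuousMap.star_apply, hg, star_mul', ContinuousMap.star_apply, _root_.zpow_neg,
            ← _root_.inv_zpow, ← Circle.coe_inv, Circle.coe_inv_eq_conj, star_zpow₀]
          rfl
        | algebraMap r => exact Subalgebra.algebraMap_mem _ (star r)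
        | add g h _ _ h1 h2 => rw [star_add]; exact (Algebra.adjoin ℂ s).add_mem h1 h2
        | mul g h _ _ h1 h2 => rw [star_mul]; exact (Algebra.adjoin ℂ s).mul_mem h2 h1 }
  have hsep : A.SeparatesPoints := by
    rintro ⟨x, z⟩ ⟨y, w⟩ hne
    by_cases hxy : x = y
    · refine ⟨_, ⟨⟨fun p => (p.2 : ℂ), by fun_prop⟩, Algebra.subset_adjoin ⟨1, 1, fun p => ?_⟩, rfl⟩,
        ?_⟩
      · simp
      · intro h
        have h' : z = w := Circle.coe_injective h
        exact hne (by rw [hxy, h'])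
    · obtain ⟨f, hf0, hf1, -⟩ := exists_continuous_zero_one_of_isClosed (isClosed_singleton (x := x))
        (isClosed_singleton (x := y)) (by simpa using hxy)
      refine ⟨_, ⟨⟨fun p => (f p.1 : ℂ), by fun_prop⟩, Algebra.subset_adjoin
        ⟨⟨fun x => (f x : ℂ), by fun_prop⟩, 0, fun p => ?_⟩, rfl⟩, ?_⟩
      · simp
      · simp [hf0 rfl, hf1 rfl]
  have htop := ContinuousMap.starSubalgebra_topologicalClosure_eq_top_of_separatesPoints A hsep
  have hf : f ∈ closure (A : Set C(X × Circle, ℂ)) := by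
    rw [← StarSubalgebra.topologicalClosure_coe, htop]
    exact Set.mem_univ _
  obtain ⟨g, hg, hgf⟩ := Metric.mem_closure_iff.1 hf ε hε
  have hg' : g ∈ Submodule.span ℂ s := by
    have h1 : g ∈ Subalgebra.toSubmodule (Algebra.adjoin ℂ s) := hg
    rw [Algebra.adjoin_eq_span] at h1
    exact Submodule.span_mono hs h1
  filter_upwards [eventually_exists_laurentSum hg'] with k ⟨b, hb⟩
  refine ⟨b, fun p => ?_⟩
  rw [← hb, ← dist_eq_norm, dist_comm]
  exact (ContinuousMap.dist_apply_le_dist p).trans_lt hgf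

theorem exists_laurentSum_isUnit [CompactSpace X] [T2Space X] (F : X × Circle → Matrix ι ι ℂ)
    (hF : Continuous F) (hF' : ∀ p, IsUnit (F p)) :
    ∃ (k : ℕ) (b : ℕ → X → Matrix ι ι ℂ), 1 ≤ k ∧ (∀ t, Continuous (b t)) ∧
      (∀ p (τ : I),
        IsUnit ((1 - (τ : ℂ)) • F p + (τ : ℂ) • laurentSum k (fun t => b t p.1) p.2)) ∧
      ∀ (x x' : X) (z : Circle) (τ : I), F (x, z) = F (x', z) →
        IsUnit ((1 - (τ : ℂ)) • laurentSum k (fun t => b t x) z +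
          (τ : ℂ) • laurentSum k (fun t => b t x') z) := by
  obtain ⟨ε, hε, hball⟩ : ∃ ε > 0, ∀ p, ∀ B : ι → ι → ℂ, dist B (F p) < ε →
      IsUnit (Matrix.of B) := by
    have hK : IsCompact (Set.range fun p => (F p : ι → ι → ℂ)) := isCompact_range hF
    obtain ⟨δ, hδ, h⟩ := hK.exists_thickening_subset_open
      (t := {A : ι → ι → ℂ | IsUnit (Matrix.of A)}) isOpen_setOf_isUnit_matrix
      (by rintro _ ⟨p, rfl⟩; exact hF' p)
    exact ⟨δ, hδ, fun p B hB => h (Metric.mem_thickening_iff.2 ⟨_, ⟨p, rfl⟩, hB⟩)⟩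
  have hev : ∀ᶠ k : ℕ in Filter.atTop, ∀ i j, ∃ b : ℕ → C(X, ℂ),
      ∀ p, ‖laurentSum k (fun t => b t p.1) (p.2 : ℂ) - F p i j‖ < ε / 2 := by
    simp only [Filter.eventually_all]
    exact fun i j => exists_laurentSum_near ⟨fun p => F p i j, by fun_prop⟩ (half_pos hε)
  obtain ⟨k, hk, hk1⟩ := (hev.and (Filter.eventually_ge_atTop 1)).exists
  choose b hb using hk
  have he : ∀ (x : X) (z : Circle) (i j : ι),
      laurentSum k (fun t => Matrix.of fun i j => b i j t x) (z : ℂ) i j =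
        laurentSum k (fun t => b i j t x) (z : ℂ) := by
    intro x z i j
    simp [laurentSum, Matrix.sum_apply]
  have hτ : ∀ τ : I, ‖(τ : ℂ)‖ = τ ∧ ‖(1 - (τ : ℂ))‖ = 1 - τ := by
    intro τ
    have e : (1 - (τ : ℂ)) = ((1 - (τ : ℝ) : ℝ) : ℂ) := by push_cast; rfl
    rw [e, Complex.norm_real, Complex.norm_real, Real.norm_of_nonneg τ.2.1,
      Real.norm_of_nonneg (by linarith [τ.2.2])]
    exact ⟨rfl, rfl⟩
  have key : ∀ (p : X × Circle) (A B : Matrix ι ι ℂ) (τ : I),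
      (∀ i j, ‖A i j - F p i j‖ ≤ ε / 2) → (∀ i j, ‖B i j - F p i j‖ ≤ ε / 2) →
      IsUnit ((1 - (τ : ℂ)) • A + (τ : ℂ) • B) := by
    intro p A B τ hA hB
    refine hball p _ (lt_of_le_of_lt ?_ (half_lt_self hε))
    refine (dist_pi_le_iff (half_pos hε).le).2 fun i => (dist_pi_le_iff (half_pos hε).le).2 fun j => ?_
    rw [dist_eq_norm]
    change ‖(1 - (τ : ℂ)) • A i j + (τ : ℂ) • B i j - F p i j‖ ≤ _
    have : (1 - (τ : ℂ)) • A i j + (τ : ℂ) • B i j - F p i j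
      = (1 - (τ : ℂ)) * (A i j - F p i j) + (τ : ℂ) * (B i j - F p i j) := by
      simp only [smul_eq_mul]; ring
    rw [this]
    refine (norm_add_le _ _).trans ?_
    rw [norm_mul, norm_mul, (hτ τ).1, (hτ τ).2]
    nlinarith [hA i j, hB i j, τ.2.1, τ.2.2]
  refine ⟨k, fun t x => Matrix.of fun i j => b i j t x, hk1, fun t => ?_, fun p τ => ?_,
    fun x x' z τ h => ?_⟩
  · exact continuous_matrix fun i j => (b i j t).continuous
  · refine key p _ _ τ (fun i j => ?_) fun i j => ?_
    · rw [sub_self, norm_zero]; exact (half_pos hε).le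
    · rw [he]; exact (hb i j p).le
  · refine key (x, z) _ _ τ (fun i j => ?_) fun i j => ?_
    · rw [he]; exact (hb i j (x, z)).le
    · rw [he, h]; exact (hb i j (x', z)).le

end Laurent

/-! ### Linearization of polynomial loops -/

section Companion

variable {X ι : Type} [TopologicalSpace X] [Fintype ι] [DecidableEq ι]

/-- The block companion matrix of the polynomial with coefficients `r`. -/
noncomputable def companion (m : ℕ) (r : ℕ → Matrix ι ι ℂ) (w : ℂ) :
    Matrix (Fin (m + 1) × ι) (Fin (m + 1) × ι) ℂ :=
  Matrix.of fun p q => if p.1 = 0 then r q.1 p.2 q.2 else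
    (if p.1 = q.1 then 1 else if (q.1 : ℕ) + 1 = p.1 then -w else 0) *
      (1 : Matrix ι ι ℂ) p.2 q.2

/-- The coefficient of the variable in the block companion matrix. -/
noncomputable def companionShift (ι : Type) [DecidableEq ι] (m : ℕ) :
    Matrix (Fin (m + 1) × ι) (Fin (m + 1) × ι) ℂ :=
  Matrix.of fun p q => (if (q.1 : ℕ) + 1 = p.1 then -1 else 0) * (1 : Matrix ι ι ℂ) p.2 q.2

theorem companion_eq (m : ℕ) (r : ℕ → Matrix ι ι ℂ) (w : ℂ) :
    companion m r w = w • companionShift ι m + companion m r 0 := by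
  ext ⟨p, i⟩ ⟨q, j⟩
  simp only [companion, companionShift, Matrix.of_apply, Matrix.add_apply, Matrix.smul_apply,
    smul_eq_mul]
  by_cases hp : p = 0
  · subst hp
    simp
  · by_cases hpq : p = q
    · subst hpq
      simp [hp]
    · by_cases h : (q : ℕ) + 1 = p
      · simp [hp, hpq, h]
      · simp [hp, hpq, h]

variable {κ : Type}

theorem companion_mul_zero (m : ℕ) (r : ℕ → Matrix ι ι ℂ) (w : ℂ)
    (W : Matrix (Fin (m + 1) × ι) κ ℂ) (i : ι) (c : κ) :
    (companion m r w * W) (0, i) c = ∑ t : Fin (m + 1), ∑ j, r t i j * W (t, j) c := by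
  rw [Matrix.mul_apply, Fintype.sum_prod_type]
  simp [companion]

theorem companion_mul_succ (m : ℕ) (r : ℕ → Matrix ι ι ℂ) (w : ℂ)
    (W : Matrix (Fin (m + 1) × ι) κ ℂ) (t : Fin m) (i : ι) (c : κ) :
    (companion m r w * W) (t.succ, i) c = W (t.succ, i) c - w * W (t.castSucc, i) c := by
  rw [Matrix.mul_apply, Fintype.sum_prod_type]
  simp only [companion, Matrix.of_apply, Fin.succ_ne_zero, if_false, Matrix.one_apply, mul_ite,
    mul_one, mul_zero, ite_mul, zero_mul, Finset.sum_ite_eq, Finset.mem_univ, if_true, one_mul]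
  rw [Fintype.sum_eq_add t.succ t.castSucc (by simp [Fin.ext_iff])]
  · rw [if_pos rfl, if_neg (by simp [Fin.ext_iff]), if_pos (by simp)]
    ring
  · intro q hq
    rw [if_neg (Ne.symm hq.1), if_neg]
    intro h
    exact hq.2 (Fin.ext (by simpa using h))

theorem companionShift_mul_succ (m : ℕ) (W : Matrix (Fin (m + 1) × ι) κ ℂ) (t : Fin m) (i : ι)
    (c : κ) : (companionShift ι m * W) (t.succ, i) c = - W (t.castSucc, i) c := by
  rw [Matrix.mul_apply, Fintype.sum_prod_type]
  simp only [companionShift, Matrix.of_apply, Matrix.one_apply, mul_ite,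
    mul_one, mul_zero, ite_mul, zero_mul, Finset.sum_ite_eq, Finset.mem_univ, if_true, one_mul]
  rw [Fintype.sum_eq_single t.castSucc]
  · simp
  · intro q hq
    rw [if_neg]
    intro h
    exact hq (Fin.ext (by simpa using h))

theorem IsUnit.matrix_eq_zero_of_mul_eq_zero {A : Matrix ι ι ℂ} (hA : IsUnit A) {W : Matrix ι κ ℂ}
    (h : A * W = 0) : W = 0 := by
  rw [← Matrix.one_mul W, ← hA.matrix_inv_mul, Matrix.mul_assoc, h, Matrix.mul_zero]

theorem isUnit_companion {m : ℕ} {r : ℕ → Matrix ι ι ℂ} {w : ℂ}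
    (h : IsUnit (∑ t ∈ Finset.range (m + 1), w ^ t • r t)) : IsUnit (companion m r w) := by
  refine isUnit_of_forall_mul_eq_zero fun W hW => ?_
  have hs : ∀ (t : Fin (m + 1)) i c, W (t, i) c = w ^ (t : ℕ) * W (0, i) c := by
    intro t i c
    induction t using Fin.induction with
    | zero => simp
    | succ t ih =>
      have := congrFun (congrFun hW (t.succ, i)) c
      rw [companion_mul_succ, Matrix.zero_apply, sub_eq_zero] at this
      rw [this, ih, Fin.val_succ, Fin.val_castSucc, pow_succ]
      ring
  have h0 : (∑ t ∈ Finset.range (m + 1), w ^ t • r t) *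
      W.submatrix (fun i => ((0 : Fin (m + 1)), i)) id = 0 := by
    ext i c
    have := congrFun (congrFun hW (0, i)) c
    rw [companion_mul_zero, Matrix.zero_apply] at this
    rw [Matrix.zero_apply, ← this, Matrix.mul_apply, Finset.sum_comm]
    refine Finset.sum_congr rfl fun j _ => ?_
    rw [Matrix.sum_apply, Finset.sum_mul, Finset.sum_range]
    refine Finset.sum_congr rfl fun t _ => ?_
    rw [hs t j c, Matrix.smul_apply, Matrix.submatrix_apply, smul_eq_mul, id]
    ring
  have h1 := h.matrix_eq_zero_of_mul_eq_zero h0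
  ext ⟨t, i⟩ c
  rw [hs]
  have := congrFun (congrFun h1 i) c
  simp only [Matrix.submatrix_apply, id, Matrix.zero_apply] at this
  simp [this]

/-- Splitting off the first block. -/
def finSuccProdEquiv (ι : Type) (m : ℕ) : ι ⊕ (Fin m × ι) ≃ Fin (m + 1) × ι where
  toFun := Sum.elim (fun i => (0, i)) fun p => (p.1.succ, p.2)
  invFun p := Fin.cases (motive := fun _ => ι → ι ⊕ (Fin m × ι)) Sum.inl
    (fun t i => Sum.inr (t, i)) p.1 p.2
  left_inv p := by rcases p with i | ⟨t, i⟩ <;> simp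
  right_inv p := by
    obtain ⟨t, i⟩ := p
    refine Fin.cases ?_ (fun t => ?_) t <;> simp

theorem glHomotopic_companion (m : ℕ) {b : ℕ → X → Matrix ι ι ℂ} (hb : ∀ t, Continuous (b t))
    (hU : ∀ (x : X) (z : Circle),
      IsUnit (∑ t ∈ Finset.range (m + 1), (z : ℂ) ^ t • b t x)) :
    GLHomotopic (fun p : X × Circle =>
      ((∑ t ∈ Finset.range (m + 1), (p.2 : ℂ) ^ t • b t p.1) ⊞ₘ
        (1 : Matrix (Fin m × ι) (Fin m × ι) ℂ)).submatrix (finSuccProdEquiv ι m).symm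
          (finSuccProdEquiv ι m).symm)
      fun p => companion m (fun t => b t p.1) p.2 := by
  let r : I → X × Circle → ℕ → Matrix ι ι ℂ := fun s p t =>
    if t = 0 then (∑ t ∈ Finset.range (m + 1), (p.2 : ℂ) ^ t • b t p.1) -
      (s : ℂ) • ∑ t ∈ Finset.range m, ((s : ℂ) * p.2) ^ (t + 1) • b (t + 1) p.1
    else (s : ℂ) • b t p.1
  have hr : ∀ t, Continuous fun q : I × (X × Circle) => r q.1 q.2 t := by
    intro t
    by_cases ht : t = 0
    · simp only [r, ht, if_true]
      fun_prop
    · simp only [r, ht, if_false]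
      fun_prop
  refine ⟨fun s p => companion m (r s p) ((s : ℂ) * p.2), ?_, fun s p => isUnit_companion ?_,
    fun p => ?_, fun p => ?_⟩
  · refine continuous_matrix fun i j => ?_
    simp only [companion, Matrix.of_apply]
    split_ifs
    · exact (hr _).matrix_elem _ _
    all_goals fun_prop
  · have : (∑ t ∈ Finset.range (m + 1), ((s : ℂ) * p.2) ^ t • r s p t) =
        ∑ t ∈ Finset.range (m + 1), (p.2 : ℂ) ^ t • b t p.1 := by
      rw [Finset.sum_range_succ']
      simp only [r, if_true, pow_zero, one_smul, Nat.add_eq_zero_iff, one_ne_zero, and_false,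
        if_false, Finset.smul_sum]
      rw [add_comm, sub_add, sub_eq_self, sub_eq_zero]
      exact Finset.sum_congr rfl fun t _ => smul_comm _ _ _
    rw [this]
    exact hU _ _
  · ext ⟨t, i⟩ ⟨t', j⟩
    refine Fin.cases ?_ (fun t => ?_) t <;> refine Fin.cases ?_ (fun t' => ?_) t' <;>
      simp [companion, finSuccProdEquiv, r, Matrix.one_apply, ← ite_and]
    exact if_congr and_comm rfl rfl
  · have : ∀ t, r 1 p t = b t p.1 := by
      intro t
      by_cases ht : t = 0
      · simp only [r, ht, if_true, Set.Icc.coe_one, Complex.ofReal_one, one_smul, one_mul]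
        rw [Finset.sum_range_succ']
        simp
      · simp [r, ht]
    simp [funext this]

end Companion

/-! ### Families of pencils -/

section MatrixPencil

variable {X ι : Type} [TopologicalSpace X] [Fintype ι] [DecidableEq ι]

/-- The pencil `z a + b` is invertible on the unit circle. -/
def MatPencilUnit (a b : Matrix ι ι ℂ) : Prop := ∀ z : ℂ, ‖z‖ = 1 → IsUnit (z • a + b)

open scoped Matrix.Norms.L2Operator in
theorem MatPencilUnit.pencilUnit {a b : Matrix ι ι ℂ} (h : MatPencilUnit a b) :
    PencilUnit a b := h

open scoped Matrix.Norms.L2Operator in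
/-- The spectral idempotent of a pencil of matrices. -/
noncomputable def matPencilProj (a b : Matrix ι ι ℂ) : Matrix ι ι ℂ := pencilProj a b

open scoped Matrix.Norms.L2Operator in
theorem continuous_matPencilProj {a b : X → Matrix ι ι ℂ} (ha : Continuous a) (hb : Continuous b)
    (h : ∀ x, MatPencilUnit (a x) (b x)) : Continuous fun x => matPencilProj (a x) (b x) :=
  continuous_pencilProj ha hb fun x => (h x).pencilUnit

open scoped Matrix.Norms.L2Operator in
theorem matPencilProj_mul_self {a b : Matrix ι ι ℂ} (h : MatPencilUnit a b) :
    matPencilProj a b * matPencilProj a b = matPencilProj a b :=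
  h.pencilUnit.proj_mul_proj

open scoped Matrix.Norms.L2Operator in
theorem glHomotopic_pencil {a b : X → Matrix ι ι ℂ} (ha : Continuous a) (hb : Continuous b)
    (h : ∀ x, MatPencilUnit (a x) (b x)) :
    GLHomotopic (fun p : X × Circle => (a p.1 * matPencilProj (a p.1) (b p.1) +
        b p.1 * (1 - matPencilProj (a p.1) (b p.1))) *
        ((p.2 : ℂ) • matPencilProj (a p.1) (b p.1) + (1 - matPencilProj (a p.1) (b p.1))))
      fun p : X × Circle => (p.2 : ℂ) • a p.1 + b p.1 := by
  have hQ := continuous_matPencilProj ha hb h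
  set Q : X → Matrix ι ι ℂ := fun x => matPencilProj (a x) (b x) with hQdef
  refine ⟨fun t p => ((p.2 : ℂ) • a p.1 + (t : ℂ) • b p.1) * Q p.1 +
      (((t : ℂ) * p.2) • a p.1 + b p.1) * (1 - Q p.1), ?_,
    fun t p => isUnit_of_forall_mul_eq_zero fun w hw =>
      (h p.1).pencilUnit.eq_zero_of_homotopy (Circle.norm_coe p.2) t.2.1 t.2.2 hw, fun p => ?_, fun p => ?_⟩
  · fun_prop
  · have hQQ : Q p.1 * Q p.1 = Q p.1 := matPencilProj_mul_self (h p.1)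
    change _ = (a p.1 * Q p.1 + b p.1 * (1 - Q p.1)) * ((p.2 : ℂ) • Q p.1 + (1 - Q p.1))
    simp only [Set.Icc.coe_zero, Complex.ofReal_zero, zero_smul, add_zero, zero_mul, zero_add]
    simp only [add_mul, mul_add, mul_sub, sub_mul, Matrix.mul_assoc, mul_one, one_mul,
      Matrix.mul_smul, Matrix.smul_mul, hQQ]
    abel
  · simp only [Set.Icc.coe_one, Complex.ofReal_one, one_smul, one_mul]
    rw [← mul_add]
    simp

open scoped Matrix.Norms.L2Operator in
theorem matPencilProj_mul_of_laurent {a b : Matrix ι ι ℂ} (h : MatPencilUnit a b)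
    (E : Matrix ι ι ℂ) (k m : ℕ) (c : ℕ → Matrix ι ι ℂ)
    (hV : ∀ z : ℂ, ‖z‖ = 1 → (z • a + b) * ∑ t ∈ Finset.range m, z ^ ((t : ℤ) - k) • c t =
      z • (a * E)) (hk : k < m) : matPencilProj a b * E = c k := by
  change pencilProj a b * E = _
  rw [h.pencilUnit.proj_eq, Matrix.mul_assoc, pencilCoeff, ← circAvg_mul_const _ (h.pencilUnit.continuousOn_smul _)]
  have : ∀ z : ℂ, ‖z‖ = 1 → z ^ (-(-1) - 1 : ℤ) • Ring.inverse (z • a + b) * (a * E) =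
      ∑ t ∈ Finset.range m, z ^ ((t : ℤ) - k - 1) • c t := by
    intro z hz
    have hz0 : z ≠ 0 := by rintro rfl; simp at hz
    have e : a * E = (z • a + b) * ∑ t ∈ Finset.range m, z ^ ((t : ℤ) - k - 1) • c t := by
      rw [← inv_smul_smul₀ hz0 (a * E), ← hV z hz, ← Matrix.mul_smul, Finset.smul_sum]
      congr 1
      refine Finset.sum_congr rfl fun t _ => ?_
      rw [smul_smul, zpow_sub_one₀ hz0, mul_comm]
    rw [e, ← Matrix.mul_assoc]
    simp [Ring.inverse_mul_cancel _ (h z hz)]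
  rw [circAvg_congr this]
  have hsum : circAvg (fun z : ℂ => ∑ t ∈ Finset.range m, z ^ ((t : ℤ) - k - 1) • c t) =
      ∑ t ∈ Finset.range m, circAvg (fun z : ℂ => z ^ ((t : ℤ) - k - 1) • c t) := by
    clear hV this hk
    induction m with
    | zero => simp [circAvg, circleIntegral]
    | succ m ih =>
      simp only [Finset.sum_range_succ]
      have hc : ∀ n : ℤ, ∀ c : Matrix ι ι ℂ,
          ContinuousOn (fun z : ℂ => z ^ n • c) (Metric.sphere 0 1) := by
        intro n c z hz
        have hz0 : z ≠ 0 := by rintro rfl; simp at hz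
        exact ((continuousAt_zpow₀ z n (Or.inl hz0)).smul continuousAt_const).continuousWithinAt
      rw [circAvg_add (continuousOn_finsetSum _ fun t _ => hc _ _) (hc _ _), ih]
  rw [hsum]
  simp only [circAvg_smul_const, circAvg_zpow]
  rw [Finset.sum_eq_single k]
  · simp
  · intro t _ ht
    rw [if_neg (by omega), zero_smul]
  · intro hk'
    exact absurd (Finset.mem_range.2 hk) hk'

end MatrixPencil

/-! ### Vanishing of the stable homotopy of families over spheres -/

section Stable

variable {X Y ι κ μ : Type} [TopologicalSpace X] [TopologicalSpace Y] [Fintype ι] [DecidableEq ι]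
  [Fintype κ] [DecidableEq κ] [Fintype μ] [DecidableEq μ]

/-- A family of invertible matrices which is homotopic to the identity after stabilization. -/
def StablyConst (u : X → Matrix ι ι ℂ) : Prop :=
  ∃ N : ℕ, GLHomotopic (fun x => u x ⊞ₘ (1 : Matrix (Fin N) (Fin N) ℂ)) fun _ => 1

theorem glHomotopic_const {A B : Matrix ι ι ℂ} (hA : IsUnit A) (hB : IsUnit B) :
    GLHomotopic (fun _ : X => A) fun _ => B := by
  obtain ⟨h, h1, h2, h3, h4⟩ := exists_path_matrix hA hB
  exact ⟨fun t _ => h t, by fun_prop, fun t _ => h2 t, fun _ => h3, fun _ => h4⟩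

theorem StablyConst.of_blockSum {u : X → Matrix ι ι ℂ} {c : Matrix (ι ⊕ κ) (ι ⊕ κ) ℂ}
    (hc : IsUnit c) (h : GLHomotopic (fun x => u x ⊞ₘ (1 : Matrix κ κ ℂ)) fun _ => c) :
    StablyConst u := by
  refine ⟨Fintype.card κ, ?_⟩
  have := (h.trans (glHomotopic_const hc isUnit_one)).reindex
    (Equiv.sumCongr (Equiv.refl ι) (Fintype.equivFin κ).symm)
  simp only [Matrix.submatrix_one_equiv] at this
  convert this using 2 with x
  ext (i | i) (j | j) <;> simp [Matrix.one_apply]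

theorem glHomotopic_susp {d : ℕ} {u v : Sph (d + 1) → Matrix ι ι ℂ}
    (h : I → Sph d → I → Matrix ι ι ℂ)
    (hc : Continuous fun p : I × (Sph d × I) => h p.1 p.2.1 p.2.2)
    (hu : ∀ s x t, IsUnit (h s x t)) (h0 : ∀ s x x', h s x 0 = h s x' 0)
    (h1 : ∀ s x x', h s x 1 = h s x' 1) (hl : ∀ x t, h 0 x t = u (suspMap d (x, t)))
    (hr : ∀ x t, h 1 x t = v (suspMap d (x, t))) : GLHomotopic u v := by
  obtain ⟨g, hg, hgq⟩ := exists_descend_susp h hc h0 h1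
  refine ⟨g, hg, fun t y => ?_, fun y => ?_, fun y => ?_⟩ <;>
    obtain ⟨⟨x, s⟩, rfl⟩ := suspMap_surjective d y
  · rw [hgq]; exact hu _ _ _
  · rw [hgq, hl]
  · rw [hgq, hr]

/-- A family over `X × Circle` which stably is homotopic to a product of families pulled back from
the factors. -/
def StablySplit (F : X × Circle → Matrix ι ι ℂ) : Prop :=
  ∃ (κ : Type) (_ : Fintype κ) (_ : DecidableEq κ) (g : X → Matrix (ι ⊕ κ) (ι ⊕ κ) ℂ)
    (K : Circle → Matrix (ι ⊕ κ) (ι ⊕ κ) ℂ), Continuous g ∧ (∀ x, IsUnit (g x)) ∧ Continuous K ∧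
    (∀ z, IsUnit (K z)) ∧
    GLHomotopic (fun p => F p ⊞ₘ (1 : Matrix κ κ ℂ)) fun p => g p.1 * K p.2

namespace StablySplit

variable {F F' : X × Circle → Matrix ι ι ℂ}

theorem of_blockSum (h : StablySplit fun p => F p ⊞ₘ (1 : Matrix κ κ ℂ)) : StablySplit F := by
  obtain ⟨μ, _, _, g, K, hg, hg', hK, hK', h⟩ := h
  let e := (Equiv.sumAssoc ι κ μ).symm
  refine ⟨κ ⊕ μ, inferInstance, inferInstance, fun x => (g x).submatrix e e,
    fun z => (K z).submatrix e e, by fun_prop, fun x => (hg' x).matrix_reindex e, by fun_prop,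
    fun z => (hK' z).matrix_reindex e, ?_⟩
  have := h.reindex e
  simp only [← Matrix.submatrix_mul_equiv _ _ _ e] at this
  convert this using 2 with p
  ext (i | i | i) (j | j | j) <;> simp [e, Matrix.one_apply]

theorem of_reindex (e : κ ≃ ι) (h : StablySplit fun p => (F p).submatrix e e) :
    StablySplit F := by
  obtain ⟨μ, _, _, g, K, hg, hg', hK, hK', h⟩ := h
  let e' := Equiv.sumCongr e.symm (Equiv.refl μ)
  refine ⟨μ, inferInstance, inferInstance, fun x => (g x).submatrix e' e',
    fun z => (K z).submatrix e' e', by fun_prop, fun x => (hg' x).matrix_reindex e', by fun_prop,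
    fun z => (hK' z).matrix_reindex e', ?_⟩
  have := h.reindex e'
  simp only [← Matrix.submatrix_mul_equiv _ _ _ e'] at this
  convert this using 2 with p
  ext (i | i) (j | j) <;> simp [e', Matrix.one_apply]

theorem of_homotopic (h : GLHomotopic F F') (h' : StablySplit F') : StablySplit F := by
  obtain ⟨μ, i1, i2, g, K, hg, hg', hK, hK', h'⟩ := h'
  exact ⟨μ, i1, i2, g, K, hg, hg', hK, hK',
    (h.blockSum (GLHomotopic.refl continuous_const fun _ => isUnit_one)).trans h'⟩

theorem mul_left {a : X → Matrix ι ι ℂ} (ha : Continuous a) (ha' : ∀ x, IsUnit (a x))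
    (h : StablySplit F) : StablySplit fun p => a p.1 * F p := by
  obtain ⟨μ, i1, i2, g, K, hg, hg', hK, hK', h⟩ := h
  refine ⟨μ, i1, i2, fun x => (a x ⊞ₘ (1 : Matrix μ μ ℂ)) * g x, K, by fun_prop,
    fun x => ((ha' x).blockSum isUnit_one).mul (hg' x), hK, hK', ?_⟩
  have := (GLHomotopic.refl (X := X × Circle) (u := fun p => a p.1 ⊞ₘ (1 : Matrix μ μ ℂ))
    (by fun_prop) fun x => (ha' _).blockSum isUnit_one).mul h
  simp only [Matrix.fromBlocks_multiply, Matrix.mul_zero, Matrix.zero_mul, add_zero, zero_add,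
    Matrix.mul_one, Matrix.mul_assoc] at this ⊢
  exact this

theorem mul_right {a : Circle → Matrix ι ι ℂ} (ha : Continuous a) (ha' : ∀ x, IsUnit (a x))
    (h : StablySplit F) : StablySplit fun p => F p * a p.2 := by
  obtain ⟨μ, i1, i2, g, K, hg, hg', hK, hK', h⟩ := h
  refine ⟨μ, i1, i2, g, fun z => K z * (a z ⊞ₘ (1 : Matrix μ μ ℂ)), hg, hg', by fun_prop,
    fun x => (hK' x).mul ((ha' x).blockSum isUnit_one), ?_⟩
  have := h.mul (GLHomotopic.refl (X := X × Circle) (u := fun p => a p.2 ⊞ₘ (1 : Matrix μ μ ℂ))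
    (by fun_prop) fun x => (ha' _).blockSum isUnit_one)
  simp only [Matrix.fromBlocks_multiply, Matrix.mul_zero, Matrix.zero_mul, add_zero, zero_add,
    Matrix.mul_one, ← Matrix.mul_assoc] at this ⊢
  exact this

end StablySplit

theorem stablySplit_of_mvN {P : X → Matrix ι ι ℂ} (hP : ∀ x, P x * P x = P x) {M : ℕ}
    (hPc : Continuous P) (h : MvN P fun _ => (1 : Matrix (Fin M) (Fin M) ℂ)) :
    StablySplit fun p : X × Circle => (p.2 : ℂ) • P p.1 + (1 - P p.1) := by
  obtain ⟨V, W, hV, hW, hVW, hWV⟩ := h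
  let Y : X → Matrix (ι ⊕ Fin M) (ι ⊕ Fin M) ℂ := fun x => Matrix.fromBlocks (1 - P x) (V x) (W x) 0
  have hPV : ∀ x, P x * V x = V x := fun x => by rw [← hVW, Matrix.mul_assoc, hWV, Matrix.mul_one]
  have hWP : ∀ x, W x * P x = W x := fun x => by
    rw [← hVW, ← Matrix.mul_assoc, hWV, Matrix.one_mul]
  have hY : ∀ x, Y x * Y x = 1 := fun x => by
    simp [Y, Matrix.fromBlocks_multiply, hVW, hWV, hPV, hWP, Matrix.mul_sub, Matrix.sub_mul, hP]
  have hYc : Continuous Y := by fun_prop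
  refine StablySplit.of_blockSum (κ := Fin M) ?_
  refine ⟨ι ⊕ Fin M, inferInstance, inferInstance, fun _ => 1,
    fun z => ((1 : Matrix ι ι ℂ) ⊞ₘ (z : ℂ) • (1 : Matrix (Fin M) (Fin M) ℂ)) ⊞ₘ 1, by fun_prop,
    fun _ => isUnit_one, by fun_prop, fun z => ?_, ?_⟩
  · refine (isUnit_one.blockSum ?_).blockSum isUnit_one
    exact isUnit_of_mul_eq_one' (B := (z : ℂ)⁻¹ • 1) (by simp)
  · have := GLHomotopic.conj_blockSum_one (X := X × Circle) (A := fun p => Y p.1)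
      (B := fun p => Y p.1)
      (u := fun p => (1 : Matrix ι ι ℂ) ⊞ₘ (p.2 : ℂ) • (1 : Matrix (Fin M) (Fin M) ℂ)) (by fun_prop)
      (by fun_prop) (fun p => hY p.1) (by fun_prop) fun p => isUnit_one.blockSum
        (isUnit_of_mul_eq_one' (B := (p.2 : ℂ)⁻¹ • 1) (by simp))
    simp only [Matrix.one_mul]
    convert this using 2 with p
    congr 1
    simp [Y, Matrix.fromBlocks_multiply, hVW, hWV, hPV, hWP, Matrix.mul_sub, Matrix.sub_mul, hP,
      add_comm]

theorem StablyTrivial.stablySplit {Q : X → Matrix ι ι ℂ} (hQ : ∀ x, Q x * Q x = Q x)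
    (hQc : Continuous Q) (h : StablyTrivial Q) :
    StablySplit fun p : X × Circle => (p.2 : ℂ) • Q p.1 + (1 - Q p.1) := by
  obtain ⟨N, M, h⟩ := h
  have h1 := (stablySplit_of_mvN (by simp [Matrix.fromBlocks_multiply, hQ]) (by fun_prop) h).mul_right
    (a := fun z => (1 : Matrix ι ι ℂ) ⊞ₘ (z : ℂ)⁻¹ • (1 : Matrix (Fin N) (Fin N) ℂ))
    (continuous_const.matrix_fromBlocks continuous_const continuous_const
      (Continuous.smul (Continuous.inv₀ (by fun_prop) fun z => Circle.coe_ne_zero z)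
        continuous_const))
    fun z => isUnit_one.blockSum (isUnit_of_mul_eq_one' (B := (z : ℂ) • 1) (by simp))
  refine StablySplit.of_blockSum (κ := Fin N) ?_
  convert h1 using 2 with p
  have e : (1 : Matrix (ι ⊕ Fin N) (ι ⊕ Fin N) ℂ) - (Q p.1 ⊞ₘ 1) = ((1 - Q p.1) ⊞ₘ 0) := by
    ext (i | i) (j | j) <;> simp [Matrix.one_apply]
  rw [e, Matrix.fromBlocks_smul, Matrix.fromBlocks_add, Matrix.fromBlocks_multiply]
  simp

theorem stablySplit_of_pencil
    (hX : ∀ (n : ℕ) (Q : X → Matrix (Fin n) (Fin n) ℂ), Continuous Q → (∀ x, Q x * Q x = Q x) →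
      StablyTrivial Q) {a b : X → Matrix ι ι ℂ} (ha : Continuous a) (hb : Continuous b)
    (hu : ∀ x, MatPencilUnit (a x) (b x)) :
    StablySplit fun p : X × Circle => (p.2 : ℂ) • a p.1 + b p.1 := by
  have hh := glHomotopic_pencil ha hb hu
  refine StablySplit.of_homotopic hh.symm ?_
  have hQ := fun x => matPencilProj_mul_self (hu x)
  have hQc := continuous_matPencilProj ha hb hu
  have h1 : ∀ x, IsUnit (a x * matPencilProj (a x) (b x) + b x * (1 - matPencilProj (a x) (b x))) := by
    intro x
    have := hh.isUnit_left (x, 1)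
    simpa using this
  clear hh
  generalize hQd : (fun x => matPencilProj (a x) (b x)) = Q at *
  have hQd' : ∀ x, matPencilProj (a x) (b x) = Q x := fun x => congrFun hQd x
  simp only [hQd'] at *
  refine StablySplit.mul_left (a := fun x => a x * Q x + b x * (1 - Q x)) (by fun_prop) h1
    (StablyTrivial.stablySplit hQ hQc ?_)
  let e := Fintype.equivFin ι
  refine StablyTrivial.of_mvN hQ (MvN.reindex e.symm hQc hQ) (hX _ _ (by fun_prop) fun x => ?_)
  rw [Matrix.submatrix_mul_equiv, hQ]

theorem stablySplit_of_polynomial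
    (hX : ∀ (n : ℕ) (Q : X → Matrix (Fin n) (Fin n) ℂ), Continuous Q → (∀ x, Q x * Q x = Q x) →
      StablyTrivial Q) {m : ℕ} {b : ℕ → X → Matrix ι ι ℂ} (hb : ∀ t, Continuous (b t))
    (hU : ∀ (x : X) (z : Circle),
      IsUnit (∑ t ∈ Finset.range (m + 1), (z : ℂ) ^ t • b t x)) :
    StablySplit fun p : X × Circle => ∑ t ∈ Finset.range (m + 1), (p.2 : ℂ) ^ t • b t p.1 := by
  have hPU : ∀ x, MatPencilUnit (companionShift ι m) (companion m (fun t => b t x) 0) := by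
    intro x z hz
    rw [← companion_eq]
    exact isUnit_companion (hU x ⟨z, by simpa [Submonoid.unitSphere] using hz⟩)
  have hcc : Continuous fun x => companion m (fun t => b t x) 0 := by
    refine continuous_matrix fun i j => ?_
    simp only [companion, Matrix.of_apply]
    split_ifs
    · exact (hb _).matrix_elem _ _
    all_goals fun_prop
  have e2 : (fun p : X × Circle => companion m (fun t => b t p.1) (p.2 : ℂ)) = fun p =>
      (p.2 : ℂ) • companionShift ι m + companion m (fun t => b t p.1) 0 :=
    funext fun p => companion_eq _ _ _
  have h1 := stablySplit_of_pencil hX continuous_const hcc hPU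
  rw [← e2] at h1
  have h2 := StablySplit.of_homotopic (glHomotopic_companion m hb hU) h1
  have h3 := StablySplit.of_reindex (F := fun p : X × Circle =>
    (∑ t ∈ Finset.range (m + 1), (p.2 : ℂ) ^ t • b t p.1) ⊞ₘ (1 : Matrix (Fin m × ι) (Fin m × ι) ℂ))
    (finSuccProdEquiv ι m).symm h2
  exact StablySplit.of_blockSum h3

theorem stablySplit_of_stablyTrivial [CompactSpace X] [T2Space X]
    (hX : ∀ (n : ℕ) (Q : X → Matrix (Fin n) (Fin n) ℂ), Continuous Q → (∀ x, Q x * Q x = Q x) →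
      StablyTrivial Q) (F : X × Circle → Matrix ι ι ℂ) (hF : Continuous F)
    (hF' : ∀ p, IsUnit (F p)) : StablySplit F := by
  obtain ⟨k, b, -, hb, hu, -⟩ := exists_laurentSum_isUnit F hF hF'
  have hz : ∀ z : Circle, (z : ℂ) ^ k ≠ 0 := fun z => pow_ne_zero _ (Circle.coe_ne_zero z)
  have hU : ∀ (x : X) (z : Circle),
      IsUnit (∑ t ∈ Finset.range (2 * k + 1), (z : ℂ) ^ t • b t x) := by
    intro x z
    have := hu (x, z) 1
    simp only [Set.Icc.coe_one, Complex.ofReal_one, sub_self, zero_smul, zero_add, one_smul,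
      laurentSum] at this
    have h2 : IsUnit ((z : ℂ) ^ k • (1 : Matrix ι ι ℂ)) :=
      isUnit_of_mul_eq_one' (B := ((z : ℂ) ^ k)⁻¹ • 1) (by simp [hz])
    have h3 := h2.mul this
    rwa [Matrix.smul_mul, Matrix.one_mul, smul_inv_smul₀ (hz z)] at h3
  have hzc : Continuous fun z : Circle => ((z : ℂ) ^ k)⁻¹ :=
    Continuous.inv₀ (by fun_prop) hz
  have hLc : Continuous fun p : X × Circle => laurentSum k (fun t => b t p.1) (p.2 : ℂ) := by
    unfold laurentSum
    exact (hzc.comp continuous_snd).smul (continuous_finsetSum _ fun t _ =>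
      Continuous.smul ((continuous_subtype_val.comp continuous_snd).pow t)
        ((hb t).comp continuous_fst))
  refine StablySplit.of_homotopic (F' := fun p => laurentSum k (fun t => b t p.1) p.2)
    ⟨fun τ p => (1 - (τ : ℂ)) • F p + (τ : ℂ) • laurentSum k (fun t => b t p.1) p.2, ?_,
      fun τ p => hu p τ, fun p => by simp, fun p => by simp⟩ ?_
  · have h1 : Continuous fun q : I × (X × Circle) => ((q.1 : ℝ) : ℂ) := by fun_prop
    exact ((continuous_const.sub h1).smul (hF.comp continuous_snd)).add
      (h1.smul (hLc.comp continuous_snd))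
  have e : (fun p : X × Circle => laurentSum k (fun t => b t p.1) (p.2 : ℂ)) = fun p =>
      (∑ t ∈ Finset.range (2 * k + 1), (p.2 : ℂ) ^ t • b t p.1) *
        (((p.2 : ℂ) ^ k)⁻¹ • (1 : Matrix ι ι ℂ)) := by
    ext1 p
    rw [laurentSum, Matrix.mul_smul, Matrix.mul_one]
  rw [e]
  exact StablySplit.mul_right (a := fun z => ((z : ℂ) ^ k)⁻¹ • (1 : Matrix ι ι ℂ)) (F := fun p =>
    ∑ t ∈ Finset.range (2 * k + 1), (p.2 : ℂ) ^ t • b t p.1)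
    (hzc.smul continuous_const)
    (fun z => isUnit_of_mul_eq_one' (B := (z : ℂ) ^ k • 1) (by simp [hz]))
    (stablySplit_of_polynomial hX hb hU)

end Stable

/-! ### Complex bundles over spheres -/

section Periodicity

variable {X ι κ : Type} [TopologicalSpace X] [Fintype ι] [DecidableEq ι]
  [Fintype κ] [DecidableEq κ]

theorem StablyConst.of_glHomotopic {u : X → Matrix ι ι ℂ} (h : GLHomotopic u fun _ => 1) :
    StablyConst u := by
  refine ⟨0, ?_⟩
  have := h.blockSum (GLHomotopic.refl (X := X) (u := fun _ => (1 : Matrix (Fin 0) (Fin 0) ℂ))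
    continuous_const fun _ => isUnit_one)
  simpa only [Matrix.fromBlocks_one] using this

theorem finite_Sph_zero : Finite (Sph 0) := by
  refine Finite.of_injective (β := ({1, -1} : Set ℝ)) (fun y => ⟨y.1 0, ?_⟩) ?_
  · have : ∑ i : Fin 1, y.1 i ^ 2 = 1 := Sph_sum_sq y
    rw [Fin.sum_univ_one] at this
    exact mul_self_eq_one_iff.1 (by rw [← sq]; exact this)
  · intro y y' h
    ext i
    rw [Fin.fin_one_eq_zero i]
    exact congrArg Subtype.val h

theorem stablyConst_Sph_zero {u : Sph 0 → Matrix ι ι ℂ} (hu : ∀ y, IsUnit (u y)) :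
    StablyConst u := by
  have := finite_Sph_zero
  choose h h1 h2 h3 h4 using fun y => exists_path_matrix (hu y) isUnit_one
  exact StablyConst.of_glHomotopic ⟨fun t y => h y t, continuous_prod_of_discrete_right.2 h1,
    fun t y => h2 y t, h3, h4⟩

theorem stablyConst_succ_of_stablyTrivial {d : ℕ}
    (hX : ∀ (n : ℕ) (Q : Sph d → Matrix (Fin n) (Fin n) ℂ), Continuous Q →
      (∀ x, Q x * Q x = Q x) → StablyTrivial Q)
    {u : Sph (d + 1) → Matrix ι ι ℂ} (huc : Continuous u) (hu : ∀ y, IsUnit (u y)) :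
    StablyConst u := by
  let x₀ : Sph d := northPole d
  have hsc := continuous_suspMap d
  set a := u (suspMap d (x₀, 0)) with ha
  set b := u (suspMap d (x₀, 1)) with hb
  have hau : IsUnit a := hu _
  have hbu : IsUnit b := hu _
  obtain ⟨c, hcc, hcu, hc0, hc1⟩ := exists_path_matrix (isUnit_one (M := Matrix ι ι ℂ))
    (hbu.matrix_inv.mul hau)
  have hua : ∀ x, u (suspMap d (x, 0)) = a := fun x => by rw [suspMap_zero x x₀]
  have hub : ∀ x, u (suspMap d (x, 1)) = b := fun x => by rw [suspMap_one x x₀]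
  obtain ⟨F, hF, hFv⟩ := exists_descend_circ (T := Sph d)
    (fun x t => u (suspMap d (x, t)) * c t) (by
      have := huc.comp hsc
      exact this.mul (hcc.comp continuous_snd)) fun x => by
      rw [hua, hub, hc0, hc1, Matrix.mul_one, ← Matrix.mul_assoc, hbu.matrix_mul_inv,
        Matrix.one_mul]
  obtain ⟨κ, _, _, g, K, hgc, hg, hKc, hK, h, h1, h2, h3, h4⟩ :=
    stablySplit_of_stablyTrivial hX (fun p : Sph d × Circle => F p.1 p.2) hF fun p => by
      obtain ⟨t, ht⟩ := circ_surjective p.2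
      rw [← ht, hFv]
      exact (hu _).mul (hcu _)
  have hcb : ∀ t, IsUnit (c t ⊞ₘ (1 : Matrix κ κ ℂ)) := fun t => (hcu t).blockSum isUnit_one
  have hcbi : Continuous fun t => (c t ⊞ₘ (1 : Matrix κ κ ℂ))⁻¹ :=
    continuous_matrix_inv (by fun_prop) hcb
  have hcirc := continuous_circ
  have hiv : Continuous fun p : I × Sph d => (h p.1 (p.2, 1))⁻¹ :=
    continuous_matrix_inv (h1.comp (f := fun p : I × Sph d => (p.1, (p.2, (1 : Circle))))
      (by fun_prop)) fun p => h2 _ _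
  let ω : I → Matrix (ι ⊕ κ) (ι ⊕ κ) ℂ := fun t => (K 1)⁻¹ * K (circ t) * (c t ⊞ₘ 1)⁻¹
  have hωc : Continuous ω := by
    refine Continuous.mul (Continuous.mul continuous_const (hKc.comp hcirc)) hcbi
  have hω0 : ω 0 = 1 := by
    simp [ω, circ_zero, hc0, (hK 1).matrix_inv_mul]
  have hωu : ∀ t, IsUnit (ω t) := fun t =>
    ((hK 1).matrix_inv.mul (hK _)).mul (hcb t).matrix_inv
  obtain ⟨w, hwc, hw⟩ := exists_descend_susp (T := I) (d := d) (fun τ _ t => ω (τ * t))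
    (hωc.comp (by fun_prop)) (fun _ _ _ => rfl) fun _ _ _ => rfl
  have e1 : GLHomotopic (w 0) (w 1) := by
    refine ⟨w, hwc, fun τ y => ?_, fun _ => rfl, fun _ => rfl⟩
    obtain ⟨⟨x, s⟩, rfl⟩ := suspMap_surjective d y
    rw [hw]
    exact hωu _
  have e2 : w 0 = fun _ => 1 := by
    ext1 y
    obtain ⟨⟨x, s⟩, rfl⟩ := suspMap_surjective d y
    rw [hw, zero_mul, hω0]
  have e3 : GLHomotopic (fun y => (a⁻¹ * u y) ⊞ₘ (1 : Matrix κ κ ℂ)) (w 1) := by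
    refine glHomotopic_susp (fun s x t => (h s (x, 1))⁻¹ * h s (x, circ t) * (c t ⊞ₘ 1)⁻¹) ?_
      (fun s x t => ((h2 _ _).matrix_inv.mul (h2 _ _)).mul (hcb t).matrix_inv) ?_ ?_ ?_ ?_
    · have c1 : Continuous fun p : I × (Sph d × I) => (h p.1 (p.2.1, 1))⁻¹ :=
        hiv.comp (f := fun p : I × (Sph d × I) => (p.1, p.2.1)) (by fun_prop)
      have c2 : Continuous fun p : I × (Sph d × I) => h p.1 (p.2.1, circ p.2.2) :=
        h1.comp (f := fun p : I × (Sph d × I) => (p.1, (p.2.1, circ p.2.2))) (by fun_prop)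
      have c3 : Continuous fun p : I × (Sph d × I) => (c p.2.2 ⊞ₘ (1 : Matrix κ κ ℂ))⁻¹ :=
        hcbi.comp (f := fun p : I × (Sph d × I) => p.2.2) (by fun_prop)
      exact (c1.mul c2).mul c3
    · intro s x x'
      simp [circ_zero, (h2 _ _).matrix_inv_mul]
    · intro s x x'
      simp [circ_one, (h2 _ _).matrix_inv_mul]
    · intro x t
      have hF1 : F x 1 = a := by rw [← circ_zero, hFv, hua, hc0, Matrix.mul_one]
      simp only [h3, hFv, hF1]
      have e : (a⁻¹ * u (suspMap d (x, t))) ⊞ₘ (1 : Matrix κ κ ℂ) =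
          (a⁻¹ ⊞ₘ 1) * ((u (suspMap d (x, t)) * c t) ⊞ₘ 1) * ((c t)⁻¹ ⊞ₘ 1) := by
        simp [Matrix.fromBlocks_multiply, Matrix.mul_assoc, (hcu t).matrix_mul_inv]
      rw [e]
      congr 1
      · congr 1
        exact Matrix.inv_eq_left_inv (by
          simp [Matrix.fromBlocks_multiply, hau.matrix_inv_mul])
      · exact Matrix.inv_eq_left_inv (by
          simp [Matrix.fromBlocks_multiply, (hcu t).matrix_inv_mul])
    · intro x t
      rw [hw, one_mul, h4, h4, Matrix.mul_inv_rev]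
      simp only [ω]
      rw [Matrix.mul_assoc (K 1)⁻¹, ← Matrix.mul_assoc (g x)⁻¹, (hg x).matrix_inv_mul,
        Matrix.one_mul]
  have hau1 : IsUnit (a ⊞ₘ (1 : Matrix κ κ ℂ)) := hau.blockSum isUnit_one
  refine StablyConst.of_blockSum hau1 ?_
  have e4 := (GLHomotopic.refl (X := Sph (d + 1)) (u := fun _ => a ⊞ₘ (1 : Matrix κ κ ℂ))
    continuous_const fun _ => hau1).mul (e3.trans (e2 ▸ e1.symm))
  simpa [Matrix.fromBlocks_multiply, ← Matrix.mul_assoc, hau.matrix_mul_inv] using e4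

theorem stablyTrivial_succ_of_stablyConst {d : ℕ}
    (hX : ∀ (n : ℕ) (u : Sph d → Matrix (Fin n) (Fin n) ℂ), Continuous u →
      (∀ x, IsUnit (u x)) → StablyConst u)
    {p : Sph (d + 1) → Matrix ι ι ℂ} (hpc : Continuous p) (hp : ∀ y, p y * p y = p y) :
    StablyTrivial p := by
  let x₀ : Sph d := northPole d
  have hsc := continuous_suspMap d
  obtain ⟨A, hAc, hAu, hA, hA0⟩ := exists_trivialization_of_homotopy
    (fun x t => p (suspMap d (x, t))) (hpc.comp hsc) (fun x t => hp _)
    (p (suspMap d (x₀, 0))) fun x => by rw [suspMap_zero x x₀]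
  set P := p (suspMap d (x₀, 0)) with hP
  have hAic : Continuous fun q : Sph d × I => (A q.1 q.2)⁻¹ :=
    continuous_matrix_inv hAc fun q => hAu _ _
  obtain ⟨r, V₀, W₀, hVW, hWV⟩ := exists_rank_factorization P (hp _)
  set C := A x₀ 1 with hC
  have hCu : IsUnit C := hAu _ _
  have hPA : ∀ x, A x 1 * P = p (suspMap d (x₀, 1)) * A x 1 := fun x => by
    rw [← hA, suspMap_one x x₀]
  have hcomm : ∀ x, (C⁻¹ * A x 1) * P = P * (C⁻¹ * A x 1) := by
    intro x
    have h1 : p (suspMap d (x₀, 1)) * C = C * P := (hPA x₀).symm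
    rw [Matrix.mul_assoc, hPA, ← Matrix.mul_assoc, ← Matrix.mul_assoc]
    congr 1
    calc C⁻¹ * p (suspMap d (x₀, 1)) = C⁻¹ * (p (suspMap d (x₀, 1)) * C) * C⁻¹ := by
          rw [Matrix.mul_assoc, Matrix.mul_assoc, hCu.matrix_mul_inv, Matrix.mul_one]
      _ = P * C⁻¹ := by
          rw [h1, ← Matrix.mul_assoc, hCu.matrix_inv_mul, Matrix.one_mul]
  have hPV : P * V₀ = V₀ := by rw [← hVW, Matrix.mul_assoc, hWV, Matrix.mul_one]
  have hWP : W₀ * P = W₀ := by rw [← hVW, ← Matrix.mul_assoc, hWV, Matrix.one_mul]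
  let v : Sph d → Matrix (Fin r) (Fin r) ℂ := fun x => W₀ * (C⁻¹ * A x 1) * V₀
  have hVv : ∀ x, V₀ * v x = (C⁻¹ * A x 1) * V₀ := by
    intro x
    simp only [v]
    rw [← Matrix.mul_assoc, ← Matrix.mul_assoc, hVW, ← hcomm, Matrix.mul_assoc, hPV]
  have hvW : ∀ x, v x * W₀ = W₀ * (C⁻¹ * A x 1) := by
    intro x
    simp only [v]
    rw [Matrix.mul_assoc _ V₀, hVW, Matrix.mul_assoc, hcomm, ← Matrix.mul_assoc, hWP]
  have hvu : ∀ x, IsUnit (v x) := by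
    intro x
    refine isUnit_of_mul_eq_one' (B := W₀ * ((A x 1)⁻¹ * C) * V₀) ?_
    rw [← Matrix.mul_assoc, ← Matrix.mul_assoc (v x), hvW, Matrix.mul_assoc W₀,
      Matrix.mul_assoc C⁻¹, ← Matrix.mul_assoc (A x 1), (hAu x 1).matrix_mul_inv, Matrix.one_mul,
      hCu.matrix_inv_mul, Matrix.mul_one, hWV]
  have hvc : Continuous v := by
    have : Continuous fun x => A x 1 := hAc.comp (f := fun x => (x, (1 : I))) (by fun_prop)
    fun_prop
  obtain ⟨N, h⟩ := hX r v hvc hvu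
  obtain ⟨h, h1, h2, h3, h4⟩ := h.symm
  have hhi : Continuous fun q : I × Sph d => (h q.1 q.2)⁻¹ :=
    continuous_matrix_inv h1 fun q => h2 _ _
  have hVC : ∀ x, A x 1 * V₀ = C * V₀ * v x := by
    intro x
    rw [Matrix.mul_assoc, hVv, ← Matrix.mul_assoc, ← Matrix.mul_assoc, hCu.matrix_mul_inv,
      Matrix.one_mul]
  have hWC : ∀ x, v x * (W₀ * (A x 1)⁻¹) = W₀ * C⁻¹ := by
    intro x
    rw [← Matrix.mul_assoc, hvW, Matrix.mul_assoc, Matrix.mul_assoc, (hAu x 1).matrix_mul_inv,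
      Matrix.mul_one]
  have hV1 : ∀ x, ((A x 1 * V₀ : Matrix ι (Fin r) ℂ) ⊞ₘ (1 : Matrix (Fin N) (Fin N) ℂ)) *
      (h 1 x)⁻¹ = ((C * V₀ : Matrix ι (Fin r) ℂ) ⊞ₘ (1 : Matrix (Fin N) (Fin N) ℂ)) := by
    intro x
    have e : ((A x 1 * V₀ : Matrix ι (Fin r) ℂ) ⊞ₘ (1 : Matrix (Fin N) (Fin N) ℂ)) =
        ((C * V₀ : Matrix ι (Fin r) ℂ) ⊞ₘ (1 : Matrix (Fin N) (Fin N) ℂ)) * h 1 x := by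
      simp [h4, Matrix.fromBlocks_multiply, hVC]
    rw [e, Matrix.mul_assoc, (h2 _ _).matrix_mul_inv, Matrix.mul_one]
  have hW1 : ∀ x, h 1 x * ((W₀ * (A x 1)⁻¹ : Matrix (Fin r) ι ℂ) ⊞ₘ
      (1 : Matrix (Fin N) (Fin N) ℂ)) =
      ((W₀ * C⁻¹ : Matrix (Fin r) ι ℂ) ⊞ₘ (1 : Matrix (Fin N) (Fin N) ℂ)) := by
    intro x
    simp [h4, Matrix.fromBlocks_multiply, hWC]
  obtain ⟨V, hVc, hV⟩ := exists_descend_susp (T := Unit) (d := d)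
    (fun _ x t => ((A x t * V₀ : Matrix ι (Fin r) ℂ) ⊞ₘ (1 : Matrix (Fin N) (Fin N) ℂ)) * (h t x)⁻¹) (by
      have e1 : Continuous fun q : Unit × (Sph d × I) => A q.2.1 q.2.2 := hAc.comp (by fun_prop)
      have e2 : Continuous fun q : Unit × (Sph d × I) => (h q.2.2 q.2.1)⁻¹ :=
        hhi.comp (f := fun q : Unit × (Sph d × I) => (q.2.2, q.2.1)) (by fun_prop)
      fun_prop) (fun _ x x' => by simp [hA0, h3]) fun _ x x' => by rw [hV1, hV1]
  obtain ⟨W, hWc, hW⟩ := exists_descend_susp (T := Unit) (d := d)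
    (fun _ x t => h t x * ((W₀ * (A x t)⁻¹ : Matrix (Fin r) ι ℂ) ⊞ₘ (1 : Matrix (Fin N) (Fin N) ℂ))) (by
      have e1 : Continuous fun q : Unit × (Sph d × I) => (A q.2.1 q.2.2)⁻¹ :=
        hAic.comp (by fun_prop)
      have e2 : Continuous fun q : Unit × (Sph d × I) => h q.2.2 q.2.1 :=
        h1.comp (f := fun q : Unit × (Sph d × I) => (q.2.2, q.2.1)) (by fun_prop)
      fun_prop) (fun _ x x' => by simp [hA0, h3]) fun _ x x' => by rw [hW1, hW1]
  refine stablyTrivial_of_const hp (1 : Matrix (Fin N) (Fin N) ℂ) (one_mul _)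
    (1 : Matrix (Fin r ⊕ Fin N) (Fin r ⊕ Fin N) ℂ) (one_mul _)
    ⟨V (), W (), hVc.comp (f := fun y => ((), y)) (by fun_prop),
      hWc.comp (f := fun y => ((), y)) (by fun_prop), fun y => ?_, fun y => ?_⟩ <;>
  obtain ⟨⟨x, t⟩, rfl⟩ := suspMap_surjective d y <;> rw [hV, hW]
  · rw [Matrix.mul_assoc, ← Matrix.mul_assoc _ (h t x), (h2 _ _).matrix_inv_mul, Matrix.one_mul,
      Matrix.fromBlocks_multiply]
    simp only [Matrix.mul_zero, Matrix.zero_mul, add_zero, zero_add, Matrix.mul_one]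
    congr 1
    rw [Matrix.mul_assoc, ← Matrix.mul_assoc V₀, hVW, ← Matrix.mul_assoc, ← hA, Matrix.mul_assoc,
      (hAu _ _).matrix_mul_inv, Matrix.mul_one]
  · rw [Matrix.mul_assoc, ← Matrix.mul_assoc _ _ (h t x)⁻¹, Matrix.fromBlocks_multiply]
    simp only [Matrix.mul_zero, Matrix.zero_mul, add_zero, zero_add, Matrix.mul_one]
    rw [Matrix.mul_assoc, ← Matrix.mul_assoc (A x t)⁻¹, (hAu _ _).matrix_inv_mul, Matrix.one_mul,
      hWV, Matrix.fromBlocks_one, Matrix.one_mul, (h2 _ _).matrix_mul_inv]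

/-- Families of invertible matrices over even spheres are stably homotopic to constants, and
families of idempotents over odd spheres are stably trivial. -/
theorem stablyConst_and_stablyTrivial (m : ℕ) :
    (∀ (n : ℕ) (u : Sph (2 * m) → Matrix (Fin n) (Fin n) ℂ), Continuous u →
      (∀ x, IsUnit (u x)) → StablyConst u) ∧
    ∀ (n : ℕ) (Q : Sph (2 * m + 1) → Matrix (Fin n) (Fin n) ℂ), Continuous Q →
      (∀ x, Q x * Q x = Q x) → StablyTrivial Q := by
  induction m with
  | zero =>
    have h : ∀ (n : ℕ) (u : Sph 0 → Matrix (Fin n) (Fin n) ℂ), Continuous u →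
      (∀ x, IsUnit (u x)) → StablyConst u := fun n u _ hu => stablyConst_Sph_zero hu
    exact ⟨h, fun n Q hQc hQ => stablyTrivial_succ_of_stablyConst h hQc hQ⟩
  | succ m ih =>
    have h : ∀ (n : ℕ) (u : Sph (2 * (m + 1)) → Matrix (Fin n) (Fin n) ℂ), Continuous u →
      (∀ x, IsUnit (u x)) → StablyConst u :=
      fun n u huc hu => stablyConst_succ_of_stablyTrivial ih.2 huc hu
    exact ⟨h, fun n Q hQc hQ => stablyTrivial_succ_of_stablyConst h hQc hQ⟩

theorem stablyTrivial_Sph_odd {m : ℕ} {p : Sph (2 * m + 1) → Matrix ι ι ℂ} (hpc : Continuous p)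
    (hp : ∀ y, p y * p y = p y) : StablyTrivial p :=
  stablyTrivial_succ_of_stablyConst (stablyConst_and_stablyTrivial m).1 hpc hp

end Periodicity

/-! ### Moving a section of low dimension to a constant vector -/

section Frame

variable {𝕜 : Type} [RCLike 𝕜] {X ι : Type} [TopologicalSpace X] [Fintype ι] [DecidableEq ι]

/-- The unitary reflection along `v - w`, which maps the unit vector `v` to the unit vector `w`. -/
noncomputable def reflMatrix (v w : ι → 𝕜) : Matrix ι ι 𝕜 :=
  1 - (1 - star w ⬝ᵥ v)⁻¹ • vecMulVec (v - w) (star (v - w))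

open scoped ComplexOrder in
theorem one_sub_dotProduct_ne_zero {v w : ι → 𝕜} (hv : star v ⬝ᵥ v = 1) (hw : star w ⬝ᵥ w = 1)
    (h : v ≠ w) : 1 - star w ⬝ᵥ v ≠ 0 := by
  intro h0
  have h1 : star w ⬝ᵥ v = 1 := (sub_eq_zero.1 h0).symm
  have h2 : star v ⬝ᵥ w = 1 := by rw [star_dotProduct, h1, star_one]
  have h3 : star (v - w) ⬝ᵥ (v - w) = 0 := by
    simp [star_sub, sub_dotProduct, dotProduct_sub, hv, hw, h1, h2]
  exact h (sub_eq_zero.1 (dotProduct_star_self_eq_zero.1 h3))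

theorem reflMatrix_mulVec {v w : ι → 𝕜} (hv : star v ⬝ᵥ v = 1) (hw : star w ⬝ᵥ w = 1)
    (h : v ≠ w) : reflMatrix v w *ᵥ v = w := by
  have hc := one_sub_dotProduct_ne_zero hv hw h
  have e : star (v - w) ⬝ᵥ v = 1 - star w ⬝ᵥ v := by rw [star_sub, sub_dotProduct, hv]
  rw [reflMatrix, sub_mulVec, one_mulVec, smul_mulVec, vecMulVec_mulVec, e]
  ext i
  simp [mul_comm _ (1 - star w ⬝ᵥ v), inv_mul_cancel_left₀ hc]

theorem reflMatrix_unitary {v w : ι → 𝕜} (hv : star v ⬝ᵥ v = 1) (hw : star w ⬝ᵥ w = 1)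
    (h : v ≠ w) : (reflMatrix v w)ᴴ * reflMatrix v w = 1 := by
  have hc := one_sub_dotProduct_ne_zero hv hw h
  set c := 1 - star w ⬝ᵥ v with hcd
  have hc' : star c = 1 - star v ⬝ᵥ w := by
    rw [hcd, star_sub, star_one, ← star_dotProduct]
  have hcs : star c ≠ 0 := star_ne_zero.2 hc
  set z := v - w with hz
  have e : star z ⬝ᵥ z = c + star c := by
    rw [hc', hcd, hz]
    simp only [star_sub, sub_dotProduct, dotProduct_sub, hv, hw]
    ring
  have e2 : (reflMatrix v w)ᴴ = 1 - (star c)⁻¹ • vecMulVec z (star z) := by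
    rw [reflMatrix, conjTranspose_sub, conjTranspose_one, conjTranspose_smul, ← hcd, ← hz,
      conjTranspose_vecMulVec, star_star, star_inv₀]
  rw [e2, reflMatrix, ← hcd, ← hz]
  have e3 : vecMulVec z (star z) * vecMulVec z (star z) = (c + star c) • vecMulVec z (star z) := by
    rw [vecMulVec_mul_vecMulVec, e]
    ext i j
    simp [vecMulVec_apply]
    ring
  rw [Matrix.sub_mul, Matrix.mul_sub, Matrix.one_mul, Matrix.mul_sub, Matrix.mul_one,
    Matrix.one_mul, Matrix.smul_mul, Matrix.mul_smul, e3, smul_smul, smul_smul, sub_sub,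
    ← sub_eq_zero]
  have : (star c)⁻¹ * c⁻¹ * (c + star c) = c⁻¹ + (star c)⁻¹ := by
    field_simp
    ring
  rw [this, add_smul]
  abel

theorem continuous_reflMatrix {v w : X → ι → 𝕜} (hv : Continuous v) (hw : Continuous w)
    (hv1 : ∀ x, star (v x) ⬝ᵥ v x = 1) (hw1 : ∀ x, star (w x) ⬝ᵥ w x = 1)
    (h : ∀ x, v x ≠ w x) : Continuous fun x => reflMatrix (v x) (w x) := by
  have h1 : Continuous fun x => (1 - star (w x) ⬝ᵥ v x)⁻¹ :=
    (continuous_const.sub (hw.star.dotProduct hv)).inv₀ fun x =>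
      one_sub_dotProduct_ne_zero (hv1 x) (hw1 x) (h x)
  exact continuous_const.sub (h1.smul ((hv.sub hw).matrix_vecMulVec (hv.sub hw).star))

theorem exists_unitary_mulVec_eq {v w : ι → 𝕜} (hv : star v ⬝ᵥ v = 1) (hw : star w ⬝ᵥ w = 1) :
    ∃ U : Matrix ι ι 𝕜, Uᴴ * U = 1 ∧ U *ᵥ v = w := by
  by_cases h : v = w
  · exact ⟨1, by simp, by simp [h]⟩
  · exact ⟨_, reflMatrix_unitary hv hw h, reflMatrix_mulVec hv hw h⟩

theorem dotProduct_star_self_eq_norm (v : EuclideanSpace 𝕜 ι) :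
    star v.ofLp ⬝ᵥ v.ofLp = ((‖v‖ ^ 2 : ℝ) : 𝕜) := by
  rw [EuclideanSpace.norm_sq_eq, dotProduct]
  push_cast
  exact Finset.sum_congr rfl fun i _ => by
    rw [Pi.star_apply, RCLike.star_def, RCLike.conj_mul]

/-- A continuous family of unit vectors over a sphere of low dimension can be moved to a constant
vector by a continuous family of unitary matrices. -/
theorem exists_unitary_frame {d : ℕ} {s : Sph d → ι → 𝕜} (hs : Continuous s)
    (hs1 : ∀ y, star (s y) ⬝ᵥ s y = 1) (hd : d + 2 < Module.finrank ℝ (EuclideanSpace 𝕜 ι))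
    {e : ι → 𝕜} (he : star e ⬝ᵥ e = 1) :
    ∃ U : Sph d → Matrix ι ι 𝕜, Continuous U ∧ (∀ y, (U y)ᴴ * U y = 1) ∧
      ∀ y, U y *ᵥ s y = e := by
  let V := EuclideanSpace ℝ (Fin (d + 1))
  let sc : C(Sph d, EuclideanSpace 𝕜 ι) := ⟨fun y => WithLp.toLp 2 (s y), by fun_prop⟩
  obtain ⟨S, hS⟩ := ContinuousMap.exists_restrict_eq (s := Sph d) Metric.isClosed_sphere sc
  obtain ⟨F, hF, hFS, -⟩ := S.continuous.exists_contDiff_approx (F := EuclideanSpace 𝕜 ι) 1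
    (ε := fun _ => 1) continuous_const fun _ => one_pos
  have hn : ∀ y, ‖sc y‖ = 1 := by
    intro y
    have h := dotProduct_star_self_eq_norm (sc y)
    have h2 : ((‖sc y‖ ^ 2 : ℝ) : 𝕜) = ((1 : ℝ) : 𝕜) := by
      rw [← h, RCLike.ofReal_one]; exact hs1 y
    have h3 : ‖sc y‖ ^ 2 = 1 := by exact_mod_cast h2
    exact (pow_eq_one_iff_of_nonneg (norm_nonneg _) two_ne_zero).1 h3
  have hFs : ∀ y : Sph d, ‖F y - sc y‖ < 1 := by
    intro y
    have := hFS y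
    rwa [dist_eq_norm, show S y = sc y from DFunLike.congr_fun hS y] at this
  have hF0 : ∀ y : Sph d, F y ≠ 0 := by
    intro y h
    have := hFs y
    rw [h, zero_sub, norm_neg, hn] at this
    exact lt_irrefl _ this
  have hFne : ∀ y : Sph d, ‖F y‖ ≠ 0 := fun y => norm_ne_zero_iff.2 (hF0 y)
  obtain ⟨c₀, hc₀⟩ : ∃ c, c ∈ (Set.range fun q : ℝ × V => q.1 • F q.2)ᶜ := by
    refine (ContDiff.dense_compl_range_of_finrank_lt_finrank
      (contDiff_fst.smul (hF.comp contDiff_snd)) ?_).nonempty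
    have : Module.finrank ℝ (ℝ × V) = d + 2 := by simp [V]; ring
    exact this.trans_lt hd
  have hc0 : c₀ ≠ 0 := by
    rintro rfl
    exact hc₀ ⟨(0, 0), by simp⟩
  have unit : ∀ v : EuclideanSpace 𝕜 ι, v ≠ 0 →
      star (((‖v‖⁻¹ : ℝ) • v).ofLp) ⬝ᵥ ((‖v‖⁻¹ : ℝ) • v).ofLp = 1 := by
    intro v hv
    rw [dotProduct_star_self_eq_norm, norm_smul, norm_inv, norm_norm,
      inv_mul_cancel₀ (norm_ne_zero_iff.2 hv)]
    simp
  let w : Sph d → ι → 𝕜 := fun y => -((‖F y‖⁻¹ : ℝ) • F y).ofLp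
  let c : ι → 𝕜 := -((‖c₀‖⁻¹ : ℝ) • c₀).ofLp
  have hw1 : ∀ y, star (w y) ⬝ᵥ w y = 1 := fun y => by
    simp only [w, star_neg, neg_dotProduct_neg]
    exact unit _ (hF0 y)
  have hc1 : star c ⬝ᵥ c = 1 := by
    simp only [c, star_neg, neg_dotProduct_neg]
    exact unit _ hc0
  have hFc : Continuous fun y : Sph d => F y := hF.continuous.comp continuous_subtype_val
  have hwc : Continuous w := by
    have h1 : Continuous fun y : Sph d => ‖F y‖⁻¹ := hFc.norm.inv₀ hFne
    have h2 : Continuous fun y : Sph d => ‖F y‖⁻¹ • F y := h1.smul hFc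
    exact ((PiLp.continuous_ofLp 2 _).comp h2).neg
  have hsw : ∀ y, s y ≠ w y := by
    intro y h
    have h1 : sc y = -((‖F y‖⁻¹ : ℝ) • F y) := by
      apply (WithLp.ofLp_injective 2)
      exact h
    have h2 : F y = -(‖F y‖ • sc y) := by
      rw [h1, smul_neg, neg_neg, smul_smul, mul_inv_cancel₀ (hFne y), one_smul]
    have h3 := hFs y
    have h4 : F y - sc y = -((‖F y‖ + 1) • sc y) := by
      rw [add_smul, one_smul, neg_add, ← h2, sub_eq_add_neg]
    rw [h4, norm_neg, norm_smul, hn, mul_one, Real.norm_of_nonneg (by positivity)] at h3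
    linarith [norm_nonneg (F y)]
  have hwc' : ∀ y, w y ≠ c := by
    intro y h
    have h1 : (‖F y‖⁻¹ : ℝ) • F y = (‖c₀‖⁻¹ : ℝ) • c₀ := by
      apply (WithLp.ofLp_injective 2)
      exact neg_injective h
    refine hc₀ ⟨(‖c₀‖ * ‖F y‖⁻¹, (y : V)), ?_⟩
    change (‖c₀‖ * ‖F y‖⁻¹) • F y = c₀
    rw [mul_smul, h1, smul_smul, mul_inv_cancel₀ (norm_ne_zero_iff.2 hc0), one_smul]
  obtain ⟨U₀, hU₀, hU₀c⟩ := exists_unitary_mulVec_eq hc1 he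
  have r1 := continuous_reflMatrix hs hwc hs1 hw1 hsw
  have r2 := continuous_reflMatrix hwc (continuous_const (y := c)) hw1 (fun _ => hc1) hwc'
  refine ⟨fun y => U₀ * (reflMatrix (w y) c * reflMatrix (s y) (w y)), by fun_prop, fun y => ?_,
    fun y => ?_⟩
  · have e1 := reflMatrix_unitary (hs1 y) (hw1 y) (hsw y)
    have e2 := reflMatrix_unitary (hw1 y) hc1 (hwc' y)
    simp only [conjTranspose_mul]
    rw [Matrix.mul_assoc, ← Matrix.mul_assoc U₀ᴴ, hU₀, Matrix.one_mul, Matrix.mul_assoc,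
      ← Matrix.mul_assoc _ (reflMatrix (w y) c), e2, Matrix.one_mul, e1]
  · rw [← mulVec_mulVec, ← mulVec_mulVec, reflMatrix_mulVec (hs1 y) (hw1 y) (hsw y),
      reflMatrix_mulVec (hw1 y) hc1 (hwc' y), hU₀c]

end Frame

/-! ### Destabilization -/

section Destabilize

variable {X ι κ μ ν : Type} [TopologicalSpace X] [Fintype ι] [DecidableEq ι]
  [Fintype κ] [DecidableEq κ] [Fintype μ] [DecidableEq μ] [Fintype ν] [DecidableEq ν]

theorem MvN.submatrix {p : X → Matrix ι ι ℂ} {q : X → Matrix κ κ ℂ} (h : MvN p q) (e : μ ≃ ι)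
    (f : ν ≃ κ) : MvN (fun x => (p x).submatrix e e) fun x => (q x).submatrix f f := by
  obtain ⟨V, W, hV, hW, h1, h2⟩ := h
  refine ⟨fun x => (V x).submatrix e f, fun x => (W x).submatrix f e, by fun_prop, by fun_prop,
    fun x => ?_, fun x => ?_⟩
  · rw [Matrix.submatrix_mul_equiv, h1]
  · rw [Matrix.submatrix_mul_equiv, h2]

theorem MvN.of_blockSum_unit {d : ℕ} {p : Sph d → Matrix ι ι ℂ}
    (h : MvN (fun y => p y ⊞ₘ (1 : Matrix Unit Unit ℂ)) fun _ => (1 : Matrix (μ ⊕ Unit) (μ ⊕ Unit) ℂ))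
    (hd : d + 2 < 2 * (Fintype.card μ + 1)) : MvN p fun _ => (1 : Matrix μ μ ℂ) := by
  obtain ⟨V, W, hVc, hWc, hVW, hWV⟩ := h
  let s : Sph d → μ ⊕ Unit → ℂ := fun y k => W y k (Sum.inr ())
  have hVs : ∀ y, V y *ᵥ s y = Pi.single (Sum.inr ()) 1 := by
    intro y
    ext i
    have := congrFun (congrFun (hVW y) i) (Sum.inr ())
    rw [Matrix.mul_apply] at this
    rw [mulVec, dotProduct, this]
    rcases i with i | i <;> simp
  let S : Sph d → EuclideanSpace ℂ (μ ⊕ Unit) := fun y => WithLp.toLp 2 (s y)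
  have hsc : Continuous s := continuous_pi fun k => hWc.matrix_elem _ _
  have hSc : Continuous S := by fun_prop
  have hS0 : ∀ y, S y ≠ 0 := by
    intro y h
    have h1 : s y = 0 := congrArg WithLp.ofLp h
    have h2 := congrFun (hVs y) (Sum.inr ())
    rw [h1, mulVec_zero] at h2
    simp at h2
  have hSn : ∀ y, ‖S y‖ ≠ 0 := fun y => norm_ne_zero_iff.2 (hS0 y)
  have hSnc : ∀ y, (‖S y‖ : ℂ) ≠ 0 := fun y => Complex.ofReal_ne_zero.2 (hSn y)
  obtain ⟨U, hUc, hU, hUs⟩ := exists_unitary_frame (s := fun y => (‖S y‖ : ℂ)⁻¹ • s y)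
    (by
      have : Continuous fun y => (‖S y‖ : ℂ)⁻¹ :=
        (Complex.continuous_ofReal.comp hSc.norm).inv₀ hSnc
      exact this.smul hsc)
    (fun y => by
      have h1 := dotProduct_star_self_eq_norm (S y)
      change star (s y) ⬝ᵥ s y = _ at h1
      rw [star_smul, smul_dotProduct, dotProduct_smul, h1]
      simp only [RCLike.star_def, map_inv₀, Complex.conj_ofReal, smul_eq_mul]
      have := hSnc y
      push_cast
      field_simp
      rfl)
    (by
      rw [finrank_real_of_complex]
      simpa using hd)
    (e := Pi.single (Sum.inr ()) 1) (by simp)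
  have hU' : ∀ y, U y * (U y)ᴴ = 1 := fun y => mul_eq_one_comm.1 (hU y)
  have hUs' : ∀ y, U y *ᵥ s y = (‖S y‖ : ℂ) • Pi.single (Sum.inr ()) 1 := by
    intro y
    rw [← hUs, mulVec_smul, smul_smul, mul_inv_cancel₀ (hSnc y), one_smul]
  let V' : Sph d → Matrix (ι ⊕ Unit) (μ ⊕ Unit) ℂ := fun y => V y * (U y)ᴴ
  let W' : Sph d → Matrix (μ ⊕ Unit) (ι ⊕ Unit) ℂ := fun y => U y * W y
  have e1 : ∀ y, V' y * W' y = p y ⊞ₘ 1 := by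
    intro y
    rw [Matrix.mul_assoc, ← Matrix.mul_assoc _ (U y), hU, Matrix.one_mul, hVW]
  have e2 : ∀ y, W' y * V' y = 1 := by
    intro y
    rw [Matrix.mul_assoc, ← Matrix.mul_assoc (W y), hWV, Matrix.one_mul, hU']
  have e3 : ∀ y i, W' y (Sum.inl i) (Sum.inr ()) = 0 := by
    intro y i
    have : W' y (Sum.inl i) (Sum.inr ()) = (U y *ᵥ s y) (Sum.inl i) := rfl
    simp [this, hUs']
  have e4 : ∀ y i, V' y (Sum.inl i) (Sum.inr ()) = 0 := by
    intro y i
    have h1 : V' y *ᵥ (U y *ᵥ s y) = Pi.single (Sum.inr ()) 1 := by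
      rw [← hVs, mulVec_mulVec, Matrix.mul_assoc, hU, Matrix.mul_one]
    rw [hUs', mulVec_smul] at h1
    have := congrFun h1 (Sum.inl i)
    simpa [hSn] using this
  refine ⟨fun y => (V' y).toBlocks₁₁, fun y => (W' y).toBlocks₁₁, ?_, ?_, fun y => ?_, fun y => ?_⟩
  · have : Continuous V' := by fun_prop
    exact continuous_matrix fun i j => this.matrix_elem _ _
  · have : Continuous W' := by fun_prop
    exact continuous_matrix fun i j => this.matrix_elem _ _
  · ext i j
    have := congrFun (congrFun (e1 y) (Sum.inl i)) (Sum.inl j)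
    rw [Matrix.mul_apply] at this
    simp only [Fintype.sum_sum_type, Finset.univ_unique, Finset.sum_singleton] at this
    rw [e4 y i, zero_mul, add_zero] at this
    rw [Matrix.mul_apply]
    exact this
  · ext i j
    have := congrFun (congrFun (e2 y) (Sum.inl i)) (Sum.inl j)
    rw [Matrix.mul_apply] at this
    simp only [Fintype.sum_sum_type, Finset.univ_unique, Finset.sum_singleton] at this
    rw [e3 y i, zero_mul, add_zero] at this
    rw [Matrix.mul_apply]
    refine Eq.trans this ?_
    simp [Matrix.one_apply]

theorem MvN.of_blockSum_fin {d R : ℕ} (hd : d + 2 < 2 * (R + 1)) (N : ℕ) {p : Sph d → Matrix ι ι ℂ}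
    (h : MvN (fun y => p y ⊞ₘ (1 : Matrix (Fin N) (Fin N) ℂ))
      fun _ => (1 : Matrix (Fin R ⊕ Fin N) (Fin R ⊕ Fin N) ℂ)) :
    MvN p fun _ => (1 : Matrix (Fin R) (Fin R) ℂ) := by
  induction N with
  | zero =>
    have := h.submatrix (Equiv.sumEmpty ι (Fin 0)).symm (Equiv.sumEmpty (Fin R) (Fin 0)).symm
    simp only [Matrix.submatrix_one_equiv] at this
    convert this using 2 with y
    ext i j
    simp
  | succ N ih =>
    apply ih
    let f : Fin N ⊕ Unit ≃ Fin (N + 1) :=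
      (finSuccEquivLast.trans (Equiv.optionEquivSumPUnit.{0} (Fin N))).symm
    have h1 := h.submatrix ((Equiv.sumAssoc ι (Fin N) Unit).trans ((Equiv.refl ι).sumCongr f))
      ((Equiv.sumAssoc (Fin R) (Fin N) Unit).trans ((Equiv.refl (Fin R)).sumCongr f))
    simp only [Matrix.submatrix_one_equiv] at h1
    refine MvN.of_blockSum_unit ?_ (by simp; omega)
    convert h1 using 2 with y
    ext ((i | i) | i) ((j | j) | j) <;> simp [Matrix.one_apply]

/-- Families of idempotents of rank `R` over a sphere of odd dimension `2 m + 1 < 2 R` are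
trivial. -/
theorem mvN_one_of_trace_eq {m R : ℕ} (hd : 2 * m + 1 < 2 * R) {p : Sph (2 * m + 1) → Matrix ι ι ℂ}
    (hpc : Continuous p) (hp : ∀ y, p y * p y = p y) (hR : ∀ y, (p y).trace = R) :
    MvN p fun _ => (1 : Matrix (Fin R) (Fin R) ℂ) := by
  obtain ⟨N, M, h⟩ := stablyTrivial_Sph_odd hpc hp
  have hM : M = R + N := by
    obtain ⟨V, W, -, -, h1, h2⟩ := h
    let y := northPole (2 * m + 1)
    have e1 := congrArg Matrix.trace (h1 y)
    have e2 := congrArg Matrix.trace (h2 y)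
    have e3 : (p y ⊞ₘ (1 : Matrix (Fin N) (Fin N) ℂ)).trace = R + N := by
      rw [← hR y]
      simp [Matrix.trace]
    simp only [e3] at e1
    rw [Matrix.trace_mul_comm, e2, Matrix.trace_one, Fintype.card_fin] at e1
    exact_mod_cast e1
  subst hM
  refine MvN.of_blockSum_fin (by omega) N ?_
  have := h.submatrix (Equiv.refl _) (finSumFinEquiv (m := R) (n := N))
  simpa using this

end Destabilize

/-! ### Orthogonal complex structures and their eigenspace projections -/

section SqrtMatrix

variable {X ι κ : Type} [TopologicalSpace X] [Fintype ι] [DecidableEq ι] [Fintype κ] [DecidableEq κ]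

open scoped Matrix.Norms.L2Operator MatrixOrder ComplexOrder in
theorem exists_continuous_matrix_sqrt {S : X → Matrix ι ι ℂ} (hS : Continuous S)
    (hp : ∀ x, (S x).PosSemidef) :
    ∃ R : X → Matrix ι ι ℂ, Continuous R ∧ (∀ x, R x * R x = S x) ∧ ∀ x, (R x)ᴴ = R x := by
  have h0 : ∀ x, 0 ≤ S x := fun x => (hp x).nonneg
  refine ⟨fun x => CFC.sqrt (S x), ?_, fun x => CFC.sqrt_mul_sqrt_self _ (h0 x), fun x => ?_⟩
  · exact CFC.continuousOn_sqrt.comp_continuous hS h0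
  · exact (CFC.sqrt_nonneg (S x)).isSelfAdjoint

open scoped ComplexOrder in
/-- A continuous family of injective matrices can be orthonormalised. -/
theorem exists_continuous_orthonormalization {V : X → Matrix κ ι ℂ} {W : X → Matrix ι κ ℂ}
    (hV : Continuous V) (hWV : ∀ x, W x * V x = 1) :
    ∃ R : X → Matrix ι ι ℂ, Continuous R ∧ ∀ x, (V x * R x)ᴴ * (V x * R x) = 1 := by
  obtain ⟨R, hR, hRR, hRh⟩ := exists_continuous_matrix_sqrt (S := fun x => (V x)ᴴ * V x)
    (by fun_prop) (fun x => Matrix.posSemidef_conjTranspose_mul_self _)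
  have hu : ∀ x, IsUnit (R x) := by
    intro x
    have h1 : IsUnit ((V x)ᴴ * V x) := by
      refine isUnit_of_forall_mul_eq_zero fun C hC => ?_
      have h2 : (V x * C)ᴴ * (V x * C) = 0 := by
        rw [Matrix.conjTranspose_mul, Matrix.mul_assoc, ← Matrix.mul_assoc (V x)ᴴ, hC,
          Matrix.mul_zero]
      have h3 : V x * C = 0 := Matrix.conjTranspose_mul_self_eq_zero.1 h2
      calc C = W x * V x * C := by rw [hWV, Matrix.one_mul]
        _ = 0 := by rw [Matrix.mul_assoc, h3, Matrix.mul_zero]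
    have h2 := hRR x
    have h3 : R x * (R x * ((V x)ᴴ * V x)⁻¹) = 1 := by
      rw [← Matrix.mul_assoc, h2, h1.matrix_mul_inv]
    exact isUnit_of_mul_eq_one' h3
  refine ⟨fun x => (R x)⁻¹, continuous_matrix_inv hR hu, fun x => ?_⟩
  have h1 := (hu x).matrix_mul_inv
  have h2 := (hu x).matrix_inv_mul
  rw [Matrix.conjTranspose_mul, Matrix.mul_assoc, ← Matrix.mul_assoc (V x)ᴴ, ← hRR,
    Matrix.conjTranspose_nonsing_inv, hRh, Matrix.mul_assoc, h1, Matrix.mul_one, h2]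

end SqrtMatrix

section EigProj

variable {X ι κ : Type} [TopologicalSpace X] [Fintype ι] [DecidableEq ι] [Fintype κ] [DecidableEq κ]

/-- The complexification of a real matrix. -/
noncomputable def cpx (A : Matrix ι κ ℝ) : Matrix ι κ ℂ := A.map Complex.ofReal

theorem cpx_mul {μ : Type} (A : Matrix ι κ ℝ) (B : Matrix κ μ ℝ) : cpx (A * B) = cpx A * cpx B :=
  Matrix.map_mul (f := Complex.ofRealHom)

@[simp] theorem cpx_one : cpx (1 : Matrix ι ι ℝ) = 1 := by
  ext i j; simp [cpx, Matrix.one_apply, apply_ite]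

@[simp] theorem cpx_neg (A : Matrix ι κ ℝ) : cpx (-A) = -cpx A := by
  ext i j; simp [cpx]

theorem cpx_transpose (A : Matrix ι κ ℝ) : cpx Aᵀ = (cpx A)ᵀ := rfl

theorem continuous_cpx : Continuous (cpx : Matrix ι κ ℝ → Matrix ι κ ℂ) :=
  Continuous.matrix_map continuous_id Complex.continuous_ofReal

/-- The projection onto the `i`-eigenspace of a real complex structure. -/
noncomputable def eigProj (J : Matrix ι ι ℝ) : Matrix ι ι ℂ := (1 / 2 : ℂ) • (1 - Complex.I • cpx J)

theorem continuous_eigProj : Continuous (eigProj : Matrix ι ι ℝ → Matrix ι ι ℂ) := by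
  have := continuous_cpx (ι := ι) (κ := ι)
  unfold eigProj
  fun_prop

theorem eigProj_mul_self {J : Matrix ι ι ℝ} (hJ : J * J = -1) : eigProj J * eigProj J = eigProj J := by
  have h1 : cpx J * cpx J = -1 := by rw [← cpx_mul, hJ]; simp
  have h2 : (1 - Complex.I • cpx J) * (1 - Complex.I • cpx J) = (2 : ℂ) • (1 - Complex.I • cpx J) := by
    have h3 : (Complex.I • cpx J) * (Complex.I • cpx J) = 1 := by
      rw [Matrix.smul_mul, Matrix.mul_smul, h1, smul_smul, Complex.I_mul_I]
      simp
    rw [mul_sub, sub_mul, sub_mul, h3, two_smul, mul_one, one_mul, mul_one]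
    abel
  rw [eigProj, Matrix.smul_mul, Matrix.mul_smul, h2, smul_smul, smul_smul]
  norm_num

theorem cpx_mul_eigProj {J : Matrix ι ι ℝ} (hJ : J * J = -1) :
    cpx J * eigProj J = Complex.I • eigProj J := by
  have h1 : cpx J * cpx J = -1 := by rw [← cpx_mul, hJ]; simp
  rw [eigProj, Matrix.mul_smul, mul_sub, Matrix.mul_smul, h1, smul_comm Complex.I]
  congr 1
  rw [smul_sub, smul_smul, Complex.I_mul_I]
  simp [add_comm]

theorem transpose_eq_neg_of_mem {J : Matrix ι ι ℝ} (h1 : Jᵀ * J = 1) (h2 : J * J = -1) : Jᵀ = -J := by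
  have h3 : Jᵀ * (J * J) = J := by rw [← Matrix.mul_assoc, h1, Matrix.one_mul]
  rw [h2, Matrix.mul_neg, Matrix.mul_one] at h3
  rw [← h3, neg_neg, h3]

theorem trace_eigProj {J : Matrix ι ι ℝ} (hJ : Jᵀ = -J) :
    (eigProj J).trace = (Fintype.card ι : ℂ) / 2 := by
  have h0 : J.trace = 0 := by
    have := Matrix.trace_transpose J
    rw [hJ, Matrix.trace_neg] at this
    linarith
  have h1 : (cpx J).trace = 0 := by
    have : (cpx J).trace = ((J.trace : ℝ) : ℂ) := by simp [Matrix.trace, cpx]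
    rw [this, h0]; simp
  rw [eigProj, Matrix.trace_smul, Matrix.trace_sub, Matrix.trace_smul, h1, Matrix.trace_one]
  simp; ring

end EigProj

theorem map_re_mul {ι κ μ : Type} [Fintype κ] (A : Matrix ι κ ℂ) (B : Matrix κ μ ℂ) :
    (A * B).map Complex.re = A.map Complex.re * B.map Complex.re -
      A.map Complex.im * B.map Complex.im := by
  ext i j
  simp [Matrix.mul_apply, ← Finset.sum_sub_distrib]

theorem map_im_mul {ι κ μ : Type} [Fintype κ] (A : Matrix ι κ ℂ) (B : Matrix κ μ ℂ) :
    (A * B).map Complex.im = A.map Complex.re * B.map Complex.im +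
      A.map Complex.im * B.map Complex.re := by
  ext i j
  simp [Matrix.mul_apply, ← Finset.sum_add_distrib]

/-- Families of orthogonal complex structures on `ℝ^{2 n + 2}` over `S^{2 n + 1}` lift to
families of orthogonal matrices. -/
theorem exists_orthogonal_lift {n : ℕ}
    {J : Sph (2 * n + 1) → Matrix (Fin (n + 1) ⊕ Fin (n + 1)) (Fin (n + 1) ⊕ Fin (n + 1)) ℝ}
    (hJc : Continuous J) (hJ : ∀ y, J y ∈ Gamma (n + 1)) :
    ∃ A : Sph (2 * n + 1) → Matrix (Fin (n + 1) ⊕ Fin (n + 1)) (Fin (n + 1) ⊕ Fin (n + 1)) ℝ,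
      Continuous A ∧ (∀ y, (A y)ᵀ * A y = 1) ∧ ∀ y, A y * J0 (n + 1) = J y * A y := by
  have hJt : ∀ y, (J y)ᵀ = -J y := fun y => transpose_eq_neg_of_mem (hJ y).1 (hJ y).2
  obtain ⟨V, W, hV, hW, hVW, hWV⟩ := mvN_one_of_trace_eq (m := n) (R := n + 1)
    (p := fun y => eigProj (J y)) (by omega) (continuous_eigProj.comp hJc)
    (fun y => eigProj_mul_self (hJ y).2)
    (fun y => by rw [trace_eigProj (hJt y)]; simp)
  obtain ⟨R, hR, hVR⟩ := exists_continuous_orthonormalization hV hWV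
  simp only at hVW hWV
  obtain ⟨U, hU⟩ : ∃ U, U = fun y => V y * R y := ⟨_, rfl⟩
  have hUc : Continuous U := by rw [hU]; fun_prop
  replace hVR : ∀ y, (U y)ᴴ * U y = 1 := by rw [hU]; exact hVR
  have hJU : ∀ y, cpx (J y) * U y = Complex.I • U y := by
    intro y
    have h1 : V y = eigProj (J y) * V y := by rw [← hVW, Matrix.mul_assoc, hWV, Matrix.mul_one]
    have h2 : cpx (J y) * V y = Complex.I • V y := by
      rw [h1, ← Matrix.mul_assoc, cpx_mul_eigProj (hJ y).2, Matrix.smul_mul]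
    simp only [hU]
    rw [← Matrix.mul_assoc, h2, Matrix.smul_mul]
  have hUU : ∀ y, (U y)ᵀ * U y = 0 := by
    intro y
    have h1 : (U y)ᵀ * cpx (J y) * U y = Complex.I • ((U y)ᵀ * U y) := by
      rw [Matrix.mul_assoc, hJU, Matrix.mul_smul]
    have h2 : (U y)ᵀ * cpx (J y) * U y = -(Complex.I • ((U y)ᵀ * U y)) := by
      have h3 : (U y)ᵀ * cpx (J y) = -(cpx (J y) * U y)ᵀ := by
        rw [Matrix.transpose_mul, ← cpx_transpose, hJt, cpx_neg, Matrix.mul_neg, neg_neg]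
      rw [h3, hJU, Matrix.transpose_smul, Matrix.neg_mul, Matrix.smul_mul]
    have h4 : (2 * Complex.I) • ((U y)ᵀ * U y) = 0 := by
      rw [mul_smul, two_smul]
      nth_rewrite 1 [← h1]
      rw [h2]; simp
    exact (smul_eq_zero.1 h4).resolve_left (by simp)
  let a : Sph (2 * n + 1) → Matrix (Fin (n + 1) ⊕ Fin (n + 1)) (Fin (n + 1)) ℝ :=
    fun y => (U y).map Complex.re
  let b : Sph (2 * n + 1) → Matrix (Fin (n + 1) ⊕ Fin (n + 1)) (Fin (n + 1)) ℝ :=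
    fun y => (U y).map Complex.im
  have hac : Continuous a := hUc.matrix_map Complex.continuous_re
  have hbc : Continuous b := hUc.matrix_map Complex.continuous_im
  have hJa : ∀ y, J y * a y = -b y ∧ J y * b y = a y := by
    intro y
    constructor
    · ext i j
      have := congrArg Complex.re (congrFun (congrFun (hJU y) i) j)
      simpa [Matrix.mul_apply, cpx, a, b] using this
    · ext i j
      have := congrArg Complex.im (congrFun (congrFun (hJU y) i) j)
      simpa [Matrix.mul_apply, cpx, a, b] using this
  have hor : ∀ y, (2 : ℝ) • ((a y)ᵀ * a y) = 1 ∧ (2 : ℝ) • ((b y)ᵀ * b y) = 1 ∧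
      (a y)ᵀ * b y = 0 ∧ (b y)ᵀ * a y = 0 := by
    intro y
    have r1 := map_re_mul (U y)ᴴ (U y)
    have r2 := map_im_mul (U y)ᴴ (U y)
    have r3 := map_re_mul (U y)ᵀ (U y)
    have r4 := map_im_mul (U y)ᵀ (U y)
    have k1 : (U y)ᴴ.map Complex.re = (a y)ᵀ := by ext i j; simp [a]
    have k2 : (U y)ᴴ.map Complex.im = -(b y)ᵀ := by ext i j; simp [b]
    have k3 : (U y)ᵀ.map Complex.re = (a y)ᵀ := rfl
    have k4 : (U y)ᵀ.map Complex.im = (b y)ᵀ := rfl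
    have k5 : (U y).map Complex.re = a y := rfl
    have k6 : (U y).map Complex.im = b y := rfl
    have k7 : (1 : Matrix (Fin (n + 1)) (Fin (n + 1)) ℂ).map Complex.re = 1 := by
      ext i j; simp [Matrix.one_apply, apply_ite]
    have k8 : (1 : Matrix (Fin (n + 1)) (Fin (n + 1)) ℂ).map Complex.im = 0 := by
      ext i j; simp [Matrix.one_apply, apply_ite]
    have k9 : (0 : Matrix (Fin (n + 1)) (Fin (n + 1)) ℂ).map Complex.re = 0 := by ext i j; simp
    have k10 : (0 : Matrix (Fin (n + 1)) (Fin (n + 1)) ℂ).map Complex.im = 0 := by ext i j; simp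
    rw [hVR, k1, k2, k5, k6, k7, Matrix.neg_mul, sub_neg_eq_add] at r1
    rw [hVR, k1, k2, k5, k6, k8, Matrix.neg_mul, ← sub_eq_add_neg] at r2
    rw [hUU, k3, k4, k5, k6, k9] at r3
    rw [hUU, k3, k4, k5, k6, k10] at r4
    have e1 := r1.symm
    have e2 := r2.symm
    have e3 := r3.symm
    have e4 := r4.symm
    have e5 := sub_eq_zero.1 e2
    have e6 : (b y)ᵀ * a y = 0 := by
      rw [e5, ← two_smul ℝ] at e4
      exact (smul_eq_zero.1 e4).resolve_left (by norm_num)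
    refine ⟨?_, ?_, by rw [e5, e6], e6⟩
    · rw [two_smul]; nth_rewrite 2 [sub_eq_zero.1 e3]; exact e1
    · rw [two_smul]; nth_rewrite 1 [← sub_eq_zero.1 e3]; exact e1
  refine ⟨fun y => √2 • Matrix.fromCols (a y) (-b y), ?_, fun y => ?_, fun y => ?_⟩
  · refine Continuous.const_smul (g := fun y => Matrix.fromCols (a y) (-b y)) ?_ (√2)
    refine continuous_matrix fun i j => ?_
    rcases j with j | j
    · exact hac.matrix_elem i j
    · exact (hbc.matrix_elem i j).neg
  · obtain ⟨h1, h2, h3, h4⟩ := hor y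
    rw [Matrix.transpose_smul, Matrix.smul_mul, Matrix.mul_smul, smul_smul,
      Real.mul_self_sqrt (by norm_num), Matrix.transpose_fromCols, Matrix.fromRows_mul_fromCols]
    simp only [Matrix.transpose_neg, Matrix.neg_mul, Matrix.mul_neg, neg_neg, h3, h4, neg_zero,
      Matrix.fromBlocks_smul, h1, h2, smul_zero, Matrix.fromBlocks_one]
  · obtain ⟨h1, h2⟩ := hJa y
    rw [Matrix.smul_mul, Matrix.mul_smul, Matrix.mul_fromCols, h1, J0,
      Matrix.mul_neg, h2, Matrix.fromCols_mul_fromBlocks]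
    simp

/-! ### The idempotent attached to a unit-valued polynomial family -/

section PolyProj

variable {X ι κ : Type} [TopologicalSpace X] [Fintype ι] [DecidableEq ι] [Fintype κ] [DecidableEq κ]

/-- The spectral idempotent of the companion pencil of a polynomial. -/
noncomputable def polyProj (m : ℕ) (b : ℕ → Matrix ι ι ℂ) :
    Matrix (Fin (m + 1) × ι) (Fin (m + 1) × ι) ℂ :=
  matPencilProj (companionShift ι m) (companion m b 0)

theorem matPencilUnit_companion {m : ℕ} {b : ℕ → Matrix ι ι ℂ}
    (hU : ∀ z : Circle, IsUnit (∑ t ∈ Finset.range (m + 1), (z : ℂ) ^ t • b t)) :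
    MatPencilUnit (companionShift ι m) (companion m b 0) := by
  intro z hz
  rw [← companion_eq]
  exact isUnit_companion (hU ⟨z, by simpa [Submonoid.unitSphere] using hz⟩)

theorem polyProj_mul_self {m : ℕ} {b : ℕ → Matrix ι ι ℂ}
    (hU : ∀ z : Circle, IsUnit (∑ t ∈ Finset.range (m + 1), (z : ℂ) ^ t • b t)) :
    polyProj m b * polyProj m b = polyProj m b :=
  matPencilProj_mul_self (matPencilUnit_companion hU)

theorem mvN_polyProj [CompactSpace X] {m : ℕ} (b : ℕ → X → I → Matrix ι ι ℂ)
    (hb : ∀ t, Continuous fun p : X × I => b t p.1 p.2)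
    (hU : ∀ x s (z : Circle), IsUnit (∑ t ∈ Finset.range (m + 1), (z : ℂ) ^ t • b t x s)) :
    MvN (fun x => polyProj m fun t => b t x 1) fun x => polyProj m fun t => b t x 0 := by
  refine mvN_of_homotopy (fun x s => polyProj m fun t => b t x s) ?_
    fun x s => polyProj_mul_self (hU x s)
  refine continuous_matPencilProj (X := X × I) continuous_const ?_
    fun p => matPencilUnit_companion (hU p.1 p.2)
  refine continuous_matrix fun i j => ?_
  simp only [companion, Matrix.of_apply]
  split_ifs
  · exact (hb _).matrix_elem _ _
  all_goals fun_prop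

/-- The spectral idempotent of `z ^ k (z p + 1 - p)`. -/
theorem polyProj_eq {p : Matrix ι ι ℂ} (hp : p * p = p) {k m : ℕ} (hk : k + 1 ≤ m) :
    polyProj m (fun t => if t = k then 1 - p else if t = k + 1 then p else 0) =
      Matrix.of fun P Q : Fin (m + 1) × ι => if P.1 = Q.1 then
        (if (P.1 : ℕ) < k then (1 : Matrix ι ι ℂ) else if (P.1 : ℕ) = k then p else 0) P.2 Q.2
        else 0 := by
  set r : ℕ → Matrix ι ι ℂ := fun t => if t = k then 1 - p else if t = k + 1 then p else 0 with hr
  have hU : ∀ z : Circle, IsUnit (∑ t ∈ Finset.range (m + 1), (z : ℂ) ^ t • r t) := by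
    intro z
    have e : ∑ t ∈ Finset.range (m + 1), (z : ℂ) ^ t • r t =
        (z : ℂ) ^ k • (1 - p) + (z : ℂ) ^ (k + 1) • p := by
      rw [Finset.sum_eq_add_of_mem k (k + 1) (by simp; omega) (by simp; omega) (by omega)]
      · simp [hr]
      · intro t _ ht
        simp [hr, ht.1, ht.2]
    have hz := Circle.coe_ne_zero z
    rw [e]
    refine isUnit_of_mul_eq_one' (B := ((z : ℂ) ^ k)⁻¹ • (1 - p) + ((z : ℂ) ^ (k + 1))⁻¹ • p) ?_
    have h1 : (1 - p) * p = 0 := by rw [sub_mul, hp, one_mul, sub_self]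
    have h2 : p * (1 - p) = 0 := by rw [mul_sub, hp, mul_one, sub_self]
    have h3 : (1 - p) * (1 - p) = 1 - p := by rw [mul_sub, h1, mul_one, sub_zero]
    simp only [add_mul, mul_add, Matrix.smul_mul, Matrix.mul_smul, h1, h2, h3, hp, smul_zero,
      smul_smul, add_zero, zero_add]
    rw [inv_mul_cancel₀ (pow_ne_zero _ hz), inv_mul_cancel₀ (pow_ne_zero _ hz)]
    simp
  let α : ℕ → Matrix ι ι ℂ := fun t => if t < k then 1 else if t = k then p else 0
  let D : ℕ → ℕ → Matrix ι ι ℂ := fun s t => if s ≤ t then α t else α t - 1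
  have hrD : ∀ s t, r s * D s t = 0 := by
    intro s t
    have h1 : (1 - p) * p = 0 := by rw [sub_mul, hp, one_mul, sub_self]
    have h2 : p * (p - 1) = 0 := by rw [mul_sub, hp, mul_one, sub_self]
    by_cases hs : s = k
    · subst hs
      rcases lt_trichotomy t s with h | h | h
      · simp [D, α, h, not_le.2 h]
      · subst h; simp [r, D, α, h1]
      · simp [D, α, h.le, h.not_gt, h.ne']
    · by_cases hs' : s = k + 1
      · subst hs'
        rcases lt_trichotomy t k with h | h | h
        · have : ¬ (k + 1 ≤ t) := by omega
          simp [D, α, h, this]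
        · subst h; simp [r, D, α, h2]
        · have : k + 1 ≤ t := h
          simp [D, α, this, h.not_gt, h.ne']
      · simp [r, hs, hs']
  let c : ℕ → Matrix (Fin (m + 1) × ι) (Fin (m + 1) × ι) ℂ := fun j => Matrix.of fun P Q =>
    if (P.1 : ℕ) + m = j + Q.1 then D P.1 Q.1 P.2 Q.2 else 0
  have key := matPencilProj_mul_of_laurent (matPencilUnit_companion hU) 1 m (2 * m + 1) c
    (fun z hz => ?_) (by omega)
  · rw [Matrix.mul_one] at key
    rw [polyProj, key]
    ext ⟨s, i⟩ ⟨t, j⟩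
    simp only [c, Matrix.of_apply]
    by_cases h : s = t
    · subst h
      simp [D, α, add_comm]
    · rw [if_neg h, if_neg]
      intro h'
      exact h (Fin.ext (by omega))
  · have hz0 : z ≠ 0 := by rintro rfl; simp at hz
    have hsum : ∑ t ∈ Finset.range (2 * m + 1), z ^ ((t : ℤ) - m) • c t =
        Matrix.of fun P Q => z ^ ((P.1 : ℤ) - (Q.1 : ℤ)) * D P.1 Q.1 P.2 Q.2 := by
      ext ⟨s, i⟩ ⟨t, j⟩
      simp only [Matrix.sum_apply, Matrix.smul_apply, c, Matrix.of_apply, smul_eq_mul]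
      rw [Finset.sum_eq_single ((s : ℕ) + m - t)]
      · have h1 : (s : ℕ) + m = s + m - t + t := by omega
        rw [if_pos h1]
        congr 2
        have : (((s : ℕ) + m - t : ℕ) : ℤ) = s + m - t := by omega
        rw [this]; ring
      · intro b _ hb
        rw [if_neg (by omega), mul_zero]
      · intro h
        exact absurd (Finset.mem_range.2 (by omega)) h
    rw [← companion_eq, hsum, Matrix.mul_one]
    ext ⟨s, i⟩ ⟨t, j⟩
    refine Fin.cases ?_ (fun s => ?_) s
    · rw [companion_mul_zero, Matrix.smul_apply]
      have h0 : companionShift ι m (0, i) (t, j) = 0 := by simp [companionShift]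
      rw [h0, smul_zero]
      refine Finset.sum_eq_zero fun s _ => ?_
      have := congrFun (congrFun (hrD s t) i) j
      rw [Matrix.mul_apply] at this
      simp only [Matrix.of_apply]
      calc _ = z ^ ((s : ℤ) - (t : ℤ)) * ∑ l, r s i l * D s t l j := by
            rw [Finset.mul_sum]
            exact Finset.sum_congr rfl fun _ _ => by ring
        _ = 0 := by rw [this]; simp
    · rw [companion_mul_succ, Matrix.smul_apply]
      have h0 : companionShift ι m (s.succ, i) (t, j) =
          -((1 : Matrix (Fin (m + 1) × ι) (Fin (m + 1) × ι) ℂ) (s.castSucc, i) (t, j)) := by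
        rw [← companionShift_mul_succ, Matrix.mul_one]
      rw [h0]
      simp only [Matrix.of_apply, Fin.val_succ, Fin.val_castSucc]
      have h1 : z ^ (((s : ℕ) + 1 : ℕ) - (t : ℤ)) = z * z ^ ((s : ℤ) - (t : ℤ)) := by
        rw [← zpow_one_add₀ hz0]
        congr 1; push_cast; ring
      rw [h1]
      rcases lt_trichotomy (s : ℕ) t with h | h | h
      · have : s.castSucc ≠ t := fun h' => by simp [← h'] at h
        rw [Matrix.one_apply_ne (by simp [this])]
        have h2 : D (s + 1) t = D s t := by
          simp [D, h.le, Nat.succ_le_of_lt h]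
        rw [h2]; simp; ring
      · have : s.castSucc = t := Fin.ext h
        subst this
        simp [D, Matrix.one_apply]
        rw [mul_sub, mul_ite, mul_one, mul_zero, sub_sub_cancel_left]
      · have : s.castSucc ≠ t := fun h' => by simp [← h'] at h
        rw [Matrix.one_apply_ne (by simp [this])]
        have h2 : D (s + 1) t = D s t := by
          have : ¬ ((s : ℕ) + 1 ≤ t) := by omega
          simp [D, not_le.2 h, this]
        rw [h2]; simp; ring

/-- If `z p + 1 - p` can be deformed to a family of loops independent of the parameter then `p`
is stably trivial. -/
theorem stablyTrivial_of_loop_homotopy [CompactSpace X] [T2Space X] {p : X → Matrix ι ι ℂ}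
    (hpc : Continuous p) (hp : ∀ x, p x * p x = p x) (x₀ : X)
    (G : I → X → Circle → Matrix ι ι ℂ)
    (hG : Continuous fun q : I × (X × Circle) => G q.1 q.2.1 q.2.2)
    (hGu : ∀ s x z, IsUnit (G s x z)) (hG0 : ∀ x z, G 0 x z = (z : ℂ) • p x + (1 - p x))
    (hG1 : ∀ x x' z, G 1 x z = G 1 x' z) : StablyTrivial p := by
  obtain ⟨k, b, hk, hb, hu, hv⟩ := exists_laurentSum_isUnit (X := X × I)
    (fun q => G q.1.2 q.1.1 q.2)
    (hG.comp (f := fun q : (X × I) × Circle => (q.1.2, (q.1.1, q.2))) (by fun_prop))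
    fun q => hGu _ _ _
  have hz : ∀ z : Circle, (z : ℂ) ^ k ≠ 0 := fun z => pow_ne_zero _ (Circle.coe_ne_zero z)
  have hzu : ∀ (z : Circle) (A : Matrix ι ι ℂ), IsUnit A → IsUnit ((z : ℂ) ^ k • A) := by
    intro z A hA
    have h2 : IsUnit ((z : ℂ) ^ k • (1 : Matrix ι ι ℂ)) :=
      isUnit_of_mul_eq_one' (B := ((z : ℂ) ^ k)⁻¹ • 1) (by simp [hz])
    simpa using h2.mul hA
  have hzL : ∀ (z : Circle) (c : ℕ → Matrix ι ι ℂ), (z : ℂ) ^ k • laurentSum k c (z : ℂ) =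
      ∑ t ∈ Finset.range (2 * k + 1), (z : ℂ) ^ t • c t := fun z c => by
    rw [laurentSum, smul_inv_smul₀ (hz z)]
  let r : ℕ → X → Matrix ι ι ℂ := fun t x => if t = k then 1 - p x else if t = k + 1 then p x else 0
  have hr : ∀ t, Continuous (r t) := by
    intro t; simp only [r]; split_ifs <;> fun_prop
  have hrs : ∀ x (z : Circle), ∑ t ∈ Finset.range (2 * k + 1), (z : ℂ) ^ t • r t x =
      (z : ℂ) ^ k • ((z : ℂ) • p x + (1 - p x)) := by
    intro x z
    rw [Finset.sum_eq_add_of_mem k (k + 1) (by simp; omega) (by simp; omega) (by omega)]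
    · simp only [r, if_true, Nat.succ_ne_self, if_false, pow_succ, smul_add, smul_smul]
      rw [add_comm]
    · intro t _ ht
      simp [r, ht.1, ht.2]
  have hlin : ∀ (τ : I) (c c' : ℕ → Matrix ι ι ℂ) (z : Circle),
      ∑ t ∈ Finset.range (2 * k + 1), (z : ℂ) ^ t • ((1 - (τ : ℂ)) • c t + (τ : ℂ) • c' t) =
      (1 - (τ : ℂ)) • ∑ t ∈ Finset.range (2 * k + 1), (z : ℂ) ^ t • c t +
        (τ : ℂ) • ∑ t ∈ Finset.range (2 * k + 1), (z : ℂ) ^ t • c' t := by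
    intro τ c c' z
    simp only [Finset.smul_sum, ← Finset.sum_add_distrib]
    refine Finset.sum_congr rfl fun t _ => ?_
    rw [smul_add, smul_comm (1 - (τ : ℂ)), smul_comm (τ : ℂ)]
  have m1 := mvN_polyProj (m := 2 * k)
    (fun t x (τ : I) => (1 - (τ : ℂ)) • r t x + (τ : ℂ) • b t (x, 0)) (fun t => by
      have h1 := hr t
      have h2 : Continuous fun q : X × I => b t (q.1, 0) := (hb t).comp (by fun_prop)
      fun_prop) fun x τ z => by
      rw [hlin, hrs, ← hzL, smul_comm, smul_comm (τ : ℂ), ← smul_add, ← hG0]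
      exact hzu z _ (hu ((x, 0), z) τ)
  have m2 := mvN_polyProj (m := 2 * k) (fun t x (τ : I) => b t (x, τ)) (fun t => hb t)
    fun x τ z => by
      rw [← hzL]
      have := hu ((x, τ), z) 1
      simp only [Set.Icc.coe_one, Complex.ofReal_one, sub_self, zero_smul, zero_add,
        one_smul] at this
      exact hzu z _ this
  have m3 := mvN_polyProj (m := 2 * k)
    (fun t x (τ : I) => (1 - (τ : ℂ)) • b t (x, 1) + (τ : ℂ) • b t (x₀, 1)) (fun t => by
      have h2 : Continuous fun q : X × I => b t (q.1, 1) := (hb t).comp (by fun_prop)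
      fun_prop) fun x τ z => by
      rw [hlin, ← hzL, ← hzL, smul_comm, smul_comm (τ : ℂ), ← smul_add]
      exact hzu z _ (hv (x, 1) (x₀, 1) z τ (hG1 x x₀ z))
  simp only [Set.Icc.coe_one, Complex.ofReal_one, sub_self, zero_smul, zero_add, one_smul,
    Set.Icc.coe_zero, Complex.ofReal_zero, sub_zero, add_zero] at m1 m2 m3
  have hid : ∀ x s, (polyProj (2 * k) fun t => b t (x, s)) * (polyProj (2 * k) fun t => b t (x, s)) =
      polyProj (2 * k) fun t => b t (x, s) := fun x s => polyProj_mul_self fun z => by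
    rw [← hzL]
    have := hu ((x, s), z) 1
    simp only [Set.Icc.coe_one, Complex.ofReal_one, sub_self, zero_smul, zero_add,
      one_smul] at this
    exact hzu z _ this
  have hidr : ∀ x, (polyProj (2 * k) fun t => r t x) * (polyProj (2 * k) fun t => r t x) =
      polyProj (2 * k) fun t => r t x := fun x => polyProj_mul_self fun z => by
    rw [hrs, ← hG0]
    exact hzu z _ (hGu _ _ _)
  have m4 := (m1.symm.trans (m2.symm.trans m3.symm (fun x => hid _ _) fun x => hid _ _) hidr
    fun x => hid _ _)
  have hkm : k < 2 * k + 1 := by omega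
  let k' : Fin (2 * k + 1) := ⟨k, hkm⟩
  let e : ι ⊕ ({t : Fin (2 * k + 1) // t ≠ k'} × ι) ≃ Fin (2 * k + 1) × ι :=
    { toFun := Sum.elim (fun i => (k', i)) fun q => (q.1.1, q.2)
      invFun := fun q => if h : q.1 = k' then Sum.inl q.2 else Sum.inr (⟨q.1, h⟩, q.2)
      left_inv := by
        rintro (i | ⟨⟨t, ht⟩, i⟩)
        · simp
        · simp [ht]
      right_inv := by
        rintro ⟨t, i⟩
        by_cases h : t = k' <;> simp [h] }
  let E : Matrix ({t : Fin (2 * k + 1) // t ≠ k'} × ι) ({t : Fin (2 * k + 1) // t ≠ k'} × ι) ℂ :=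
    Matrix.diagonal fun P => if (P.1.1 : ℕ) < k then 1 else 0
  refine stablyTrivial_of_const hp E (by
    rw [Matrix.diagonal_mul_diagonal]; congr 1; ext P; split_ifs <;> simp) _ (hid x₀ 1) ?_
  have m5 := m4.submatrix e (Equiv.refl _)
  convert m5 using 2 with x
  swap
  · rfl
  have h := polyProj_eq (hp x) (k := k) (m := 2 * k) (by omega)
  simp only [r]
  rw [h]
  ext (i | ⟨⟨t, ht⟩, i⟩) (j | ⟨⟨t', ht'⟩, j⟩)
  · simp [e, k']
  · simp [e, Ne.symm ht']
  · simp [e, ht]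
  · have : (t : ℕ) ≠ k := fun h => ht (Fin.ext h)
    by_cases htt : t = t'
    · subst htt
      simp [e, E, Matrix.diagonal_apply, this, Matrix.one_apply]
      split_ifs <;> simp_all [Matrix.one_apply]
    · simp [e, E, Matrix.diagonal_apply, htt]

end PolyProj

/-! ### Suspension of idempotents and invertible matrices -/

section Clutching

variable {ι : Type} [Fintype ι] [DecidableEq ι]

/-- The map `S^{e+1} → Idempotents` clutched by `γ`, in suspension coordinates; if it is stably
trivial then `γ` is stably constant. -/
theorem StablyTrivial.stablyConst_of_clutching {e : ℕ} {γ γ' : Sph e → Matrix ι ι ℂ}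
    (hγ : Continuous γ) (hγ' : Continuous γ') (hm : ∀ y, γ y * γ' y = 1)
    {P : Sph (e + 1) → Matrix (ι ⊕ ι) (ι ⊕ ι) ℂ}
    (hP : ∀ y s, P (suspMap e (y, s)) = Matrix.fromBlocks
      ((Real.cos (Real.pi / 2 * s) : ℂ) ^ 2 • (1 : Matrix ι ι ℂ))
      (((Real.cos (Real.pi / 2 * s) : ℂ) * (Real.sin (Real.pi / 2 * s) : ℂ)) • γ' y)
      (((Real.cos (Real.pi / 2 * s) : ℂ) * (Real.sin (Real.pi / 2 * s) : ℂ)) • γ y)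
      ((Real.sin (Real.pi / 2 * s) : ℂ) ^ 2 • (1 : Matrix ι ι ℂ)))
    (h : StablyTrivial P) : StablyConst γ := by
  obtain ⟨N, M, V, W, hV, hW, hVW, hWV⟩ := h
  simp only at hVW hWV
  have hm' : ∀ y, γ' y * γ y = 1 := fun y => mul_eq_one_comm.1 (hm y)
  obtain ⟨T, hT⟩ : ∃ T : Sph e → I → Matrix ((ι ⊕ ι) ⊕ Fin N) ((ι ⊕ ι) ⊕ Fin N) ℂ, T = fun y (s : I) =>
    Matrix.fromBlocks ((Real.cos (Real.pi / 2 * s) : ℂ) • (1 : Matrix ι ι ℂ))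
      (-((Real.sin (Real.pi / 2 * s) : ℂ) • γ' y)) ((Real.sin (Real.pi / 2 * s) : ℂ) • γ y)
      ((Real.cos (Real.pi / 2 * s) : ℂ) • (1 : Matrix ι ι ℂ)) ⊞ₘ (1 : Matrix (Fin N) (Fin N) ℂ) :=
    ⟨_, rfl⟩
  obtain ⟨T', hT'⟩ : ∃ T : Sph e → I → Matrix ((ι ⊕ ι) ⊕ Fin N) ((ι ⊕ ι) ⊕ Fin N) ℂ, T = fun y (s : I) =>
    Matrix.fromBlocks ((Real.cos (Real.pi / 2 * s) : ℂ) • (1 : Matrix ι ι ℂ))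
      ((Real.sin (Real.pi / 2 * s) : ℂ) • γ' y) (-((Real.sin (Real.pi / 2 * s) : ℂ) • γ y))
      ((Real.cos (Real.pi / 2 * s) : ℂ) • (1 : Matrix ι ι ℂ)) ⊞ₘ (1 : Matrix (Fin N) (Fin N) ℂ) :=
    ⟨_, rfl⟩
  let y₀ : Sph e := northPole e
  obtain ⟨n, hn⟩ : ∃ n, n = suspMap e (y₀, 0) := ⟨_, rfl⟩
  obtain ⟨s, hs⟩ : ∃ s, s = suspMap e (y₀, 1) := ⟨_, rfl⟩
  have hPn : P n = (1 : Matrix ι ι ℂ) ⊞ₘ (0 : Matrix ι ι ℂ) := by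
    rw [hn, hP]; simp
  have hPs : P s = (0 : Matrix ι ι ℂ) ⊞ₘ (1 : Matrix ι ι ℂ) := by
    rw [hs, hP]; simp
  have hTP : ∀ y t, T y t * (P n ⊞ₘ (1 : Matrix (Fin N) (Fin N) ℂ)) * T' y t =
      P (suspMap e (y, t)) ⊞ₘ (1 : Matrix (Fin N) (Fin N) ℂ) := fun y t => by
    rw [hT, hT', hPn, hP]
    simp only [Matrix.fromBlocks_multiply, Matrix.mul_zero, Matrix.zero_mul, add_zero, zero_add,
      Matrix.mul_one, Matrix.one_mul, smul_smul, Matrix.smul_mul, Matrix.mul_smul, hm, sq, smul_zero]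
    rw [mul_comm (Complex.ofReal (Real.sin _))]
  let f : Matrix ((ι ⊕ ι) ⊕ Fin N) (ι ⊕ Fin N) ℂ :=
    Matrix.fromBlocks (Matrix.fromRows 0 1) 0 0 1
  let f' : Matrix (ι ⊕ Fin N) ((ι ⊕ ι) ⊕ Fin N) ℂ :=
    Matrix.fromBlocks (Matrix.fromCols 0 1) 0 0 1
  let g : Matrix ((ι ⊕ ι) ⊕ Fin N) (ι ⊕ Fin N) ℂ :=
    Matrix.fromBlocks (Matrix.fromRows 1 0) 0 0 1
  let g' : Matrix (ι ⊕ Fin N) ((ι ⊕ ι) ⊕ Fin N) ℂ :=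
    Matrix.fromBlocks (Matrix.fromCols 1 0) 0 0 1
  have hgg : g * g' = P n ⊞ₘ (1 : Matrix (Fin N) (Fin N) ℂ) := by
    simp [g, g', hPn, Matrix.fromBlocks_multiply, Matrix.fromRows_mul_fromCols]
    ext (i | i) (j | j) <;> simp
  have hff : f' * (P s ⊞ₘ (1 : Matrix (Fin N) (Fin N) ℂ)) * f = 1 := by
    simp [f, f', hPs, Matrix.fromBlocks_multiply, Matrix.fromCols_mul_fromBlocks,
      Matrix.fromCols_mul_fromRows]
  have hWPV : ∀ q, W q * (P q ⊞ₘ (1 : Matrix (Fin N) (Fin N) ℂ)) * V q = 1 := fun q => by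
    rw [← hVW, ← Matrix.mul_assoc, hWV, Matrix.one_mul, hWV]
  have hcT : Continuous fun p : I × Sph e => T p.2 p.1 := by rw [hT]; fun_prop
  have hcs := continuous_suspMap e
  have key : ∀ t y, (f' * (V s * (W (suspMap e (y, t)) * T y t * V n) * W n) * g) *
      (g' * (V n * (W n * T' y t * V (suspMap e (y, t))) * W s) * f) = 1 := fun t y => by
    calc _ = f' * V s * (W (suspMap e (y, t)) * (T y t * (V n * (W n * (g * g') * V n) * W n) *
          T' y t) * V (suspMap e (y, t))) * W s * f := by simp only [Matrix.mul_assoc]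
      _ = 1 := by
        rw [hgg, hWPV, Matrix.mul_one, hVW, hTP, hWPV, Matrix.mul_one, Matrix.mul_assoc f', hVW, hff]
  have h0 : ∀ y, f' * (V s * (W (suspMap e (y, 0)) * T y 0 * V n) * W n) * g = f' * (V s * W n) * g :=
    fun y => by
      rw [suspMap_zero y y₀, ← hn]
      have : T y 0 = 1 := by simp [hT]
      rw [this, Matrix.mul_one, hWV, Matrix.mul_one]
  have h1 : ∀ y, f' * (V s * (W (suspMap e (y, 1)) * T y 1 * V n) * W n) * g =
      γ y ⊞ₘ (1 : Matrix (Fin N) (Fin N) ℂ) := fun y => by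
    rw [suspMap_one y y₀, ← hs]
    calc _ = f' * (V s * W s * T y 1 * (V n * W n)) * g := by simp only [Matrix.mul_assoc]
      _ = _ := by
        rw [hVW, hVW, hPn, hPs, hT]
        simp [f', g, Matrix.fromBlocks_multiply, Matrix.fromCols_mul_fromBlocks,
          Matrix.fromCols_mul_fromRows]
  have hc : Continuous fun p : I × Sph e =>
      f' * (V s * (W (suspMap e (p.2, p.1)) * T p.2 p.1 * V n) * W n) * g := by
    have hcW : Continuous fun p : I × Sph e => W (suspMap e (p.2, p.1)) := by fun_prop
    exact (continuous_const.matrix_mul ((continuous_const.matrix_mul ((hcW.matrix_mul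
      hcT).matrix_mul continuous_const)).matrix_mul continuous_const)).matrix_mul continuous_const
  refine StablyConst.of_blockSum (κ := Fin N) (c := f' * (V s * W n) * g) ?_ ?_
  · rw [← h0 y₀]
    exact isUnit_of_mul_eq_one' (key 0 y₀)
  · refine GLHomotopic.symm ⟨fun t y => f' * (V s * (W (suspMap e (y, t)) * T y t * V n) * W n) * g,
      hc, fun t y => isUnit_of_mul_eq_one' (key t y), h0, h1⟩

/-- If the suspension of an idempotent is stably constant, then the idempotent is stably
trivial. -/
theorem StablyConst.stablyTrivial_of_susp {d : ℕ} {p : Sph d → Matrix ι ι ℂ}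
    (hpc : Continuous p) (hp : ∀ x, p x * p x = p x) {γ : Sph (d + 1) → Matrix ι ι ℂ}
    (hγ : ∀ x (t : I), Complex.exp (Real.pi * (t : ℝ) * Complex.I) • γ (suspMap d (x, t)) =
      (circ t : ℂ) • p x + (1 - p x)) (h : StablyConst γ) : StablyTrivial p := by
  obtain ⟨N, h, hh, hu, h0, h1⟩ := h
  let x₀ : Sph d := northPole d
  obtain ⟨n, hn⟩ : ∃ n, n = suspMap d (x₀, 0) := ⟨_, rfl⟩
  obtain ⟨s, hs⟩ : ∃ s, s = suspMap d (x₀, 1) := ⟨_, rfl⟩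
  obtain ⟨D, hD⟩ : ∃ D : I → Matrix (ι ⊕ Fin N) (ι ⊕ Fin N) ℂ, D = fun (t : I) =>
    (Complex.exp (Real.pi * (t : ℝ) * Complex.I) • (1 : Matrix ι ι ℂ)) ⊞ₘ
      (1 : Matrix (Fin N) (Fin N) ℂ) := ⟨_, rfl⟩
  have hDc : Continuous D := by
    rw [hD]; fun_prop
  have hDu : ∀ t, IsUnit (D t) := fun t => by
    rw [hD]
    refine IsUnit.blockSum ?_ isUnit_one
    refine isUnit_of_mul_eq_one' (B := Complex.exp (-(Real.pi * (t : ℝ) * Complex.I)) • 1) ?_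
    rw [Matrix.smul_mul, Matrix.mul_smul, smul_smul, ← Complex.exp_add]
    simp
  obtain ⟨K, hK⟩ : ∃ K : I → Matrix (ι ⊕ Fin N) (ι ⊕ Fin N) ℂ, K = fun τ =>
    (D 1 * h τ s)⁻¹ * h τ n := ⟨_, rfl⟩
  have hKc : Continuous K := by
    have c1 : Continuous fun τ => h τ s := hh.comp (f := fun τ : I => (τ, s)) (by fun_prop)
    have c2 : Continuous fun τ => h τ n := hh.comp (f := fun τ : I => (τ, n)) (by fun_prop)
    rw [hK]
    exact (continuous_matrix_inv (by fun_prop) fun τ => (hDu 1).mul (hu τ s)).matrix_mul c2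
  have hKu : ∀ τ, IsUnit (K τ) := fun τ => by
    rw [hK]; exact ((hDu 1).mul (hu τ s)).matrix_inv.mul (hu τ n)
  have hDγ : ∀ x t, D t * h 0 (suspMap d (x, t)) =
      ((circ t : ℂ) • p x + (1 - p x)) ⊞ₘ (1 : Matrix (Fin N) (Fin N) ℂ) := fun x t => by
    rw [h0, hD, ← hγ]
    simp [Matrix.fromBlocks_multiply]
  have hD0 : D 0 = 1 := by simp [hD]
  have hK0 : K 0 = 1 := by
    have a1 : h 0 n = 1 := by
      have := hDγ x₀ 0
      rw [hD0, Matrix.one_mul, ← hn] at this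
      simpa using this
    have a2 : D 1 * h 0 s = 1 := by
      have := hDγ x₀ 1
      rw [← hs] at this
      simpa using this
    rw [hK]
    simp only
    rw [a1, a2]; simp
  have hcs := continuous_suspMap d
  obtain ⟨G, hG, hGq⟩ := exists_descend_circ (T := I × Sph d)
    (fun q t => D t * h q.1 (suspMap d (q.2, t)) * K (q.1 * t)) (by
      have c1 : Continuous fun q : (I × Sph d) × I => h q.1.1 (suspMap d (q.1.2, q.2)) :=
        hh.comp (f := fun q : (I × Sph d) × I => (q.1.1, suspMap d (q.1.2, q.2))) (by fun_prop)
      fun_prop) fun q => by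
      rw [mul_zero, mul_one, hK0, hD0, Matrix.mul_one, Matrix.one_mul, hK, suspMap_zero q.2 x₀,
        suspMap_one q.2 x₀, ← hn, ← hs]
      simp only
      rw [← Matrix.mul_assoc, ((hDu 1).mul (hu q.1 s)).matrix_mul_inv, Matrix.one_mul]
  have hST := stablyTrivial_of_loop_homotopy (X := Sph d)
    (p := fun x => p x ⊞ₘ (0 : Matrix (Fin N) (Fin N) ℂ)) (by fun_prop)
    (by simp [Matrix.fromBlocks_multiply, hp]) x₀ (fun τ x z => G (τ, x) z)
    (hG.comp (f := fun q : I × (Sph d × Circle) => ((q.1, q.2.1), q.2.2)) (by fun_prop))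
    (fun τ x z => by
      obtain ⟨t, rfl⟩ := circ_surjective z
      simp only [hGq]
      exact ((hDu t).mul (hu _ _)).mul (hKu _))
    (fun x z => by
      obtain ⟨t, rfl⟩ := circ_surjective z
      simp only [hGq]
      rw [zero_mul, hK0, Matrix.mul_one, hDγ, ← Matrix.fromBlocks_one]
      simp only [Matrix.fromBlocks_smul, Matrix.fromBlocks_add, sub_eq_add_neg, Matrix.fromBlocks_neg,
        smul_zero, neg_zero, add_zero, zero_add])
    fun x x' z => by
      obtain ⟨t, rfl⟩ := circ_surjective z
      simp only [hGq, h1]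
  exact StablyTrivial.of_blockSum hpc hp 0 (by simp) hST

end Clutching

/-! ### Clifford maps and the Bott idempotents on even spheres -/

/-- The block diagonal matrix with `r` copies of `A`. -/
def dup {ι 𝕜 : Type} [DecidableEq ι] [Zero 𝕜] (r : ℕ) (A : Matrix ι ι 𝕜) :
    Matrix (ι × Fin r) (ι × Fin r) 𝕜 :=
  Matrix.blockDiagonal fun _ => A

section Dup

variable {ι 𝕜 : Type} [Fintype ι] [DecidableEq ι] [CommRing 𝕜]

theorem dup_mul (r : ℕ) (A B : Matrix ι ι 𝕜) : dup r (A * B) = dup r A * dup r B :=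
  Matrix.blockDiagonal_mul _ _

theorem dup_add (r : ℕ) (A B : Matrix ι ι 𝕜) : dup r (A + B) = dup r A + dup r B :=
  Matrix.blockDiagonal_add (fun _ => A) fun _ => B

@[simp] theorem dup_one (r : ℕ) : dup r (1 : Matrix ι ι 𝕜) = 1 := Matrix.blockDiagonal_one

theorem dup_smul (r : ℕ) (c : 𝕜) (A : Matrix ι ι 𝕜) : dup r (c • A) = c • dup r A :=
  Matrix.blockDiagonal_smul c fun _ => A

theorem Continuous.dup {X : Type} [TopologicalSpace X] {p : X → Matrix ι ι ℂ} (hp : Continuous p)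
    (r : ℕ) : Continuous fun x => dup r (p x) := by
  unfold _root_.dup
  fun_prop

end Dup

section Clifford

variable {ι : Type} [Fintype ι] [DecidableEq ι] {d : ℕ}

/-- A continuous map, homogeneous for real scalars, whose square is the squared norm. -/
structure IsCliffordMap (L : (Fin (d + 1) → ℝ) → Matrix ι ι ℂ) : Prop where
  continuous : Continuous L
  smul : ∀ (c : ℝ) x, L (c • x) = (c : ℂ) • L x
  mul_self : ∀ x, L x * L x = ((∑ i, x i ^ 2 : ℝ) : ℂ) • (1 : Matrix ι ι ℂ)

/-- The map `y ↦ y_last + ε L (init y)`. -/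
noncomputable def cliffordSusp (L : (Fin (d + 1) → ℝ) → Matrix ι ι ℂ) (ε : ℂ)
    (y : Fin (d + 2) → ℝ) : Matrix ι ι ℂ :=
  (y (Fin.last _) : ℂ) • 1 + ε • L (Fin.init y)

/-- The passage from a Clifford map in `d + 1` variables to one in `d + 3` variables. -/
noncomputable def cliffordStep (L : (Fin (d + 1) → ℝ) → Matrix ι ι ℂ) (z : Fin (d + 3) → ℝ) :
    Matrix (ι ⊕ ι) (ι ⊕ ι) ℂ :=
  Matrix.fromBlocks ((z (Fin.last _) : ℂ) • 1) (cliffordSusp L (-Complex.I) (Fin.init z))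
    (cliffordSusp L Complex.I (Fin.init z)) (-((z (Fin.last _) : ℂ) • 1))

/-- The projection to the positive eigenspace of a Clifford map at a point of the sphere. -/
noncomputable def cliffordProj (L : (Fin (d + 1) → ℝ) → Matrix ι ι ℂ) (x : Sph d) :
    Matrix ι ι ℂ :=
  (1 / 2 : ℂ) • (1 + L fun i => x.1 i)

theorem continuous_init {m : ℕ} : Continuous fun y : Fin (m + 1) → ℝ => (Fin.init y : Fin m → ℝ) :=
  continuous_pi fun i => continuous_apply (A := fun _ => ℝ) i.castSucc

namespace IsCliffordMap

variable {L : (Fin (d + 1) → ℝ) → Matrix ι ι ℂ}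

theorem mul_self_sph (hL : IsCliffordMap L) (x : Sph d) : (L fun i => x.1 i) * (L fun i => x.1 i) = 1 := by
  rw [hL.mul_self, Sph_sum_sq]; simp

theorem continuous_sph (hL : IsCliffordMap L) : Continuous fun x : Sph d => L fun i => x.1 i :=
  hL.continuous.comp (by fun_prop)

theorem continuous_cliffordProj (hL : IsCliffordMap L) : Continuous (cliffordProj L) := by
  have := hL.continuous_sph
  exact (continuous_const.add this).fun_const_smul _

theorem cliffordProj_mul_self (hL : IsCliffordMap L) (x : Sph d) :
    cliffordProj L x * cliffordProj L x = cliffordProj L x := by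
  have := hL.mul_self_sph x
  rw [cliffordProj]
  simp only [Matrix.smul_mul, Matrix.mul_smul, smul_smul, add_mul, mul_add, mul_one, one_mul, this]
  module

theorem continuous_cliffordSusp (hL : IsCliffordMap L) (ε : ℂ) : Continuous (cliffordSusp L ε) := by
  have := hL.continuous.comp (continuous_init (m := d + 1))
  unfold cliffordSusp
  exact ((Complex.continuous_ofReal.comp (continuous_apply _)).smul continuous_const).add
    (this.fun_const_smul ε)

theorem cliffordSusp_smul (hL : IsCliffordMap L) (ε : ℂ) (c : ℝ) (y : Fin (d + 2) → ℝ) :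
    cliffordSusp L ε (c • y) = (c : ℂ) • cliffordSusp L ε y := by
  have : (Fin.init (c • y) : Fin (d + 1) → ℝ) = c • Fin.init y := rfl
  rw [cliffordSusp, cliffordSusp, this, hL.smul]
  simp only [Pi.smul_apply, smul_eq_mul, Complex.ofReal_mul, smul_add, smul_smul]
  rw [mul_comm ε]

theorem cliffordSusp_mul (hL : IsCliffordMap L) {ε : ℂ} (hε : ε ^ 2 = -1) (y : Fin (d + 2) → ℝ) :
    cliffordSusp L ε y * cliffordSusp L (-ε) y =
      ((∑ i, y i ^ 2 : ℝ) : ℂ) • (1 : Matrix ι ι ℂ) := by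
  have h := hL.mul_self (Fin.init y)
  rw [cliffordSusp, cliffordSusp, Fin.sum_univ_castSucc]
  have h2 : ∑ i : Fin (d + 1), y i.castSucc ^ 2 = ∑ i, (Fin.init y : Fin (d + 1) → ℝ) i ^ 2 := rfl
  rw [h2]
  simp only [add_mul, mul_add, Matrix.smul_mul, Matrix.mul_smul, smul_smul, one_mul, mul_one, h,
    neg_smul, mul_neg]
  have h3 : -ε * ε = 1 := by rw [neg_mul, ← sq, hε, neg_neg]
  simp only [← mul_assoc, h3]
  push_cast
  match_scalars
  · linear_combination (-∑ i, ((Fin.init y : Fin (d + 1) → ℝ) i : ℂ) ^ 2) * hε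
  · ring

theorem step (hL : IsCliffordMap L) : IsCliffordMap (cliffordStep L) where
  continuous := by
    have h := fun ε => (hL.continuous_cliffordSusp ε).comp (continuous_init (m := d + 2))
    have h' : Continuous fun z : Fin (d + 3) → ℝ => ((z (Fin.last _) : ℂ) • (1 : Matrix ι ι ℂ)) :=
      (Complex.continuous_ofReal.comp (continuous_apply _)).smul continuous_const
    exact Continuous.matrix_fromBlocks h' (h _) (h _) h'.neg
  smul c z := by
    have : (Fin.init (c • z) : Fin (d + 2) → ℝ) = c • Fin.init z := rfl
    rw [cliffordStep, cliffordStep, this, hL.cliffordSusp_smul, hL.cliffordSusp_smul]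
    simp only [Matrix.fromBlocks_smul, Pi.smul_apply, smul_eq_mul, Complex.ofReal_mul, smul_smul,
      smul_neg]
  mul_self z := by
    have h1 := hL.cliffordSusp_mul Complex.I_sq (Fin.init z)
    have h2 := hL.cliffordSusp_mul (ε := -Complex.I) (by simp) (Fin.init z)
    have h3 : ∑ i, z i ^ 2 =
        ∑ i : Fin (d + 2), (Fin.init z : Fin (d + 2) → ℝ) i ^ 2 + z (Fin.last _) ^ 2 := by
      rw [Fin.sum_univ_castSucc]; rfl
    rw [neg_neg] at h2
    rw [cliffordStep, h3, Matrix.fromBlocks_multiply, h1, h2, ← Matrix.fromBlocks_one,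
      Matrix.fromBlocks_smul]
    simp only [Matrix.smul_mul, Matrix.mul_smul, one_mul, mul_one, mul_neg, neg_mul, neg_neg,
      smul_smul, smul_zero, smul_neg]
    congr 1 <;> push_cast <;> module

theorem stablyTrivial_of_step (hL : IsCliffordMap L) (h : StablyTrivial (cliffordProj (cliffordStep L))) :
    StablyTrivial (cliffordProj L) := by
  have hpi : ∀ t : ℝ, Real.pi * t = 2 * (Real.pi / 2 * t) := fun t => by ring
  have h1 := StablyTrivial.stablyConst_of_clutching
    (γ := fun y : Sph (d + 1) => cliffordSusp L Complex.I fun i => y.1 i)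
    (γ' := fun y : Sph (d + 1) => cliffordSusp L (-Complex.I) fun i => y.1 i)
    ((hL.continuous_cliffordSusp _).comp (by fun_prop))
    ((hL.continuous_cliffordSusp _).comp (by fun_prop))
    (fun y => by rw [hL.cliffordSusp_mul Complex.I_sq, Sph_sum_sq]; simp)
    (fun y s => by
      have : (Fin.init (fun i => (suspMap (d + 1) (y, s)).1 i) : Fin (d + 2) → ℝ) =
          Real.sin (Real.pi * s) • fun i => y.1 i := by
        ext i; simp [Fin.init]
      rw [cliffordProj, cliffordStep, this, hL.cliffordSusp_smul, hL.cliffordSusp_smul,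
        suspMap_last, ← Matrix.fromBlocks_one, Matrix.fromBlocks_add, Matrix.fromBlocks_smul, hpi,
        Real.sin_two_mul]
      congr 1
      · rw [Real.cos_two_mul]; push_cast; module
      · push_cast; module
      · push_cast; module
      · rw [Real.cos_two_mul, Real.cos_sq']; push_cast; module) h
  refine h1.stablyTrivial_of_susp hL.continuous_cliffordProj hL.cliffordProj_mul_self fun x t => ?_
  have : (Fin.init (fun i => (suspMap d (x, t)).1 i) : Fin (d + 1) → ℝ) =
      Real.sin (Real.pi * t) • fun i => x.1 i := by
    ext i; simp [Fin.init]
  rw [cliffordSusp, this, hL.smul, suspMap_last, cliffordProj]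
  have hc : (circ t : ℂ) = Complex.exp (Real.pi * (t : ℝ) * Complex.I) ^ 2 := by
    rw [circ, Circle.coe_exp, ← Complex.exp_nat_mul]
    congr 1; push_cast; ring
  have he : Complex.exp (Real.pi * (t : ℝ) * Complex.I) =
      (Real.cos (Real.pi * t) : ℂ) + (Real.sin (Real.pi * t) : ℂ) * Complex.I := by
    rw [Complex.exp_mul_I]; push_cast; rfl
  rw [hc, he]
  have hcs : (Real.cos (Real.pi * t) : ℂ) ^ 2 + (Real.sin (Real.pi * t) : ℂ) ^ 2 = 1 := by
    exact_mod_cast Real.cos_sq_add_sin_sq _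
  generalize (Real.cos (Real.pi * t) : ℂ) = c at *
  generalize (Real.sin (Real.pi * t) : ℂ) = s at *
  have hI := Complex.I_sq
  match_scalars
  · linear_combination (1 / 2) * hcs - (1 / 2) * s ^ 2 * hI
  · linear_combination (1 / 2) * s ^ 2 * hI - (1 / 2) * hcs

theorem copies (hL : IsCliffordMap L) (r : ℕ) : IsCliffordMap fun x => dup r (L x) where
  continuous := hL.continuous.dup r
  smul c x := by rw [hL.smul, dup_smul]
  mul_self x := by rw [← dup_mul, hL.mul_self, dup_smul, dup_one]

end IsCliffordMap

theorem cliffordProj_dup (L : (Fin (d + 1) → ℝ) → Matrix ι ι ℂ) (r : ℕ) (x : Sph d) :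
    cliffordProj (fun x => dup r (L x)) x = dup r (cliffordProj L x) := by
  rw [cliffordProj, cliffordProj, dup_smul, dup_add, dup_one]

theorem cliffordStep_dup (L : (Fin (d + 1) → ℝ) → Matrix ι ι ℂ) (r : ℕ) (z : Fin (d + 3) → ℝ) :
    cliffordStep (fun x => dup r (L x)) z = (dup r (cliffordStep L z)).submatrix
      (Equiv.sumProdDistrib ι ι (Fin r)).symm (Equiv.sumProdDistrib ι ι (Fin r)).symm := by
  ext (⟨i, a⟩ | ⟨i, a⟩) (⟨j, b⟩ | ⟨j, b⟩) <;>
  by_cases hab : a = b <;>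
  simp [cliffordStep, cliffordSusp, dup, Matrix.blockDiagonal_apply, Matrix.one_apply, hab]

end Clifford

section CliffordInduction

variable {ι : Type} [Fintype ι] [DecidableEq ι] {d : ℕ}

theorem dup_idem {p : Matrix ι ι ℂ} (hp : p * p = p) (r : ℕ) : dup r p * dup r p = dup r p := by
  rw [← dup_mul, hp]

theorem IsCliffordMap.stablyTrivial_dup_of_step {L : (Fin (d + 1) → ℝ) → Matrix ι ι ℂ}
    (hL : IsCliffordMap L) {r : ℕ} (h : StablyTrivial fun x => dup r (cliffordProj (cliffordStep L) x)) :
    StablyTrivial fun x => dup r (cliffordProj L x) := by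
  have h1 := (hL.copies r).stablyTrivial_of_step ?_
  · simpa only [← cliffordProj_dup] using h1
  · have h2 := MvN.reindex (Equiv.sumProdDistrib ι ι (Fin r)).symm
        (hL.step.continuous_cliffordProj.dup r)
        fun x => dup_idem (hL.step.cliffordProj_mul_self x) r
    refine StablyTrivial.of_mvN (hL.copies r).step.cliffordProj_mul_self ?_ h
    convert h2.symm using 2 with x
    rw [cliffordProj, cliffordStep_dup, cliffordProj, dup_smul, dup_add, dup_one]
    simp only [Matrix.submatrix_smul, Matrix.submatrix_add, Matrix.submatrix_one_equiv, Pi.smul_apply,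
      Pi.add_apply]

theorem cliffordSusp_conjTranspose {L : (Fin (d + 1) → ℝ) → Matrix ι ι ℂ} (hL : ∀ x, (L x)ᴴ = L x)
    (ε : ℂ) (y : Fin (d + 2) → ℝ) : (cliffordSusp L ε y)ᴴ = cliffordSusp L (star ε) y := by
  simp [cliffordSusp, Matrix.conjTranspose_add, Matrix.conjTranspose_smul, hL]

theorem cliffordStep_conjTranspose {L : (Fin (d + 1) → ℝ) → Matrix ι ι ℂ} (hL : ∀ x, (L x)ᴴ = L x)
    (z : Fin (d + 3) → ℝ) : (cliffordStep L z)ᴴ = cliffordStep L z := by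
  simp [cliffordStep, Matrix.fromBlocks_conjTranspose, cliffordSusp_conjTranspose hL,
    Matrix.conjTranspose_smul]

theorem cliffordSusp_transpose {L : (Fin (d + 1) → ℝ) → Matrix ι ι ℂ} {C C' : Matrix ι ι ℂ}
    (hC : C' * C = 1) {s : ℂ} (hL : ∀ x, (L x)ᵀ = s • (C' * L x * C)) (ε : ℂ)
    (y : Fin (d + 2) → ℝ) : (cliffordSusp L ε y)ᵀ = C' * cliffordSusp L (s * ε) y * C := by
  simp only [cliffordSusp, Matrix.transpose_add, Matrix.transpose_smul, hL, Matrix.transpose_one,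
    mul_add, add_mul, Matrix.mul_smul, Matrix.smul_mul, mul_one, hC, smul_smul, mul_comm s]

theorem cliffordStep_transpose {L : (Fin (d + 1) → ℝ) → Matrix ι ι ℂ} {C C' : Matrix ι ι ℂ}
    (hC : C' * C = 1) {s : ℂ} (hs : s = 1 ∨ s = -1) (hL : ∀ x, (L x)ᵀ = s • (C' * L x * C)) :
    ∃ D D' : Matrix (ι ⊕ ι) (ι ⊕ ι) ℂ, D' * D = 1 ∧
      ∀ z, (cliffordStep L z)ᵀ = (-s) • (D' * cliffordStep L z * D) := by
  rcases hs with rfl | rfl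
  · refine ⟨Matrix.fromBlocks 0 1 (-1) 0 * (C ⊞ₘ C), (C' ⊞ₘ C') * Matrix.fromBlocks 0 (-1) 1 0,
      ?_, fun z => ?_⟩
    · simp [Matrix.fromBlocks_multiply, hC]
    · simp [cliffordStep, Matrix.fromBlocks_transpose, cliffordSusp_transpose hC hL,
        Matrix.fromBlocks_multiply, hC, Matrix.fromBlocks_neg]
  · refine ⟨C ⊞ₘ C, C' ⊞ₘ C', ?_, fun z => ?_⟩
    · simp [Matrix.fromBlocks_multiply, hC]
    · simp [cliffordStep, Matrix.fromBlocks_transpose, cliffordSusp_transpose hC hL,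
        Matrix.fromBlocks_multiply, hC, Matrix.fromBlocks_neg]

theorem exists_cliffordMap (j : ℕ) :
    ∃ (ι : Type) (_ : Fintype ι) (_ : DecidableEq ι) (L : (Fin (2 * j + 1) → ℝ) → Matrix ι ι ℂ)
      (C C' : Matrix ι ι ℂ), IsCliffordMap L ∧ (∀ x, (L x)ᴴ = L x) ∧ C' * C = 1 ∧
      (∀ x, (L x)ᵀ = (-1 : ℂ) ^ j • (C' * L x * C)) ∧
      ∀ r, StablyTrivial (fun x : Sph (2 * j) => dup r (cliffordProj L x)) → r = 0 := by
  induction j with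
  | zero =>
    refine ⟨Unit, inferInstance, inferInstance, fun x => (x 0 : ℂ) • 1, 1, 1, ⟨?_, ?_, ?_⟩, ?_, ?_,
      ?_, ?_⟩
    · exact (Complex.continuous_ofReal.comp (continuous_apply _)).smul continuous_const
    · intro c x; simp only [smul_smul, Pi.smul_apply, smul_eq_mul, Complex.ofReal_mul]
    · intro x
      rw [Matrix.smul_mul, Matrix.one_mul, smul_smul]
      simp only [Nat.mul_zero, Nat.reduceAdd, Finset.univ_unique, Finset.sum_singleton]
      rw [← Complex.ofReal_mul, sq]
      rfl
    · intro x; simp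
    · simp
    · intro x; simp
    · rintro r ⟨N, M, V, W, hV, hW, hVW, hWV⟩
      simp only at hVW hWV
      have key : ∀ x, (dup r (cliffordProj (d := 0) (fun x => (x 0 : ℂ) • (1 : Matrix Unit Unit ℂ)) x)).trace + N =
          M := fun x => by
        have h1 := congrArg Matrix.trace (hVW x)
        rw [Matrix.trace_mul_comm, hWV] at h1
        simpa [Matrix.trace] using h1.symm
      have hy : ∀ s : ℝ, s ^ 2 = 1 → ∃ y : Sph 0, y.1 0 = s := fun s hs =>
        ⟨⟨WithLp.toLp 2 fun _ => s, by rw [mem_Sph_iff]; simp [hs]⟩, rfl⟩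
      obtain ⟨a, ha⟩ := hy 1 (by norm_num)
      obtain ⟨b, hb⟩ := hy (-1) (by norm_num)
      have h1 := (key a).trans (key b).symm
      rw [cliffordProj, cliffordProj] at h1
      simp only at h1
      rw [ha, hb] at h1
      have h2 : (1 / 2 : ℂ) • ((1 : Matrix Unit Unit ℂ) + (((-1 : ℝ) : ℂ)) • 1) = 0 := by simp
      have h3 : (1 / 2 : ℂ) • ((1 : Matrix Unit Unit ℂ) + (((1 : ℝ) : ℂ)) • 1) = 1 := by
        push_cast; module
      rw [h2, h3] at h1
      simpa [dup, Matrix.trace, Matrix.blockDiagonal_apply] using h1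
  | succ j ih =>
    obtain ⟨ι, _, _, L, C, C', hL, hh, hC, ht, hr⟩ := ih
    obtain ⟨D, D', hD, ht'⟩ := cliffordStep_transpose hC (neg_one_pow_eq_or ℂ j) ht
    refine ⟨ι ⊕ ι, inferInstance, inferInstance, cliffordStep L, D, D', hL.step,
      cliffordStep_conjTranspose hh, hD, fun x => ?_, fun r h => ?_⟩
    · rw [pow_succ, mul_neg_one]
      exact ht' x
    · exact hr r (hL.stablyTrivial_dup_of_step h)

end CliffordInduction

/-! ### Idempotents of infinite order -/

section InfiniteOrder

variable {X ι κ : Type} [TopologicalSpace X] [Fintype ι] [DecidableEq ι] [Fintype κ] [DecidableEq κ]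

/-- No positive number of copies of `p` is stably trivial. -/
def InfiniteOrder (p : X → Matrix ι ι ℂ) : Prop :=
  ∀ r, StablyTrivial (fun x => dup r (p x)) → r = 0

theorem Continuous.dup_rect {V : X → Matrix ι κ ℂ} (hV : Continuous V) (r : ℕ) :
    Continuous fun x => Matrix.blockDiagonal fun _ : Fin r => V x :=
  Continuous.matrix_blockDiagonal (continuous_pi fun _ => hV)

theorem MvN.copies {p : X → Matrix ι ι ℂ} {q : X → Matrix κ κ ℂ} (h : MvN p q) (r : ℕ) :
    MvN (fun x => dup r (p x)) fun x => dup r (q x) := by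
  obtain ⟨V, W, hV, hW, h1, h2⟩ := h
  refine ⟨_, _, hV.dup_rect r, hW.dup_rect r, fun x => ?_, fun x => ?_⟩
  · rw [← Matrix.blockDiagonal_mul, h1]; rfl
  · rw [← Matrix.blockDiagonal_mul, h2]; rfl

theorem dup_blockSum (A : Matrix ι ι ℂ) (B : Matrix κ κ ℂ) (r : ℕ) :
    (dup r (A ⊞ₘ B)).submatrix (Equiv.sumProdDistrib ι κ (Fin r)).symm
      (Equiv.sumProdDistrib ι κ (Fin r)).symm = dup r A ⊞ₘ dup r B := by
  ext (⟨i, a⟩ | ⟨i, a⟩) (⟨j, b⟩ | ⟨j, b⟩) <;>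
  by_cases hab : a = b <;>
  simp [_root_.dup, Matrix.blockDiagonal_apply, hab]

theorem MvN.dup_blockSum {p : X → Matrix ι ι ℂ} {q : X → Matrix κ κ ℂ} (hpc : Continuous p)
    (hp : ∀ x, p x * p x = p x) (hqc : Continuous q) (hq : ∀ x, q x * q x = q x) (r : ℕ) :
    MvN (fun x => dup r (p x ⊞ₘ q x)) fun x => dup r (p x) ⊞ₘ dup r (q x) := by
  have := MvN.reindex (p := fun x => _root_.dup r (p x ⊞ₘ q x))
    (Equiv.sumProdDistrib ι κ (Fin r)).symm
    (Continuous.dup (by fun_prop) r) fun x => dup_idem (by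
      simp [Matrix.fromBlocks_multiply, hp, hq]) r
  simpa only [_root_.dup_blockSum] using this

theorem dup_add_index (A : Matrix ι ι ℂ) (r s : ℕ) :
    (dup (r + s) A).submatrix
      (((Equiv.prodSumDistrib ι (Fin r) (Fin s)).symm.trans
        (Equiv.prodCongr (Equiv.refl ι) finSumFinEquiv)))
      (((Equiv.prodSumDistrib ι (Fin r) (Fin s)).symm.trans
        (Equiv.prodCongr (Equiv.refl ι) finSumFinEquiv))) = dup r A ⊞ₘ dup s A := by
  ext (⟨i, a⟩ | ⟨i, a⟩) (⟨j, b⟩ | ⟨j, b⟩) <;>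
  simp [dup, Matrix.blockDiagonal_apply, Fin.ext_iff]
  · intro h; exact absurd h (by omega)
  · intro h; exact absurd h (by omega)

theorem MvN.dup_add {p : X → Matrix ι ι ℂ} (hpc : Continuous p) (hp : ∀ x, p x * p x = p x)
    (r s : ℕ) : MvN (fun x => dup (r + s) (p x)) fun x => dup r (p x) ⊞ₘ dup s (p x) := by
  have := MvN.reindex (p := fun x => _root_.dup (r + s) (p x))
    (((Equiv.prodSumDistrib ι (Fin r) (Fin s)).symm.trans
        (Equiv.prodCongr (Equiv.refl ι) finSumFinEquiv))) (hpc.dup _) fun x => dup_idem (hp x) _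
  simpa only [dup_add_index] using this

theorem StablyTrivial.blockSum_const {p : X → Matrix ι ι ℂ} (hpc : Continuous p)
    (hp : ∀ x, p x * p x = p x) (h : StablyTrivial p) {e : Matrix κ κ ℂ} (he : e * e = e) :
    StablyTrivial fun x => p x ⊞ₘ e := by
  obtain ⟨N, M, h⟩ := h
  have hi : ∀ x, (p x ⊞ₘ e) * (p x ⊞ₘ e) = p x ⊞ₘ e := fun x => by
    simp [Matrix.fromBlocks_multiply, hp, he]
  have h1 : MvN (fun x => (p x ⊞ₘ (1 : Matrix (Fin N) (Fin N) ℂ)) ⊞ₘ e)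
      fun _ => (1 : Matrix (Fin M) (Fin M) ℂ) ⊞ₘ e :=
    h.blockSum (MvN.refl continuous_const fun _ => he)
  have h2 := MvN.assoc (X := X) (p := p) (q := fun _ => (1 : Matrix (Fin N) (Fin N) ℂ))
    (r := fun _ => e) hpc hp continuous_const (by simp) continuous_const (by simp [he])
  have h3 := MvN.assoc (X := X) (p := p) (q := fun _ => e)
    (r := fun _ => (1 : Matrix (Fin N) (Fin N) ℂ)) hpc hp continuous_const (by simp [he])
    continuous_const (by simp)
  have h4 := (MvN.refl hpc hp).blockSum (MvN.comm (X := X) (p := fun _ => e)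
    (q := fun _ => (1 : Matrix (Fin N) (Fin N) ℂ)) continuous_const (by simp [he])
    continuous_const (by simp))
  refine stablyTrivial_of_const hi (1 : Matrix (Fin N) (Fin N) ℂ) (by simp)
    ((1 : Matrix (Fin M) (Fin M) ℂ) ⊞ₘ e) (by simp [Matrix.fromBlocks_multiply, he]) ?_
  refine ((h3.trans h4 ?_ ?_).trans h2.symm ?_ ?_).trans h1 ?_ ?_ <;>
    simp [Matrix.fromBlocks_multiply, hp, he]

namespace InfiniteOrder

variable {p : X → Matrix ι ι ℂ} {q : X → Matrix κ κ ℂ}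

theorem of_mvN (h : InfiniteOrder p) (hp : ∀ x, p x * p x = p x) (hpq : MvN p q) :
    InfiniteOrder q := fun r hr =>
  h r (StablyTrivial.of_mvN (fun x => dup_idem (hp x) r) (hpq.copies r) hr)

theorem blockSum_const (h : InfiniteOrder p) (hpc : Continuous p) (hp : ∀ x, p x * p x = p x)
    {e : Matrix κ κ ℂ} (he : e * e = e) : InfiniteOrder fun x => p x ⊞ₘ e := fun r hr =>
  h r (StablyTrivial.of_blockSum (hpc.dup r) (fun x => dup_idem (hp x) r) (dup r e) (dup_idem he r)
    (StablyTrivial.of_mvN (by simp [Matrix.fromBlocks_multiply, dup_idem, hp, he])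
      (MvN.dup_blockSum hpc hp continuous_const (fun _ => he) r).symm hr))

theorem of_blockSum_const (hpc : Continuous p) (hp : ∀ x, p x * p x = p x) {e : Matrix κ κ ℂ}
    (he : e * e = e) (h : InfiniteOrder fun x => p x ⊞ₘ e) : InfiniteOrder p := fun r hr =>
  h r (StablyTrivial.of_mvN (fun x => dup_idem (by simp [Matrix.fromBlocks_multiply, hp, he]) r)
    (MvN.dup_blockSum hpc hp continuous_const (fun _ => he) r)
    (StablyTrivial.blockSum_const (hpc.dup r) (fun x => dup_idem (hp x) r) hr (dup_idem he r)))

theorem double (h : InfiniteOrder p) (hpc : Continuous p) (hp : ∀ x, p x * p x = p x) :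
    InfiniteOrder fun x => p x ⊞ₘ p x := fun r hr => by
  have := h (r + r) (StablyTrivial.of_mvN (fun x => dup_idem (hp x) _)
    ((MvN.dup_add hpc hp r r).trans (MvN.dup_blockSum hpc hp hpc hp r).symm
      (fun x => dup_idem (hp x) _)
      fun x => dup_idem (by simp [Matrix.fromBlocks_multiply, hp]) r) hr)
  omega

end InfiniteOrder

end InfiniteOrder

/-! ### Families of orthogonal complex structures of infinite order -/

section ComplexStructures

variable {ι κ ν : Type} [Fintype ι] [DecidableEq ι] [Fintype κ] [DecidableEq κ]
  [Fintype ν] [DecidableEq ν] {d : ℕ}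

/-- A family of orthogonal complex structures over a sphere whose eigenbundle has infinite
order. -/
structure IsInfiniteFamily (F : Sph d → Matrix κ κ ℝ) : Prop where
  continuous : Continuous F
  transpose_mul : ∀ x, (F x)ᵀ * F x = 1
  mul_self : ∀ x, F x * F x = -1
  infiniteOrder : InfiniteOrder fun x => eigProj (F x)

theorem eigProj_conj {Q Q' J : Matrix ι ι ℝ} (h : Q * Q' = 1) :
    eigProj (Q * J * Q') = cpx Q * eigProj J * cpx Q' := by
  have h' : cpx Q * cpx Q' = 1 := by rw [← cpx_mul, h, cpx_one]
  simp only [eigProj, cpx_mul, Matrix.mul_smul, Matrix.smul_mul, Matrix.mul_sub, Matrix.sub_mul,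
    Matrix.mul_one, h']

theorem eigProj_blockSum (A : Matrix ι ι ℝ) (B : Matrix κ κ ℝ) :
    eigProj (A ⊞ₘ B) = eigProj A ⊞ₘ eigProj B := by
  ext (i | i) (j | j) <;> simp [eigProj, cpx, Matrix.one_apply]

theorem eigProj_submatrix (A : Matrix ι ι ℝ) (e : κ ≃ ι) :
    eigProj (A.submatrix e e) = (eigProj A).submatrix e e := by
  ext i j
  simp [eigProj, cpx, Matrix.one_apply]

namespace IsInfiniteFamily

variable {F : Sph d → Matrix κ κ ℝ}

theorem conj (h : IsInfiniteFamily F) {Q : Sph d → Matrix κ κ ℝ} (hQ : Continuous Q)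
    (hQo : ∀ x, (Q x)ᵀ * Q x = 1) : IsInfiniteFamily fun x => Q x * F x * (Q x)ᵀ := by
  have hF := h.continuous
  have hQo' : ∀ x, Q x * (Q x)ᵀ = 1 := fun x => mul_eq_one_comm.1 (hQo x)
  refine ⟨by fun_prop, fun x => ?_, fun x => ?_, ?_⟩
  · simp only [Matrix.transpose_mul, Matrix.transpose_transpose]
    calc Q x * ((F x)ᵀ * (Q x)ᵀ) * (Q x * F x * (Q x)ᵀ)
        = Q x * ((F x)ᵀ * ((Q x)ᵀ * Q x) * F x) * (Q x)ᵀ := by simp only [Matrix.mul_assoc]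
      _ = 1 := by rw [hQo, Matrix.mul_one, h.transpose_mul, Matrix.mul_one, hQo']
  · calc Q x * F x * (Q x)ᵀ * (Q x * F x * (Q x)ᵀ)
        = Q x * (F x * ((Q x)ᵀ * Q x) * F x) * (Q x)ᵀ := by simp only [Matrix.mul_assoc]
      _ = -1 := by
        rw [hQo, Matrix.mul_one, h.mul_self, Matrix.mul_neg, Matrix.mul_one, Matrix.neg_mul, hQo']
  · have hc : Continuous fun x => eigProj (F x) := continuous_eigProj.comp hF
    have hi : ∀ x, eigProj (F x) * eigProj (F x) = eigProj (F x) := fun x =>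
      eigProj_mul_self (h.mul_self x)
    have := MvN.conj (V := fun x => cpx (Q x)) (W := fun x => cpx (Q x)ᵀ)
      (continuous_cpx.comp hQ) (continuous_cpx.comp (by fun_prop))
      (fun x => by rw [← cpx_mul, hQo', cpx_one]) hc hi
    simp only [eigProj_conj (hQo' _)]
    exact h.infiniteOrder.of_mvN hi (this.symm)

theorem submatrix (h : IsInfiniteFamily F) (e : ι ≃ κ) :
    IsInfiniteFamily fun x => (F x).submatrix e e := by
  refine ⟨h.continuous.matrix_submatrix _ _, fun x => ?_, fun x => ?_, ?_⟩
  · rw [Matrix.transpose_submatrix, Matrix.submatrix_mul_equiv, h.transpose_mul]; simp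
  · rw [Matrix.submatrix_mul_equiv, h.mul_self]; ext; simp [Matrix.one_apply]
  · have hc : Continuous fun x => eigProj (F x) := continuous_eigProj.comp h.continuous
    have hi : ∀ x, eigProj (F x) * eigProj (F x) = eigProj (F x) := fun x =>
      eigProj_mul_self (h.mul_self x)
    simp only [eigProj_submatrix]
    exact h.infiniteOrder.of_mvN hi (MvN.reindex e hc hi)

theorem blockSum_const (h : IsInfiniteFamily F) {J : Matrix ι ι ℝ} (h1 : Jᵀ * J = 1)
    (h2 : J * J = -1) : IsInfiniteFamily fun x => F x ⊞ₘ J := by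
  have hF := h.continuous
  refine ⟨by fun_prop, fun x => ?_, fun x => ?_, ?_⟩
  · simp [Matrix.fromBlocks_transpose, Matrix.fromBlocks_multiply, h.transpose_mul, h1]
  · simp only [Matrix.fromBlocks_multiply, h.mul_self, h2]
    simp [← Matrix.fromBlocks_one, Matrix.fromBlocks_neg]
  · simp only [eigProj_blockSum]
    exact h.infiniteOrder.blockSum_const (continuous_eigProj.comp hF)
      (fun x => eigProj_mul_self (h.mul_self x)) (eigProj_mul_self h2)

theorem of_blockSum_const {J : Matrix ι ι ℝ} (h : IsInfiniteFamily fun x => F x ⊞ₘ J) :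
    IsInfiniteFamily F := by
  have hF : Continuous F := continuous_matrix fun i j =>
    (h.continuous.matrix_elem (Sum.inl i) (Sum.inl j))
  have h1 : ∀ x, (F x)ᵀ * F x = 1 ∧ Jᵀ * J = 1 := fun x => by
    have := h.transpose_mul x
    simp only [Matrix.fromBlocks_transpose, Matrix.fromBlocks_multiply, Matrix.transpose_zero,
      ← Matrix.fromBlocks_one, Matrix.fromBlocks_inj] at this
    simpa using this
  have h2 : ∀ x, F x * F x = -1 ∧ J * J = -1 := fun x => by
    have := h.mul_self x
    simp only [Matrix.fromBlocks_neg, Matrix.fromBlocks_multiply,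
      ← Matrix.fromBlocks_one, Matrix.fromBlocks_inj] at this
    simpa using this
  refine ⟨hF, fun x => (h1 x).1, fun x => (h2 x).1, ?_⟩
  refine InfiniteOrder.of_blockSum_const (continuous_eigProj.comp hF)
      (fun x => eigProj_mul_self (h2 x).1) (eigProj_mul_self (h2 (northPole d)).2) (κ := ι) ?_
  simpa only [eigProj_blockSum] using h.infiniteOrder

end IsInfiniteFamily

/-- Over a sphere of small dimension, a family of orthogonal complex structures of infinite
order can be split down by two real dimensions. -/
theorem IsInfiniteFamily.exists_compression {F : Sph d → Matrix (Unit ⊕ (Unit ⊕ ν)) _ ℝ}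
    (h : IsInfiniteFamily F) (hd : d + 1 < Fintype.card ν) :
    ∃ G : Sph d → Matrix ν ν ℝ, IsInfiniteFamily G := by
  have hF := h.continuous
  have hskew : ∀ x, (F x)ᵀ = -F x := fun x =>
    transpose_eq_neg_of_mem (h.transpose_mul x) (h.mul_self x)
  have h00 : ∀ x, F x (Sum.inl ()) (Sum.inl ()) = 0 := fun x => by
    have := congrFun (congrFun (hskew x) (Sum.inl ())) (Sum.inl ())
    simp only [Matrix.transpose_apply, Matrix.neg_apply] at this
    linarith
  obtain ⟨U, hU, hUo, hUe⟩ := exists_unitary_frame (𝕜 := ℝ)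
    (s := fun x (i : Unit ⊕ ν) => F x (Sum.inr i) (Sum.inl ())) (by fun_prop)
    (fun x => by
      have := congrFun (congrFun (h.transpose_mul x) (Sum.inl ())) (Sum.inl ())
      simp only [Matrix.mul_apply, Fintype.sum_sum_type, Matrix.transpose_apply, h00] at this
      simpa [dotProduct] using this)
    (by simp; omega) (e := Pi.single (Sum.inl ()) 1) (by simp)
  have hUo' : ∀ x, (U x)ᵀ * U x = 1 := fun x => by
    simpa [Matrix.conjTranspose_eq_transpose_of_trivial] using hUo x
  obtain ⟨Q, hQ⟩ : ∃ Q, Q = fun x => (1 : Matrix Unit Unit ℝ) ⊞ₘ U x := ⟨_, rfl⟩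
  have hH := h.conj (Q := Q) (by rw [hQ]; fun_prop) (fun x => by
    simp [hQ, Matrix.fromBlocks_transpose, Matrix.fromBlocks_multiply, hUo'])
  obtain ⟨H, hHdef⟩ : ∃ H, H = fun x => Q x * F x * (Q x)ᵀ := ⟨_, rfl⟩
  rw [← hHdef] at hH
  have hHskew : ∀ x i j, H x i j = - H x j i := fun x i j => by
    have := transpose_eq_neg_of_mem (hH.transpose_mul x) (hH.mul_self x)
    simpa using congrFun (congrFun this j) i
  have hHll : ∀ x, H x (Sum.inl ()) (Sum.inl ()) = 0 := fun x => by
    have := hHskew x (Sum.inl ()) (Sum.inl ())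
    linarith
  have hHrl : ∀ x i, H x (Sum.inr i) (Sum.inl ()) = (Pi.single (Sum.inl ()) 1 : Unit ⊕ ν → ℝ) i :=
      fun x i => by
    rw [← hUe x, hHdef, hQ]
    simp [Matrix.mul_apply, Fintype.sum_sum_type, Matrix.mulVec, dotProduct]
  have hHr : ∀ x i, H x (Sum.inr i) (Sum.inr (Sum.inl ())) = 0 := fun x i => by
    have := congrFun (congrFun (hH.mul_self x) (Sum.inr i)) (Sum.inl ())
    simpa [Matrix.mul_apply, Fintype.sum_sum_type, hHrl, hHll] using this
  have hHr' : ∀ x i, H x (Sum.inr (Sum.inl ())) (Sum.inr i) = 0 := fun x i => by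
    rw [hHskew, hHr, neg_zero]
  have hHlr : ∀ x i, H x (Sum.inl ()) (Sum.inr i) = -(Pi.single (Sum.inl ()) 1 : Unit ⊕ ν → ℝ) i :=
    fun x i => by rw [hHskew, hHrl]
  let e : ν ⊕ (Unit ⊕ Unit) ≃ Unit ⊕ (Unit ⊕ ν) :=
    (Equiv.sumComm _ _).trans (Equiv.sumAssoc _ _ _)
  refine ⟨fun x => (H x).submatrix (fun i => Sum.inr (Sum.inr i)) fun i => Sum.inr (Sum.inr i),
    IsInfiniteFamily.of_blockSum_const
      (J := (Matrix.fromBlocks 0 (-1) 1 0 : Matrix (Unit ⊕ Unit) (Unit ⊕ Unit) ℝ)) ?_⟩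
  convert hH.submatrix e using 2 with x
  ext (i | i | i) (j | j | j) <;> simp [e, hHll, hHr, hHr', hHlr, hHrl]

section Clifford

variable (L : Matrix ι ι ℂ)

/-- The real form of multiplication by `i L`. -/
def realForm : Matrix (ι ⊕ ι) (ι ⊕ ι) ℝ :=
  Matrix.fromBlocks (-L.map Complex.im) (-L.map Complex.re) (L.map Complex.re) (-L.map Complex.im)

/-- The matrix diagonalizing the complexification of `realForm`. -/
def realFormBasis (ι : Type) [DecidableEq ι] : Matrix (ι ⊕ ι) (ι ⊕ ι) ℂ :=
  Matrix.fromBlocks 1 1 ((-Complex.I) • 1) (Complex.I • 1)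

/-- The inverse of `realFormBasis`. -/
noncomputable def realFormBasisInv (ι : Type) [DecidableEq ι] : Matrix (ι ⊕ ι) (ι ⊕ ι) ℂ :=
  (1 / 2 : ℂ) • Matrix.fromBlocks 1 (Complex.I • 1) 1 ((-Complex.I) • 1)

theorem realFormBasisInv_mul : realFormBasisInv ι * realFormBasis ι = 1 := by
  ext (i | i) (j | j) <;>
  simp [realFormBasis, realFormBasisInv, Matrix.fromBlocks_multiply, smul_smul,
    Matrix.one_apply] <;>
  split_ifs <;> norm_num

theorem realFormBasis_mul_inv : realFormBasis ι * realFormBasisInv ι = 1 :=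
  mul_eq_one_comm.1 realFormBasisInv_mul

variable {L}

theorem cpx_realForm_mul (hL : Lᴴ = L) :
    cpx (realForm L) * realFormBasis ι =
      realFormBasis ι * ((Complex.I • L) ⊞ₘ ((-Complex.I) • Lᵀ)) := by
  have hij : ∀ i j, L j i = (starRingEnd ℂ) (L i j) := fun i j => by
    have := congrFun (congrFun hL j) i
    simpa using this.symm
  have h : cpx (realForm L) = Matrix.fromBlocks (-cpx (L.map Complex.im))
      (-cpx (L.map Complex.re)) (cpx (L.map Complex.re)) (-cpx (L.map Complex.im)) := by
    ext (i | i) (j | j) <;> simp [cpx, realForm]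
  rw [h, realFormBasis, Matrix.fromBlocks_multiply, Matrix.fromBlocks_multiply]
  simp only [Matrix.mul_one, Matrix.mul_smul, Matrix.one_mul, Matrix.smul_mul, Matrix.mul_zero,
    add_zero, zero_add, smul_zero]
  congr 1 <;> ext i j <;> apply Complex.ext <;> simp [cpx, hij i j]

theorem eigProj_realForm (hL : Lᴴ = L) :
    eigProj (realForm L) = realFormBasis ι *
      (((1 / 2 : ℂ) • (1 + L)) ⊞ₘ ((1 / 2 : ℂ) • (1 - Lᵀ))) * realFormBasisInv ι := by
  have h : cpx (realForm L) = realFormBasis ι *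
      ((Complex.I • L) ⊞ₘ ((-Complex.I) • Lᵀ)) * realFormBasisInv ι := by
    rw [← cpx_realForm_mul hL, Matrix.mul_assoc, realFormBasis_mul_inv, Matrix.mul_one]
  have h' : (((1 / 2 : ℂ) • (1 + L)) ⊞ₘ ((1 / 2 : ℂ) • (1 - Lᵀ))) =
      (1 / 2 : ℂ) • (1 - Complex.I • ((Complex.I • L) ⊞ₘ ((-Complex.I) • Lᵀ))) := by
    ext (i | i) (j | j) <;> simp [Matrix.one_apply, ← mul_assoc]
    split_ifs <;> ring
  rw [h', eigProj, h]
  simp only [Matrix.mul_smul, Matrix.smul_mul, Matrix.mul_sub, Matrix.sub_mul, Matrix.mul_one,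
    realFormBasis_mul_inv]

theorem realForm_transpose (hL : Lᴴ = L) : (realForm L)ᵀ = -realForm L := by
  have hij : ∀ i j, L j i = (starRingEnd ℂ) (L i j) := fun i j => by
    have := congrFun (congrFun hL j) i
    simpa using this.symm
  ext (i | i) (j | j) <;> simp [realForm, hij i j]

theorem cpx_injective : Function.Injective (cpx : Matrix ι κ ℝ → Matrix ι κ ℂ) :=
  Matrix.map_injective Complex.ofReal_injective

theorem realForm_mul_self (hL : Lᴴ = L) (h1 : L * L = 1) : realForm L * realForm L = -1 := by
  have h : cpx (realForm L) = realFormBasis ι *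
      ((Complex.I • L) ⊞ₘ ((-Complex.I) • Lᵀ)) * realFormBasisInv ι := by
    rw [← cpx_realForm_mul hL, Matrix.mul_assoc, realFormBasis_mul_inv, Matrix.mul_one]
  have h2 : ((Complex.I • L) ⊞ₘ ((-Complex.I) • Lᵀ)) *
      ((Complex.I • L) ⊞ₘ ((-Complex.I) • Lᵀ)) = -1 := by
    rw [Matrix.fromBlocks_multiply]
    simp [smul_smul, h1, ← Matrix.transpose_mul, ← Matrix.fromBlocks_one, Matrix.fromBlocks_neg]
  apply cpx_injective
  rw [cpx_mul, h]
  calc _ = realFormBasis ι * ((Complex.I • L) ⊞ₘ ((-Complex.I) • Lᵀ)) *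
        (realFormBasisInv ι * realFormBasis ι) *
        ((Complex.I • L) ⊞ₘ ((-Complex.I) • Lᵀ)) * realFormBasisInv ι := by
        simp only [Matrix.mul_assoc]
    _ = realFormBasis ι * (((Complex.I • L) ⊞ₘ ((-Complex.I) • Lᵀ)) *
        ((Complex.I • L) ⊞ₘ ((-Complex.I) • Lᵀ))) * realFormBasisInv ι := by
        rw [realFormBasisInv_mul, Matrix.mul_one]; simp only [Matrix.mul_assoc]
    _ = _ := by
        rw [h2, Matrix.mul_neg, Matrix.mul_one, Matrix.neg_mul, realFormBasis_mul_inv]; simp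

end Clifford

theorem exists_isInfiniteFamily (k : ℕ) : ∃ (ι : Type) (_ : Fintype ι) (_ : DecidableEq ι)
    (F : Sph (2 * (2 * k + 1)) → Matrix (ι ⊕ ι) (ι ⊕ ι) ℝ), IsInfiniteFamily F := by
  obtain ⟨ι, _, _, L, C, C', hL, hLh, hC, hLt, hinf⟩ := exists_cliffordMap (2 * k + 1)
  have hLc := hL.continuous_sph
  have hpc : Continuous (cliffordProj L) := hL.continuous_cliffordProj
  have hp : ∀ x, cliffordProj L x * cliffordProj L x = cliffordProj L x :=
    hL.cliffordProj_mul_self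
  have hF : Continuous fun x : Sph (2 * (2 * k + 1)) => realForm (L fun i => x.1 i) := by
    have c1 := hLc.matrix_map Complex.continuous_re
    have c2 := hLc.matrix_map Complex.continuous_im
    exact Continuous.matrix_fromBlocks c2.neg c1.neg c1 c2.neg
  have hF2 : ∀ x : Sph (2 * (2 * k + 1)), realForm (L fun i => x.1 i) *
      realForm (L fun i => x.1 i) = -1 := fun x =>
    realForm_mul_self (hLh _) (hL.mul_self_sph x)
  refine ⟨ι, inferInstance, inferInstance, fun x => realForm (L fun i => x.1 i), hF, fun x => ?_,
    hF2, ?_⟩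
  · rw [realForm_transpose (hLh _), Matrix.neg_mul, hF2, neg_neg]
  have hC' : C * C' = 1 := mul_eq_one_comm.1 hC
  have key : ∀ x : Sph (2 * (2 * k + 1)), (1 / 2 : ℂ) • (1 - (L fun i => x.1 i)ᵀ) =
      C' * cliffordProj L x * C := fun x => by
    rw [hLt, cliffordProj, Odd.neg_one_pow ⟨k, rfl⟩]
    simp only [Matrix.mul_smul, Matrix.smul_mul, Matrix.mul_add, Matrix.add_mul, Matrix.mul_one,
      hC, neg_smul, one_smul, sub_neg_eq_add]
  have hconj := MvN.conj (V := fun _ => C') (W := fun _ => C) continuous_const continuous_const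
    (fun _ => hC) hpc hp
  have hci : ∀ x, C' * cliffordProj L x * C * (C' * cliffordProj L x * C) =
      C' * cliffordProj L x * C := fun x => by
    calc _ = C' * (cliffordProj L x * (C * C') * cliffordProj L x) * C := by
          simp only [Matrix.mul_assoc]
      _ = _ := by rw [hC', Matrix.mul_one, hp]
  have hsum := MvN.blockSum (MvN.refl hpc hp) hconj
  have hsumi : ∀ x, (cliffordProj L x ⊞ₘ (C' * cliffordProj L x * C)) *
      (cliffordProj L x ⊞ₘ (C' * cliffordProj L x * C)) =
      cliffordProj L x ⊞ₘ (C' * cliffordProj L x * C) := fun x => by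
    simp only [Matrix.fromBlocks_multiply, hp, hci]; simp
  have hbig := MvN.conj (V := fun _ => realFormBasis ι) (W := fun _ => realFormBasisInv ι)
    continuous_const continuous_const (fun _ => realFormBasis_mul_inv)
    (p := fun x => cliffordProj L x ⊞ₘ (C' * cliffordProj L x * C)) (by fun_prop) hsumi
  have hpp : ∀ x, (cliffordProj L x ⊞ₘ cliffordProj L x) *
      (cliffordProj L x ⊞ₘ cliffordProj L x) = cliffordProj L x ⊞ₘ cliffordProj L x := fun x => by
    simp [Matrix.fromBlocks_multiply, hp]
  have h0 : InfiniteOrder (cliffordProj L) := hinf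
  have h1 := (h0.double hpc hp).of_mvN hpp hsum.symm
  have h2 := h1.of_mvN hsumi hbig.symm
  simp only [eigProj_realForm (hLh _), key]
  exact h2

/-- In the stable range there is a family of orthogonal complex structures of infinite order. -/
theorem exists_infiniteOrder_complexStructure {n k : ℕ} (h : 4 * k + 2 ≤ 2 * n) :
    ∃ g : Sph (2 * (2 * k + 1)) → Matrix (Fin (n + 1) ⊕ Fin (n + 1)) (Fin (n + 1) ⊕ Fin (n + 1)) ℝ,
      IsInfiniteFamily g ∧ g (northPole _) = J0 (n + 1) := by
  have hdesc : ∀ m, (∃ G : Sph (2 * (2 * k + 1)) → Matrix (Fin (2 * m + (2 * n + 2))) _ ℝ,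
      IsInfiniteFamily G) →
      ∃ G : Sph (2 * (2 * k + 1)) → Matrix (Fin (2 * n + 2)) _ ℝ, IsInfiniteFamily G := by
    intro m
    induction m with
    | zero => rintro ⟨G, hG⟩; exact ⟨_, hG.submatrix (finCongr (by omega))⟩
    | succ m ih =>
      rintro ⟨G, hG⟩
      refine ih (IsInfiniteFamily.exists_compression (hG.submatrix (ι := Unit ⊕ (Unit ⊕
        Fin (2 * m + (2 * n + 2)))) (Fintype.equivOfCardEq ?_)) ?_)
      · simp; omega
      · simp; omega
  obtain ⟨ι, _, _, F, hF⟩ := exists_isInfiniteFamily k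
  have hJ := J0_mem (n + 1)
  obtain ⟨G, hG⟩ := hdesc (Fintype.card ι) ⟨_, (hF.blockSum_const hJ.1 hJ.2).submatrix
    (Fintype.equivOfCardEq (by simp; omega))⟩
  have hG' := hG.submatrix (ι := Fin (n + 1) ⊕ Fin (n + 1)) (Fintype.equivOfCardEq (by simp; omega))
  obtain ⟨g, hg⟩ : ∃ g : Sph (2 * (2 * k + 1)) →
      Matrix (Fin (n + 1) ⊕ Fin (n + 1)) (Fin (n + 1) ⊕ Fin (n + 1)) ℝ, IsInfiniteFamily g :=
    ⟨_, hG'⟩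
  obtain ⟨A, hA, hAo, hAe⟩ := exists_orthogonal_lift (n := n) (J := fun _ => g (northPole _))
    continuous_const fun _ => ⟨hg.transpose_mul _, hg.mul_self _⟩
  obtain ⟨Q, hQ⟩ : ∃ Q, Q = (A (northPole _))ᵀ := ⟨_, rfl⟩
  have hQo : A (northPole _) * (A (northPole _))ᵀ = 1 := mul_eq_one_comm.1 (hAo _)
  refine ⟨_, hg.conj (Q := fun _ => Q) continuous_const fun _ => ?_, ?_⟩
  · rw [hQ, Matrix.transpose_transpose, hQo]
  · rw [hQ, Matrix.transpose_transpose, Matrix.mul_assoc, ← hAe, ← Matrix.mul_assoc, hAo,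
      Matrix.one_mul]

end ComplexStructures

/-! ### The sphere as a quotient of the cube -/

section Collapse

variable {d : ℕ}

/-- The coordinates of the cube, rescaled to `[-1, 1]`. -/
def cubeVec (x : Fin d → I) : Fin d → ℝ := fun i => 2 * (x i : ℝ) - 1

theorem continuous_cubeVec : Continuous (cubeVec : (Fin d → I) → Fin d → ℝ) := by
  unfold cubeVec; fun_prop

theorem cubeVec_injective : Function.Injective (cubeVec : (Fin d → I) → Fin d → ℝ) :=
  fun x x' h => funext fun i => Subtype.ext (by
    have := congrFun h i
    simp only [cubeVec] at this
    linarith)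

theorem abs_cubeVec_le (x : Fin d → I) (i : Fin d) : |cubeVec x i| ≤ 1 := by
  have h0 := (x i).2.1
  have h1 := (x i).2.2
  rw [abs_le]; unfold cubeVec
  constructor <;> linarith

theorem norm_cubeVec_le (x : Fin d → I) : ‖cubeVec x‖ ≤ 1 :=
  (pi_norm_le_iff_of_nonneg zero_le_one).2 fun i => abs_cubeVec_le x i

theorem mem_boundary_iff_norm (x : Fin d → I) :
    x ∈ Cube.boundary (Fin d) ↔ ‖cubeVec x‖ = 1 := by
  have key : ∀ i, (x i = 0 ∨ x i = 1) ↔ |cubeVec x i| = 1 := fun i => by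
    rw [abs_eq zero_le_one, Subtype.ext_iff, Subtype.ext_iff]
    simp only [cubeVec, Set.Icc.coe_zero, Set.Icc.coe_one]
    constructor
    · rintro (h | h)
      · right; rw [h]; norm_num
      · left; rw [h]; norm_num
    · rintro (h | h)
      · right; linarith
      · left; linarith
  constructor
  · rintro ⟨i, hi⟩
    refine le_antisymm (norm_cubeVec_le x) ?_
    rw [← (key i).1 hi]
    exact norm_le_pi_norm (cubeVec x) i
  · intro h
    by_contra hx
    have hlt : ∀ i, ‖cubeVec x i‖ < 1 := fun i =>
      lt_of_le_of_ne (abs_cubeVec_le x i) fun he => hx ⟨i, (key i).2 he⟩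
    exact absurd h ((pi_norm_lt_iff one_pos).2 hlt).ne

theorem cubeVec_surjective {v : Fin d → ℝ} (hv : ‖v‖ ≤ 1) : ∃ x, cubeVec x = v := by
  have h : ∀ i, |v i| ≤ 1 := fun i => (norm_le_pi_norm v i).trans hv
  refine ⟨fun i => ⟨(v i + 1) / 2, ?_, ?_⟩, ?_⟩
  · have := (abs_le.1 (h i)).1; linarith
  · have := (abs_le.1 (h i)).2; linarith
  · ext i; simp [cubeVec]; ring

/-- The denominator in the definition of `collapse`. -/
noncomputable def collapseDen (v : Fin d → ℝ) : ℝ := ∑ i, v i ^ 2 + (1 - ‖v‖) ^ 2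

theorem collapseDen_pos (v : Fin d → ℝ) : 0 < collapseDen v := by
  unfold collapseDen
  by_cases h : ‖v‖ = 1
  · have : v ≠ 0 := by rintro rfl; simp at h
    obtain ⟨i, hi⟩ := Function.ne_iff.1 this
    have h1 : v i ^ 2 ≤ ∑ i, v i ^ 2 :=
      Finset.single_le_sum (f := fun i => v i ^ 2) (fun i _ => sq_nonneg _) (Finset.mem_univ i)
    have h2 : 0 < v i ^ 2 := by have : v i ≠ 0 := hi; positivity
    nlinarith [sq_nonneg (1 - ‖v‖)]
  · have h1 : 0 ≤ ∑ i, v i ^ 2 := Finset.sum_nonneg fun i _ => sq_nonneg _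
    have h2 : 1 - ‖v‖ ≠ 0 := fun h' => h (by linarith)
    positivity

/-- The vector representing the image of a point in the cube under the collapse of the boundary
to the north pole. -/
noncomputable def collapseVec (v : Fin d → ℝ) : EuclideanSpace ℝ (Fin (d + 1)) :=
  WithLp.toLp 2 (Fin.snoc (α := fun _ => ℝ) (fun i => 2 * (1 - ‖v‖) * v i / collapseDen v)
    ((∑ i, v i ^ 2 - (1 - ‖v‖) ^ 2) / collapseDen v))

theorem collapseVec_castSucc (v : Fin d → ℝ) (i : Fin d) :
    collapseVec v i.castSucc = 2 * (1 - ‖v‖) * v i / collapseDen v := by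
  simp [collapseVec]

theorem collapseVec_last (v : Fin d → ℝ) :
    collapseVec v (Fin.last d) = (∑ i, v i ^ 2 - (1 - ‖v‖) ^ 2) / collapseDen v := by
  simp [collapseVec]

theorem continuous_collapseDen : Continuous (collapseDen : (Fin d → ℝ) → ℝ) := by
  unfold collapseDen; fun_prop

theorem continuous_collapseVec : Continuous (collapseVec : (Fin d → ℝ) → _) := by
  refine (PiLp.continuous_toLp 2 _).comp (continuous_pi fun i => ?_)
  have hD := continuous_collapseDen (d := d)
  have hD' : ∀ v : Fin d → ℝ, collapseDen v ≠ 0 := fun v => (collapseDen_pos v).ne'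
  refine Fin.lastCases ?_ (fun i => ?_) i
  · simp only [Fin.snoc_last]
    exact Continuous.div (by fun_prop) hD hD'
  · simp only [Fin.snoc_castSucc]
    exact Continuous.div (by fun_prop) hD hD'

theorem collapseVec_mem (v : Fin d → ℝ) : collapseVec v ∈ Sph d := by
  have hD := (collapseDen_pos v).ne'
  rw [mem_Sph_iff, Fin.sum_univ_castSucc]
  simp only [collapseVec_castSucc, collapseVec_last, div_pow, mul_pow, ← Finset.sum_div,
    ← Finset.mul_sum]
  rw [← add_div, div_eq_one_iff_eq (pow_ne_zero 2 hD), collapseDen]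
  ring

theorem one_sub_collapseVec_last (v : Fin d → ℝ) :
    1 - collapseVec v (Fin.last d) = 2 * (1 - ‖v‖) ^ 2 / collapseDen v := by
  have hD := (collapseDen_pos v).ne'
  rw [collapseVec_last, eq_div_iff hD, sub_mul, div_mul_cancel₀ _ hD, collapseDen]
  ring

theorem collapseVec_div {v : Fin d → ℝ} (hv : ‖v‖ ≠ 1) (i : Fin d) :
    collapseVec v i.castSucc / (1 - collapseVec v (Fin.last d)) = v i / (1 - ‖v‖) := by
  have hD := (collapseDen_pos v).ne'
  have h2 : 1 - ‖v‖ ≠ 0 := fun h' => hv (by linarith)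
  rw [one_sub_collapseVec_last, collapseVec_castSucc]
  field_simp

/-- A continuous surjection from the cube to the sphere collapsing the boundary of the cube to
the north pole and injective on the interior. -/
theorem exists_collapse (hd : 0 < d) : ∃ c : (Fin d → I) → Sph d, Continuous c ∧
    Function.Surjective c ∧ (∀ x ∈ Cube.boundary (Fin d), c x = northPole d) ∧
    ∀ x x', c x = c x' → x = x' ∨ x ∈ Cube.boundary (Fin d) ∧ x' ∈ Cube.boundary (Fin d) := by
  have hN : ∀ v : Fin d → ℝ, ‖v‖ = 1 → (⟨collapseVec v, collapseVec_mem v⟩ : Sph d) =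
      northPole d := fun v hv => by
    apply Subtype.ext
    ext i
    have hD := (collapseDen_pos v).ne'
    have := one_sub_collapseVec_last v
    rw [hv] at this
    refine Fin.lastCases ?_ (fun i => ?_) i
    · simp only [northPole]
      simp at this ⊢
      linarith
    · simp [northPole, collapseVec_castSucc, hv]
  have hlast : ∀ v : Fin d → ℝ, ‖v‖ ≤ 1 → (‖v‖ = 1 ↔ collapseVec v (Fin.last d) = 1) :=
      fun v hv => by
    have hD := (collapseDen_pos v).ne'
    have h := one_sub_collapseVec_last v
    constructor
    · intro h1; rw [h1] at h; simp at h; linarith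
    · intro h1
      rw [h1, sub_self, eq_comm, div_eq_zero_iff] at h
      have : (1 - ‖v‖) ^ 2 = 0 := by
        rcases h with h | h
        · linarith
        · exact absurd h hD
      have := pow_eq_zero_iff (two_ne_zero) |>.1 this
      linarith
  refine ⟨fun x => ⟨collapseVec (cubeVec x), collapseVec_mem _⟩,
    (continuous_collapseVec.comp continuous_cubeVec).subtype_mk _, fun y => ?_,
    fun x hx => hN _ ((mem_boundary_iff_norm x).1 hx), fun x x' h => ?_⟩
  · by_cases hy : y.1 (Fin.last d) = 1
    · refine ⟨fun _ => 0, (hN _ ((mem_boundary_iff_norm _).1 ⟨⟨0, hd⟩, Or.inl rfl⟩)).trans ?_⟩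
      have hs := Sph_sum_sq y
      rw [Fin.sum_univ_castSucc, hy] at hs
      have h0 : ∑ i : Fin d, y.1 i.castSucc ^ 2 = 0 := by linarith
      rw [Finset.sum_eq_zero_iff_of_nonneg fun i _ => sq_nonneg _] at h0
      apply Subtype.ext
      ext i
      refine Fin.lastCases ?_ (fun i => ?_) i
      · simp [northPole, hy]
      · have := pow_eq_zero_iff (two_ne_zero) |>.1 (h0 i (Finset.mem_univ i))
        simp [northPole, this]
    · obtain ⟨a, ha⟩ : ∃ a, a = 1 - y.1 (Fin.last d) := ⟨_, rfl⟩
      have ha0 : a ≠ 0 := fun h => hy (by linarith)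
      obtain ⟨w, hw⟩ : ∃ w : Fin d → ℝ, w = fun i => y.1 i.castSucc / a := ⟨_, rfl⟩
      have hn : 0 < 1 + ‖w‖ := by positivity
      have hv : ‖(1 + ‖w‖)⁻¹ • w‖ = ‖w‖ / (1 + ‖w‖) := by
        rw [norm_smul, Real.norm_eq_abs, abs_of_pos (inv_pos.2 hn)]; field_simp
      have hv' : 1 - ‖(1 + ‖w‖)⁻¹ • w‖ = (1 + ‖w‖)⁻¹ := by rw [hv]; field_simp; ring
      obtain ⟨x, hx⟩ := cubeVec_surjective (v := (1 + ‖w‖)⁻¹ • w) (by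
        have := inv_pos.2 hn; linarith)
      refine ⟨x, Subtype.ext ?_⟩
      have hs := Sph_sum_sq y
      rw [Fin.sum_univ_castSucc] at hs
      have hl : y.1 (Fin.last d) = 1 - a := by linarith
      have hsw : ∑ i, w i ^ 2 = (2 - a) / a := by
        rw [hw]
        simp only [div_pow, ← Finset.sum_div]
        have : ∑ i : Fin d, y.1 i.castSucc ^ 2 = a * (2 - a) := by rw [hl] at hs; linarith
        rw [this]; field_simp
      have hsv : ∑ i, ((1 + ‖w‖)⁻¹ • w) i ^ 2 = (1 + ‖w‖)⁻¹ ^ 2 * ((2 - a) / a) := by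
        rw [← hsw, Finset.mul_sum]
        simp [mul_pow]
      have hden : collapseDen ((1 + ‖w‖)⁻¹ • w) = (1 + ‖w‖)⁻¹ ^ 2 * (2 / a) := by
        rw [collapseDen, hsv, hv']; field_simp; ring
      ext i
      change collapseVec (cubeVec x) i = _
      rw [hx]
      refine Fin.lastCases ?_ (fun i => ?_) i
      · rw [collapseVec_last, hden, hsv, hv', hl]; field_simp; ring
      · rw [collapseVec_castSucc, hden, hv', Pi.smul_apply, smul_eq_mul, hw]; field_simp
  · have h' : collapseVec (cubeVec x) = collapseVec (cubeVec x') := congrArg Subtype.val h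
    have e1 := hlast _ (norm_cubeVec_le x)
    have e2 := hlast _ (norm_cubeVec_le x')
    rw [mem_boundary_iff_norm, mem_boundary_iff_norm]
    rw [← h', ← e1] at e2
    by_cases hx : ‖cubeVec x‖ = 1
    · exact Or.inr ⟨hx, e2.2 hx⟩
    · left
      have hx' : ‖cubeVec x'‖ ≠ 1 := fun h => hx (e2.1 h)
      have l1 := lt_of_le_of_ne (norm_cubeVec_le x) hx
      have l2 := lt_of_le_of_ne (norm_cubeVec_le x') hx'
      have q : (1 - ‖cubeVec x‖)⁻¹ • cubeVec x = (1 - ‖cubeVec x'‖)⁻¹ • cubeVec x' := by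
        ext i
        have := collapseVec_div hx i
        rw [h', collapseVec_div hx' i] at this
        simp only [Pi.smul_apply, smul_eq_mul]
        rw [inv_mul_eq_div, inv_mul_eq_div, this]
      have qn := congrArg norm q
      rw [norm_smul, norm_smul, Real.norm_eq_abs, Real.norm_eq_abs,
        abs_of_pos (inv_pos.2 (by linarith)), abs_of_pos (inv_pos.2 (by linarith)),
        inv_mul_eq_div, inv_mul_eq_div, div_eq_div_iff (by linarith) (by linarith)] at qn
      have hnn : ‖cubeVec x‖ = ‖cubeVec x'‖ := by linarith
      rw [hnn] at q
      exact cubeVec_injective (smul_right_injective _ (inv_ne_zero (by linarith)) q)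

end Collapse

/-! ### Idempotents over spheres induced by generalized loops -/

section Loops

open scoped Topology.Homotopy

variable {d : ℕ} {Y : Type} [TopologicalSpace Y] {y₀ : Y}

/-- A collapse of the boundary of the cube to the north pole of the sphere. -/
structure IsCollapse (c : (Fin d → I) → Sph d) : Prop where
  continuous : Continuous c
  surjective : Function.Surjective c
  apply_boundary : ∀ x ∈ Cube.boundary (Fin d), c x = northPole d
  eq_or_boundary : ∀ x x', c x = c x' →
    x = x' ∨ x ∈ Cube.boundary (Fin d) ∧ x' ∈ Cube.boundary (Fin d)

variable {c : (Fin d → I) → Sph d}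

/-- The map on the sphere induced by a generalized loop. -/
noncomputable def loopDescent (hc : IsCollapse c) (b : Ω^ (Fin d) Y y₀) (y : Sph d) : Y :=
  b (Function.surjInv hc.surjective y)

theorem loopDescent_apply (hc : IsCollapse c) (b : Ω^ (Fin d) Y y₀) (x : Fin d → I) :
    loopDescent hc b (c x) = b x := by
  rcases hc.eq_or_boundary _ _ (Function.surjInv_eq hc.surjective (c x)) with h | ⟨h, h'⟩
  · exact congrArg b h
  · exact (b.2 _ h).trans (b.2 _ h').symm

theorem continuous_loopDescent (hc : IsCollapse c) (b : Ω^ (Fin d) Y y₀) :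
    Continuous (loopDescent hc b) := by
  refine (IsQuotientMap.of_surjective_continuous hc.surjective hc.continuous).continuous_iff.2 ?_
  have : loopDescent hc b ∘ c = b := funext (loopDescent_apply hc b)
  rw [this]
  exact b.1.2

@[simp] theorem loopDescent_const (hc : IsCollapse c) (y : Sph d) :
    loopDescent hc (GenLoop.const : Ω^ (Fin d) Y y₀) y = y₀ := rfl

variable {κ ι : Type} [Fintype κ] [DecidableEq κ] [Fintype ι] [DecidableEq ι]
  {φ : Y → Matrix κ κ ℂ}

theorem mvN_of_homotopic (hc : IsCollapse c) (hφ : Continuous φ) (hφi : ∀ y, φ y * φ y = φ y)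
    {b b' : Ω^ (Fin d) Y y₀} (h : GenLoop.Homotopic b b') :
    MvN (fun y => φ (loopDescent hc b y)) fun y => φ (loopDescent hc b' y) := by
  obtain ⟨H⟩ := h
  have hb : ∀ (t : I) (x : Fin d → I), x ∈ Cube.boundary (Fin d) → H (t, x) = y₀ :=
    fun t x hx => (H.eq_fst t hx).trans (b.2 x hx)
  obtain ⟨K, hK, hKc⟩ := exists_descend c hc.continuous hc.surjective
    (fun (t : I) x => φ (H (t, x))) (hφ.comp (map_continuous H.toHomotopy)) fun t x x' hx => by
      rcases hc.eq_or_boundary _ _ hx with rfl | ⟨h1, h2⟩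
      · rfl
      · simp only [hb t x h1, hb t x' h2]
  have := mvN_of_homotopy (fun y t => K t y) (hK.comp continuous_swap) fun y t => by
    obtain ⟨x, rfl⟩ := hc.surjective y
    rw [hKc, hφi]
  have e0 : ∀ y, K 0 y = φ (loopDescent hc b y) := fun y => by
    obtain ⟨x, rfl⟩ := hc.surjective y
    rw [hKc, loopDescent_apply]; simp
  have e1 : ∀ y, K 1 y = φ (loopDescent hc b' y) := fun y => by
    obtain ⟨x, rfl⟩ := hc.surjective y
    rw [hKc, loopDescent_apply]; simp
  simpa only [e0, e1] using this.symm

/-- Idempotents differing from a constant on disjoint sets can be added up to stabilization. -/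
theorem mvN_of_disjoint {X : Type} [TopologicalSpace X] [CompactSpace X]
    {p q : X → Matrix κ κ ℂ} {e : Matrix κ κ ℂ} (hpc : Continuous p) (hp : ∀ x, p x * p x = p x)
    (hqc : Continuous q) (hq : ∀ x, q x * q x = q x) (he : e * e = e)
    (h : ∀ x, p x = e ∨ q x = e) :
    MvN (fun x => (p x + q x - e) ⊞ₘ e) fun x => p x ⊞ₘ q x := by
  obtain ⟨E, hE⟩ : ∃ E, E = fun x (t : I) => (p x ⊞ₘ e) +
      (rotBlock κ t * (q x ⊞ₘ e) * rotBlock κ (-t) - (e ⊞ₘ e)) := ⟨_, rfl⟩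
  have hr : Continuous fun z : X × I => rotBlock κ (z.2 : ℝ) :=
    (continuous_rotBlock (ι := κ)).comp (by fun_prop)
  have hr' : Continuous fun z : X × I => rotBlock κ (-(z.2 : ℝ)) :=
    (continuous_rotBlock (ι := κ)).comp (by fun_prop)
  have hEc : Continuous fun z : X × I => E z.1 z.2 := by
    rw [hE]
    have c1 : Continuous fun z : X × I => p z.1 ⊞ₘ e := by fun_prop
    have c2 : Continuous fun z : X × I => q z.1 ⊞ₘ e := by fun_prop
    exact c1.add (((hr.matrix_mul c2).matrix_mul hr').sub continuous_const)
  have hcomm : ∀ t : ℝ, rotBlock κ t * (e ⊞ₘ e) * rotBlock κ (-t) = e ⊞ₘ e := fun t => by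
    have : rotBlock κ t * (e ⊞ₘ e) = (e ⊞ₘ e) * rotBlock κ t := by
      simp [rotBlock, Matrix.fromBlocks_multiply]
    rw [this, Matrix.mul_assoc, rotBlock_mul_neg, Matrix.mul_one]
  have hEi : ∀ x t, E x t * E x t = E x t := fun x t => by
    rcases h x with hx | hx
    · have h1 : E x t = rotBlock κ t * (q x ⊞ₘ e) * rotBlock κ (-t) := by
        rw [hE]; simp only [hx]; abel
      rw [h1]
      calc _ = rotBlock κ t * ((q x ⊞ₘ e) * (rotBlock κ (-t) * rotBlock κ t) * (q x ⊞ₘ e)) *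
            rotBlock κ (-t) := by simp only [Matrix.mul_assoc]
        _ = _ := by
          rw [rotBlock_neg_mul, Matrix.mul_one]
          simp [Matrix.fromBlocks_multiply, hq, he]
    · have h1 : E x t = p x ⊞ₘ e := by
        rw [hE]; simp only [hx, hcomm]; abel
      rw [h1]
      simp [Matrix.fromBlocks_multiply, hp, he]
  have := mvN_of_homotopy E hEc hEi
  have e0 : ∀ x, E x 0 = (p x + q x - e) ⊞ₘ e := fun x => by
    rw [hE]
    ext (i | i) (j | j) <;> simp [add_sub_assoc]
  have e1 : ∀ x, E x 1 = p x ⊞ₘ q x := fun x => by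
    rw [hE]
    simp only [Set.Icc.coe_one, rotBlock_one, rotBlock_neg_one, Matrix.fromBlocks_multiply]
    ext (i | i) (j | j) <;> simp
  simpa only [e0, e1] using this.symm

theorem mvN_transAt (hc : IsCollapse c) (hφ : Continuous φ) (hφi : ∀ y, φ y * φ y = φ y)
    [Nonempty (Fin d)] (i : Fin d) (b b' : Ω^ (Fin d) Y y₀) :
    MvN (fun y => φ (loopDescent hc (GenLoop.transAt i b b') y) ⊞ₘ φ y₀)
      fun y => φ (loopDescent hc b y) ⊞ₘ φ (loopDescent hc b' y) := by
  have hl : GenLoop.Homotopic (GenLoop.transAt i b GenLoop.const) b := by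
    have h := HomotopyGroup.mul_spec (i := i) (p := (GenLoop.const : Ω^ (Fin d) Y y₀)) (q := b)
    rw [← HomotopyGroup.one_def] at h
    exact Quotient.exact (h.symm.trans (one_mul _))
  have hr : GenLoop.Homotopic (GenLoop.transAt i GenLoop.const b') b' := by
    have h := HomotopyGroup.mul_spec (i := i) (p := b') (q := (GenLoop.const : Ω^ (Fin d) Y y₀))
    rw [← HomotopyGroup.one_def] at h
    exact Quotient.exact (h.symm.trans (mul_one _))
  have hcont : ∀ b : Ω^ (Fin d) Y y₀, Continuous fun y => φ (loopDescent hc b y) := fun b =>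
    hφ.comp (continuous_loopDescent hc b)
  have key : ∀ y, (φ (loopDescent hc (GenLoop.transAt i b GenLoop.const) y) = φ y₀ ∧
        φ (loopDescent hc (GenLoop.transAt i b b') y) =
          φ (loopDescent hc (GenLoop.transAt i GenLoop.const b') y)) ∨
      (φ (loopDescent hc (GenLoop.transAt i GenLoop.const b') y) = φ y₀ ∧
        φ (loopDescent hc (GenLoop.transAt i b b') y) =
          φ (loopDescent hc (GenLoop.transAt i b GenLoop.const) y)) := fun y => by
    obtain ⟨x, rfl⟩ := hc.surjective y
    simp only [loopDescent_apply, GenLoop.transAt, GenLoop.coe_copy]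
    by_cases hx : (x i : ℝ) ≤ 1 / 2
    · right; simp only [hx, if_true]; exact ⟨rfl, trivial⟩
    · left; simp only [hx, if_false]; exact ⟨rfl, trivial⟩
  have hsum := mvN_of_disjoint (hcont (GenLoop.transAt i b GenLoop.const)) (fun y => hφi _)
    (hcont (GenLoop.transAt i GenLoop.const b')) (fun y => hφi _) (hφi y₀)
    fun y => (key y).imp And.left And.left
  have hval : ∀ y, φ (loopDescent hc (GenLoop.transAt i b GenLoop.const) y) +
      φ (loopDescent hc (GenLoop.transAt i GenLoop.const b') y) - φ y₀ =
      φ (loopDescent hc (GenLoop.transAt i b b') y) := fun y => by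
    rcases key y with ⟨h1, h2⟩ | ⟨h1, h2⟩ <;> rw [h1, h2] <;> abel
  simp only [hval] at hsum
  exact hsum.trans ((mvN_of_homotopic hc hφ hφi hl).blockSum (mvN_of_homotopic hc hφ hφi hr))
    (fun y => by simp [Matrix.fromBlocks_multiply, hφi])
    fun y => by simp [Matrix.fromBlocks_multiply, hφi]

theorem MvN.dup_one {p : Y → Matrix κ κ ℂ} (hpc : Continuous p) (hp : ∀ x, p x * p x = p x) :
    MvN p fun x => _root_.dup 1 (p x) := by
  have := MvN.reindex (Equiv.prodUnique κ (Fin 1)) hpc hp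
  convert this using 2 with x
  ext ⟨i, a⟩ ⟨j, b⟩
  simp [_root_.dup, Matrix.blockDiagonal_apply, Subsingleton.elim a b]

/-- The class of a generalized loop in the homotopy group. -/
def loopClass (b : Ω^ (Fin d) Y y₀) : HomotopyGroup (Fin d) Y y₀ := ⟦b⟧

theorem exists_loop_pow (hc : IsCollapse c) (hφ : Continuous φ) (hφi : ∀ y, φ y * φ y = φ y)
    [Nonempty (Fin d)] (b : Ω^ (Fin d) Y y₀) (r : ℕ) : ∃ (b' : Ω^ (Fin d) Y y₀) (μ ν : Type)
      (_ : Fintype μ) (_ : DecidableEq μ) (_ : Fintype ν) (_ : DecidableEq ν)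
      (e : Matrix μ μ ℂ) (e' : Matrix ν ν ℂ),
      loopClass b' = loopClass b ^ r ∧
      e * e = e ∧ e' * e' = e' ∧
      MvN (fun y => φ (loopDescent hc b' y) ⊞ₘ e)
        fun y => dup r (φ (loopDescent hc b y)) ⊞ₘ e' := by
  have hcont : ∀ b : Ω^ (Fin d) Y y₀, Continuous fun y => φ (loopDescent hc b y) := fun b =>
    hφ.comp (continuous_loopDescent hc b)
  have hi : ∀ (b : Ω^ (Fin d) Y y₀) (y), φ (loopDescent hc b y) * φ (loopDescent hc b y) =
    φ (loopDescent hc b y) := fun _ _ => hφi _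
  induction r with
  | zero =>
    refine ⟨GenLoop.const, κ × Fin 0, κ, inferInstance, inferInstance, inferInstance,
      inferInstance, 0, φ y₀, by rw [pow_zero]; rfl, by simp, hφi _, ?_⟩
    have := MvN.comm (X := Sph d) (p := fun _ => φ y₀)
      (q := fun _ => (0 : Matrix (κ × Fin 0) (κ × Fin 0) ℂ)) continuous_const (fun _ => hφi _)
      continuous_const (by simp)
    have h0 : ∀ y, dup 0 (φ (loopDescent hc b y)) = 0 := fun y => Subsingleton.elim _ _
    simpa only [h0, loopDescent_const] using this
  | succ r ih =>
    obtain ⟨b', μ, ν, _, _, _, _, e, e', hb, he, he', h⟩ := ih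
    obtain ⟨i⟩ := ‹Nonempty (Fin d)›
    have : Nonempty (Fin d) := ⟨i⟩
    refine ⟨GenLoop.transAt i b b', κ ⊕ μ, ν, inferInstance, inferInstance, inferInstance,
      inferInstance, φ y₀ ⊞ₘ e, e', ?_, ?_, he', ?_⟩
    · rw [pow_succ, ← hb]
      exact (HomotopyGroup.mul_spec (i := i) (p := b') (q := b)).symm
    · simp [Matrix.fromBlocks_multiply, hφi, he]
    have s1 := (MvN.assoc (X := Sph d) (hcont (GenLoop.transAt i b b')) (hi _)
      (q := fun _ => φ y₀) continuous_const (fun _ => hφi _)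
      (r := fun _ => e) continuous_const (fun _ => he)).symm
    have s2 := (mvN_transAt hc hφ hφi i b b').blockSum
      (MvN.refl (X := Sph d) (p := fun _ => e) continuous_const (fun _ => he))
    have s3 := MvN.assoc (X := Sph d) (hcont b) (hi _) (hcont b') (hi _)
      (r := fun _ => e) continuous_const (fun _ => he)
    have s4 := (MvN.dup_one (hcont b) (hi b)).blockSum h
    have hd : ∀ r y, dup r (φ (loopDescent hc b y)) * dup r (φ (loopDescent hc b y)) =
      dup r (φ (loopDescent hc b y)) := fun r y => dup_idem (hi b y) r
    have s5 := (MvN.assoc ((hcont b).dup 1) (hd 1) ((hcont b).dup r) (hd r)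
      (r := fun _ => e') continuous_const (fun _ => he')).symm
    have s6 := (MvN.dup_add (hcont b) (hi b) 1 r).symm.blockSum
      (MvN.refl (X := Sph d) (p := fun _ => e') continuous_const (fun _ => he'))
    rw [add_comm r 1]
    refine ((((s1.trans s2 ?_ ?_).trans s3 ?_ ?_).trans s4 ?_ ?_).trans s5 ?_ ?_).trans s6 ?_ ?_ <;>
      intro y <;> simp [Matrix.fromBlocks_multiply, hφi, he, he', hd]

/-- A generalized loop inducing an idempotent of infinite order has infinite order. -/
theorem not_isOfFinOrder_of_infiniteOrder (hc : IsCollapse c) (hφ : Continuous φ)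
    (hφi : ∀ y, φ y * φ y = φ y) [Nonempty (Fin d)] (b : Ω^ (Fin d) Y y₀)
    (h : InfiniteOrder fun y => φ (loopDescent hc b y)) :
    ¬ IsOfFinOrder (loopClass b) := by
  intro hfin
  obtain ⟨r, hr, hbr⟩ := isOfFinOrder_iff_pow_eq_one.1 hfin
  obtain ⟨b', μ, ν, _, _, _, _, e, e', hb, he, he', hm⟩ := exists_loop_pow hc hφ hφi b r
  rw [hbr, HomotopyGroup.one_def] at hb
  have h1 := mvN_of_homotopic hc hφ hφi (Quotient.exact hb)
  simp only [loopDescent_const] at h1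
  have h2 := h1.blockSum (MvN.refl (X := Sph d) (p := fun _ => e) continuous_const (fun _ => he))
  refine hr.ne' (h r (stablyTrivial_of_const (fun y => dup_idem (hφi _) r) e' he' (φ y₀ ⊞ₘ e)
    (by simp [Matrix.fromBlocks_multiply, hφi, he]) (hm.symm.trans h2 (fun y => ?_) fun y => ?_)))
  · have := dup_idem (hφi (loopDescent hc b y)) r
    simp [Matrix.fromBlocks_multiply, this, he']
  · simp [Matrix.fromBlocks_multiply, hφi, he]

end Loops

/-! ### The loop conjugating a fixed family along a frame -/

section Main

theorem pathConnectedSpace_Sph {d : ℕ} (hd : 0 < d) : PathConnectedSpace (Sph d) :=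
  isPathConnected_iff_pathConnectedSpace.1 (isPathConnected_sphere (by
    rw [← Module.finrank_eq_rank]
    simp only [finrank_euclideanSpace, Fintype.card_fin]
    exact_mod_cast (by omega : 1 < d + 1)) 0 zero_le_one)

theorem conj_mem_Gamma {m : ℕ} {A J : Matrix (Fin m ⊕ Fin m) (Fin m ⊕ Fin m) ℝ}
    (hA : Aᵀ * A = 1) (hJ : J ∈ Gamma m) : A * J * Aᵀ ∈ Gamma m := by
  have hA' : A * Aᵀ = 1 := mul_eq_one_comm.1 hA
  constructor
  · rw [Matrix.transpose_mul, Matrix.transpose_mul, Matrix.transpose_transpose]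
    calc A * (Jᵀ * Aᵀ) * (A * J * Aᵀ) = A * (Jᵀ * (Aᵀ * A) * J) * Aᵀ := by
          simp only [Matrix.mul_assoc]
      _ = 1 := by rw [hA, Matrix.mul_one, hJ.1, Matrix.mul_one, hA']
  · calc A * J * Aᵀ * (A * J * Aᵀ) = A * (J * (Aᵀ * A) * J) * Aᵀ := by
          simp only [Matrix.mul_assoc]
      _ = -1 := by rw [hA, Matrix.mul_one, hJ.2, Matrix.mul_neg, Matrix.mul_one, Matrix.neg_mul, hA']

open scoped Topology.Homotopy in
theorem exists_infinite_order_loop {d n k : ℕ} (hd : d = 4 * k + 2) (hk : d ≤ 2 * n)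
    [Nonempty (Fin d)] (f : C(Sph (2 * n + 1), GammaPlus (n + 1))) :
    ∃ b : Ω^ (Fin d) C(Sph (2 * n + 1), GammaPlus (n + 1)) f, ¬ IsOfFinOrder (loopClass b) := by
  obtain ⟨g, hg, hgN⟩ : ∃ g : Sph d → Matrix (Fin (n + 1) ⊕ Fin (n + 1)) _ ℝ,
      IsInfiniteFamily g ∧ g (northPole _) = J0 (n + 1) := by
    have h2 : d = 2 * (2 * k + 1) := by omega
    subst h2
    exact exists_infiniteOrder_complexStructure (by omega)
  obtain ⟨c, hc1, hc2, hc3, hc4⟩ := exists_collapse (d := d) (by omega)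
  have hc : IsCollapse c := ⟨hc1, hc2, hc3, hc4⟩
  have := pathConnectedSpace_Sph (d := d) (by omega)
  obtain ⟨A, hA, hAo, hAe⟩ := exists_orthogonal_lift (n := n)
    (J := fun y => ((f y).1 : Matrix (Fin (n + 1) ⊕ Fin (n + 1)) _ ℝ)) (by fun_prop)
    fun y => (f y).1.2
  have hAo' : ∀ y, A y * (A y)ᵀ = 1 := fun y => mul_eq_one_comm.1 (hAo y)
  have hgc := hg.continuous
  have hmem : ∀ z y, A y * g z * (A y)ᵀ ∈ Gamma (n + 1) := fun z y =>
    conj_mem_Gamma (hAo y) ⟨hg.transpose_mul z, hg.mul_self z⟩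
  have hbase : ∀ y, A y * g (northPole d) * (A y)ᵀ = (f y).1 := fun y => by
    rw [hgN, hAe, Matrix.mul_assoc, hAo', Matrix.mul_one]
  have hplus : ∀ z y, (⟨_, hmem z y⟩ : Gamma (n + 1)) ∈ GammaPlus (n + 1) := fun z y => by
    have h1 : Joined (⟨_, hmem (northPole d) y⟩ : Gamma (n + 1)) ⟨_, hmem z y⟩ :=
      ((PathConnectedSpace.joined (northPole d) z).map
        (f := fun z => (⟨_, hmem z y⟩ : Gamma (n + 1))) (by fun_prop))
    have h2 : (⟨_, hmem (northPole d) y⟩ : Gamma (n + 1)) = (f y).1 := Subtype.ext (hbase y)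
    rw [h2] at h1
    exact Joined.trans (f y).2 h1
  have hcont : Continuous fun p : (Fin d → I) × Sph (2 * n + 1) =>
      (⟨⟨_, hmem (c p.1) p.2⟩, hplus (c p.1) p.2⟩ : GammaPlus (n + 1)) := by
    refine Continuous.subtype_mk (Continuous.subtype_mk ?_ _) _
    have c1 : Continuous fun p : (Fin d → I) × Sph (2 * n + 1) => A p.2 := by fun_prop
    have c2 : Continuous fun p : (Fin d → I) × Sph (2 * n + 1) => g (c p.1) :=
      hgc.comp (hc1.comp continuous_fst)
    exact (c1.matrix_mul c2).matrix_mul c1.matrix_transpose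
  obtain ⟨b, hb⟩ : ∃ b : Ω^ (Fin d) C(Sph (2 * n + 1), GammaPlus (n + 1)) f,
      ∀ τ y, ((b τ y).1 : Matrix (Fin (n + 1) ⊕ Fin (n + 1)) _ ℝ) = A y * g (c τ) * (A y)ᵀ :=
    ⟨⟨ContinuousMap.curry ⟨_, hcont⟩, fun τ hτ => ContinuousMap.ext fun y =>
      Subtype.ext (Subtype.ext ((congrArg (fun z => A y * g z * (A y)ᵀ) (hc3 τ hτ)).trans
        (hbase y)))⟩, fun _ _ => rfl⟩
  obtain ⟨y₁⟩ : Nonempty (Sph (2 * n + 1)) := ⟨northPole _⟩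
  obtain ⟨φ, hφ⟩ : ∃ φ, φ = fun F : C(Sph (2 * n + 1), GammaPlus (n + 1)) =>
    eigProj ((F y₁).1 : Matrix (Fin (n + 1) ⊕ Fin (n + 1)) _ ℝ) := ⟨_, rfl⟩
  refine ⟨b, not_isOfFinOrder_of_infiniteOrder hc (φ := φ) ?_ (fun F => ?_) b ?_⟩
  · rw [hφ]
    exact continuous_eigProj.comp (by fun_prop)
  · rw [hφ]
    exact eigProj_mul_self (F y₁).1.2.2
  · have hval : ∀ z, φ (loopDescent hc b z) = eigProj (A y₁ * g z * (A y₁)ᵀ) := fun z => by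
      obtain ⟨τ, rfl⟩ := hc2 z
      rw [loopDescent_apply, hφ, ← hb]
    simp only [hval]
    exact (hg.conj (Q := fun _ => A y₁) continuous_const fun _ => hAo y₁).infiniteOrder

end Main

end

/-- For `1 ≤ 4k+1 ≤ 2n-1` and every `f ∈ C(S^{2n+1}, Γ_{n+1}⁺)`, the homotopy group
`π_{4k+2}(C(S^{2n+1}, Γ_{n+1}⁺), f)` contains an element of infinite order. -/
theorem stmt8 (n k : ℕ) (hn : 1 ≤ n) (hk : 4 * k + 1 ≤ 2 * n - 1)
    (f : C(Sph (2 * n + 1), GammaPlus (n + 1))) :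
    ∃ γ : π_ (4 * k + 2) C(Sph (2 * n + 1), GammaPlus (n + 1)) f, ¬ IsOfFinOrder γ := by
  obtain ⟨b, hb⟩ := exists_infinite_order_loop (d := 4 * k + 2) (n := n) rfl (by omega) f
  exact ⟨loopClass b, hb⟩
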